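/- arXiv:2012.02747 — 2 statements merged into one kernel-verified Lean document; each statement's English description precedes it below -/
import Mathlib

section
/- Let 0 < δ < 1, C > 1 and 0 < α < 1. Let X ⊆ [0,1] be a δ-regular set on scales [α,1] with constant C, and let μ_X be an associated regular measure. Then there exist an absolute constant c > 0 and a constant A depending only on C and δ such that for every α ≤ r < 1 one has E(μ_X, r) ≤ A · r^{δ+β}, where β = c · min(δ, 1−δ) · C^{−25}. -/
open MeasureTheory Metric Set
open scoped ENNReal Pointwise

/-- The additive energy `E(μ, r)` of a measure `μ` at scale `r`: the fourfold product
measure of the set where `|x₁ + x₂ - x₃ - x₄| ≤ r`. -/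
noncomputable def addEnergy {E : Type*} [NormedAddCommGroup E] [MeasurableSpace E]
    (μ : Measure E) (r : ℝ) : ℝ≥0∞ :=
  (μ.prod (μ.prod (μ.prod μ)))
    {p : E × E × E × E | ‖p.1 + p.2.1 - p.2.2.1 - p.2.2.2‖ ≤ r}

/-- `μ` is a regular measure associated to the `δ`-regular set `X` on scales `[α₀, α₁]`
with constant `C`: it is a Radon measure (finite on compacts) supported on `X`, with
`μ(B(x,r)) ≤ C rᵟ` for all balls with radius `r ∈ [α₀,α₁]`, and `μ(B(x,r)) ≥ C⁻¹ rᵟ`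
whenever moreover `x ∈ X`. -/
def IsRegularMeasure {E : Type*} [NormedAddCommGroup E] [MeasurableSpace E]
    (δ α₀ α₁ C : ℝ) (X : Set E) (μ : Measure E) : Prop :=
  (∀ K : Set E, IsCompact K → μ K < ⊤) ∧
  μ Xᶜ = 0 ∧
  (∀ (x : E) (r : ℝ), α₀ ≤ r → r ≤ α₁ →
    μ (closedBall x r) ≤ ENNReal.ofReal (C * r ^ δ)) ∧
  (∀ x ∈ X, ∀ r : ℝ, α₀ ≤ r → r ≤ α₁ →
    ENNReal.ofReal (C⁻¹ * r ^ δ) ≤ μ (closedBall x r))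


/-- Double counting for a relation `R` between two finite measure spaces. -/
lemma mul_measureReal_le_of_relation {A B : Type*} [MeasurableSpace A] [MeasurableSpace B]
    (τ : Measure A) (ν : Measure B) [IsFiniteMeasure τ] [IsFiniteMeasure ν]
    {R : Set (A × B)} (hR : MeasurableSet R) {m M : ℝ} (hM : 0 ≤ M)
    {S : Set A} (hS : MeasurableSet S) {L : Set B} (hL : MeasurableSet L)
    (h₁ : ∀ᵐ a ∂τ, a ∈ S → m ≤ ν.real {b | b ∈ L ∧ (a, b) ∈ R})
    (h₂ : ∀ b ∈ L, τ.real {a | a ∈ S ∧ (a, b) ∈ R} ≤ M) :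
    m * τ.real S ≤ M * ν.real L := by
  have key : ENNReal.ofReal m * τ S ≤ ENNReal.ofReal M * ν L := by
    set Q : Set (A × B) := R ∩ S ×ˢ L with hQ
    have hQm : MeasurableSet Q := hR.inter (hS.prod hL)
    calc ENNReal.ofReal m * τ S = ∫⁻ _ in S, ENNReal.ofReal m ∂τ := by simp
      _ ≤ ∫⁻ a in S, ν (Prod.mk a ⁻¹' Q) ∂τ := by
          refine lintegral_mono_ae ?_
          filter_upwards [ae_restrict_of_ae h₁, ae_restrict_mem hS] with a ha haS
          have : Prod.mk a ⁻¹' Q = {b | b ∈ L ∧ (a, b) ∈ R} := by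
            ext b; simp [hQ, haS, and_comm]
          rw [this]
          exact ENNReal.ofReal_le_of_le_toReal (ha haS)
      _ ≤ ∫⁻ a, ν (Prod.mk a ⁻¹' Q) ∂τ := setLIntegral_le_lintegral _ _
      _ = ∫⁻ b, τ ((fun a => (a, b)) ⁻¹' Q) ∂ν := by
          rw [← Measure.prod_apply hQm, Measure.prod_apply_symm hQm]
      _ ≤ ∫⁻ b, L.indicator (fun _ => ENNReal.ofReal M) b ∂ν := by
          refine lintegral_mono fun b => ?_
          by_cases hb : b ∈ L
          · have : (fun a => (a, b)) ⁻¹' Q = {a | a ∈ S ∧ (a, b) ∈ R} := by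
              ext a; simp [hQ, hb, and_comm]
            simp only [this, hb, indicator_of_mem]
            exact (ENNReal.le_ofReal_iff_toReal_le (measure_ne_top _ _) hM).2 (h₂ b hb)
          · have : (fun a => (a, b)) ⁻¹' Q = ∅ := by
              ext a; simp [hQ, hb]
            simp [this]
      _ = ENNReal.ofReal M * ν L := by rw [lintegral_indicator hL]; simp
  have := ENNReal.toReal_mono (by finiteness) key
  rw [ENNReal.toReal_mul, ENNReal.toReal_mul, ENNReal.toReal_ofReal hM] at this
  refine le_trans ?_ this
  gcongr
  · exact (le_max_left m 0).trans_eq ENNReal.toReal_ofReal'.symm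
  · exact le_rfl

lemma measureReal_prod_le {A B : Type*} [MeasurableSpace A] [MeasurableSpace B]
    (μ : Measure A) (ν : Measure B) [IsFiniteMeasure μ] [IsFiniteMeasure ν]
    {Q : Set (A × B)} (hQ : MeasurableSet Q) {S : Set A} (hS : MeasurableSet S)
    (hQS : ∀ p ∈ Q, p.1 ∈ S) {b : ℝ} (hb : 0 ≤ b)
    (h : ∀ a ∈ S, ν.real (Prod.mk a ⁻¹' Q) ≤ b) :
    (μ.prod ν).real Q ≤ b * μ.real S := by
  have key : (μ.prod ν) Q ≤ ENNReal.ofReal b * μ S := by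
    rw [Measure.prod_apply hQ]
    calc ∫⁻ a, ν (Prod.mk a ⁻¹' Q) ∂μ ≤ ∫⁻ a, S.indicator (fun _ => ENNReal.ofReal b) a ∂μ := by
          refine lintegral_mono fun a => ?_
          by_cases ha : a ∈ S
          · simp only [ha, indicator_of_mem]
            exact (ENNReal.le_ofReal_iff_toReal_le (measure_ne_top _ _) hb).2 (h a ha)
          · have : Prod.mk a ⁻¹' Q = ∅ := by
              ext c; simpa using fun hc => ha (hQS _ hc)
            simp [this]
      _ = _ := by rw [lintegral_indicator hS]; simp
  have := ENNReal.toReal_mono (by finiteness) key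
  rwa [ENNReal.toReal_mul, ENNReal.toReal_ofReal hb] at this

lemma le_measureReal_of_vitali (lam : Measure ℝ) [IsFiniteMeasure lam] {E : Set ℝ} (s : ℝ → ℝ)
    {m ρ D : ℝ} (hm : 0 ≤ m) (hs : ∀ z ∈ E, 0 < s z) (hsρ : ∀ z ∈ E, s z ≤ ρ)
    (hE : ∀ z ∈ E, m * s z ≤ lam.real (closedBall z (s z)))
    {V : Set ℝ} (hV : ∀ z ∈ E, closedBall z (s z) ⊆ V) (hD : ENNReal.ofReal D ≤ volume E) :
    m * D ≤ 10 * lam.real V := by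
  obtain ⟨u, huE, hdisj, hcov⟩ :=
    Vitali.exists_disjoint_subfamily_covering_enlargement_closedBall E id s ρ hsρ 5 (by norm_num)
  have hcount : u.Countable := by
    refine hdisj.countable_of_nonempty_interior fun z hz => ?_
    rw [interior_closedBall _ (hs z (huE hz)).ne']
    exact nonempty_ball.2 (hs z (huE hz))
  have key : ENNReal.ofReal m * volume E ≤ ENNReal.ofReal 10 * lam V := by
    calc ENNReal.ofReal m * volume E
        ≤ ENNReal.ofReal m * volume (⋃ z ∈ u, closedBall z (5 * s z)) := by
          gcongr
          intro z hz
          obtain ⟨b, hb, hsub⟩ := hcov z hz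
          exact mem_biUnion hb (hsub (mem_closedBall_self (hs z hz).le))
      _ ≤ ENNReal.ofReal m * ∑' z : u, volume (closedBall (z : ℝ) (5 * s z)) := by
          gcongr
          exact measure_biUnion_le _ hcount _
      _ = ∑' z : u, ENNReal.ofReal 10 * ENNReal.ofReal (m * s z) := by
          rw [← ENNReal.tsum_mul_left]
          congr 1 with z
          rw [Real.volume_closedBall, ← ENNReal.ofReal_mul hm, ← ENNReal.ofReal_mul (by norm_num)]
          congr 1; ring
      _ ≤ ∑' z : u, ENNReal.ofReal 10 * lam (closedBall (z : ℝ) (s z)) := by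
          gcongr with z
          exact ENNReal.ofReal_le_of_le_toReal (hE z (huE z.2))
      _ = ENNReal.ofReal 10 * lam (⋃ z ∈ u, closedBall z (s z)) := by
          rw [ENNReal.tsum_mul_left]
          congr 1
          exact (measure_biUnion hcount hdisj fun _ _ => measurableSet_closedBall).symm
      _ ≤ ENNReal.ofReal 10 * lam V := by
          gcongr
          exact iUnion₂_subset fun z hz => hV z (huE hz)
  have h2 : ENNReal.ofReal (m * D) ≤ ENNReal.ofReal 10 * lam V := by
    rw [ENNReal.ofReal_mul hm]
    exact (mul_le_mul_right hD _).trans key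
  have := ENNReal.toReal_mono (by finiteness) h2
  rw [ENNReal.toReal_mul, ENNReal.toReal_ofReal (by norm_num : (0 : ℝ) ≤ 10)] at this
  exact ((le_max_left (m * D) 0).trans_eq ENNReal.toReal_ofReal'.symm).trans this

/-- Away from a one-sided gap of length `2 * s` ending at `y₀`, one of the two translates
`y₀ - t₁`, `y₀ - t₂` misses `X`, or some point of `t₁ + X` falls into the gap. -/
lemma exists_miss_of_gap_left {X Y : Set ℝ} {y₀ s h t₁ t₂ : ℝ}
    (hgap : ∀ y ∈ Y, y₀ - 2 * s < y → y₀ ≤ y) (hh : 0 < h) (hs : 100 * h ≤ s)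
    (h₁₂ : t₁ + 13 * h ≤ t₂) (h₂₁ : t₂ ≤ t₁ + s / 4) :
    (∀ x ∈ X, 3 * h < |y₀ - t₁ - x|) ∨ (∀ x ∈ X, 3 * h < |y₀ - t₂ - x|) ∨
      ∃ x ∈ X, |t₁ + x - y₀| ≤ 2 * s ∧ ∀ y ∈ Y, 3 * h < |t₁ + x - y| := by
  by_contra! hcon
  obtain ⟨⟨x, hx, hx'⟩, ⟨z, hz, hz'⟩, hall⟩ := hcon
  rw [abs_le] at hx' hz'
  obtain ⟨y, hy, hy'⟩ := hall z hz (abs_le.2 ⟨by linarith, by linarith⟩)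
  rw [abs_le] at hy'
  have := hgap y hy (by linarith)
  linarith

lemma exists_miss_of_gap_right {X Y : Set ℝ} {y₀ s h t₁ t₂ : ℝ}
    (hgap : ∀ y ∈ Y, y < y₀ + 2 * s → y ≤ y₀) (hh : 0 < h) (hs : 100 * h ≤ s)
    (h₁₂ : t₂ + 13 * h ≤ t₁) (h₂₁ : t₁ ≤ t₂ + s / 4) :
    (∀ x ∈ X, 3 * h < |y₀ - t₁ - x|) ∨ (∀ x ∈ X, 3 * h < |y₀ - t₂ - x|) ∨
      ∃ x ∈ X, |t₁ + x - y₀| ≤ 2 * s ∧ ∀ y ∈ Y, 3 * h < |t₁ + x - y| := by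
  by_contra! hcon
  obtain ⟨⟨x, hx, hx'⟩, ⟨z, hz, hz'⟩, hall⟩ := hcon
  rw [abs_le] at hx' hz'
  obtain ⟨y, hy, hy'⟩ := hall z hz (abs_le.2 ⟨by linarith, by linarith⟩)
  rw [abs_le] at hy'
  have := hgap y hy (by linarith)
  linarith

/-- Among translation parameters near `t₀ ∈ T`, some `t` either moves the point `y₀ ∈ Y` nearest
to `z` off `X`, or moves a point of `X` into the gap of `Y` around `z`. -/
lemma exists_miss {X Y T : Set ℝ} {z s h t₀ t : ℝ} {y₀ : ℝ}
    (hz : |z - y₀| = s) (hgap : ∀ y ∈ Y, s ≤ |z - y|) (hh : 0 < h) (hs : 100 * h ≤ s)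
    (ht₀ : t₀ ∈ T) (ht : t ∈ T) (h₁ : 13 * h < |t - t₀|) (h₂ : |t - t₀| ≤ s / 4) :
    ∃ t' ∈ T, |t' - t₀| ≤ s / 4 ∧ ((∀ x ∈ X, 3 * h < |y₀ - t' - x|) ∨
      ∃ x ∈ X, |t' + x - y₀| ≤ 2 * s ∧ ∀ y ∈ Y, 3 * h < |t' + x - y|) := by
  have h₀ : |t₀ - t₀| ≤ s / 4 := by simp; linarith
  have main : ∀ t₁ t₂, (t₁ ∈ T ∧ |t₁ - t₀| ≤ s / 4) → (t₂ ∈ T ∧ |t₂ - t₀| ≤ s / 4) →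
      t₁ + 13 * h ≤ t₂ → t₂ ≤ t₁ + s / 4 → ∃ t' ∈ T, |t' - t₀| ≤ s / 4 ∧
      ((∀ x ∈ X, 3 * h < |y₀ - t' - x|) ∨
        ∃ x ∈ X, |t' + x - y₀| ≤ 2 * s ∧ ∀ y ∈ Y, 3 * h < |t' + x - y|) := by
    rintro t₁ t₂ ⟨a₁, b₁⟩ ⟨a₂, b₂⟩ hl hu
    rcases le_total z y₀ with hzy | hzy
    · rw [abs_of_nonpos (by linarith)] at hz
      have hg : ∀ y ∈ Y, y₀ - 2 * s < y → y₀ ≤ y := by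
        intro y hy hlt
        rcases le_abs.1 (hgap y hy) with H | H <;> linarith
      rcases exists_miss_of_gap_left (X := X) hg hh hs hl hu with H | H | H
      · exact ⟨t₁, a₁, b₁, .inl H⟩
      · exact ⟨t₂, a₂, b₂, .inl H⟩
      · exact ⟨t₁, a₁, b₁, .inr H⟩
    · rw [abs_of_nonneg (by linarith)] at hz
      have hg : ∀ y ∈ Y, y < y₀ + 2 * s → y ≤ y₀ := by
        intro y hy hlt
        rcases le_abs.1 (hgap y hy) with H | H <;> linarith
      rcases exists_miss_of_gap_right (X := X) hg hh hs hl hu with H | H | H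
      · exact ⟨t₂, a₂, b₂, .inl H⟩
      · exact ⟨t₁, a₁, b₁, .inl H⟩
      · exact ⟨t₂, a₂, b₂, .inr H⟩
  rcases le_total t t₀ with hle | hle
  · rw [abs_of_nonpos (by linarith)] at h₁ h₂
    exact main t t₀ ⟨ht, by rw [abs_of_nonpos (by linarith)]; exact h₂⟩ ⟨ht₀, h₀⟩
      (by linarith) (by linarith)
  · rw [abs_of_nonneg (by linarith)] at h₁ h₂
    exact main t₀ t ⟨ht₀, h₀⟩ ⟨ht, by rw [abs_of_nonneg (by linarith)]; exact h₂⟩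
      (by linarith) (by linarith)

/-- A closed nonempty set `X` carrying a finite measure `μ` that is `δ`-regular on scales
`[α, 1]`, phrased with real-valued masses. -/
structure RegularPair (δ α C : ℝ) (X : Set ℝ) (μ : Measure ℝ) : Prop where
  closed : IsClosed X
  nonempty : X.Nonempty
  null : μ Xᶜ = 0
  upper : ∀ x r, α ≤ r → r ≤ 1 → μ.real (closedBall x r) ≤ C * r ^ δ
  lower : ∀ x ∈ X, ∀ r, α ≤ r → r ≤ 1 → C⁻¹ * r ^ δ ≤ μ.real (closedBall x r)

/-- The sum of the laws of `(t, t + x)` and of `(t, y)`, for independent `t`, `x` with law `μ`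
and `y` with law `μ'`. -/
noncomputable def pairMeasure (μ μ' : Measure ℝ) : Measure (ℝ × ℝ) :=
  (μ.prod μ).map (fun p => (p.1, p.1 + p.2)) + μ.prod μ'

/-- The pairs `(t, w)` with `w` within `r` of `Y` and of `t + X`. -/
def nearSet (X Y : Set ℝ) (r : ℝ) : Set (ℝ × ℝ) :=
  {p | infDist p.2 Y ≤ r ∧ infDist (p.2 - p.1) X ≤ r}

lemma measurableSet_nearSet (X Y : Set ℝ) (r : ℝ) : MeasurableSet (nearSet X Y r) := by
  refine IsClosed.measurableSet (IsClosed.inter ?_ ?_)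
  · exact isClosed_le ((continuous_infDist_pt Y).comp continuous_snd) continuous_const
  · exact isClosed_le ((continuous_infDist_pt X).comp (continuous_snd.sub continuous_fst))
      continuous_const

lemma nearSet_mono (X Y : Set ℝ) {r r' : ℝ} (h : r ≤ r') : nearSet X Y r ⊆ nearSet X Y r' :=
  fun _ hp => ⟨hp.1.trans h, hp.2.trans h⟩

lemma mem_nearSet_of_near {X Y : Set ℝ} {r a b R : ℝ} {p q : ℝ × ℝ} (hp : p ∈ nearSet X Y r)
    (h₁ : |q.1 - p.1| ≤ a) (h₂ : |q.2 - p.2| ≤ b) (hR : r + a + b ≤ R) : q ∈ nearSet X Y R := by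
  have ha := (abs_nonneg _).trans h₁
  constructor
  · have := infDist_le_infDist_add_dist (s := Y) (x := q.2) (y := p.2)
    rw [Real.dist_eq] at this
    linarith [hp.1]
  · have := infDist_le_infDist_add_dist (s := X) (x := q.2 - q.1) (y := p.2 - p.1)
    rw [Real.dist_eq] at this
    have h3 : |q.2 - q.1 - (p.2 - p.1)| ≤ a + b := by
      rw [abs_le] at *
      constructor <;> linarith [h₁.1, h₁.2, h₂.1, h₂.2]
    linarith [hp.2]

section

variable {δ α C : ℝ} {X Y : Set ℝ} {μ μ' : Measure ℝ}

instance [IsFiniteMeasure μ] [IsFiniteMeasure μ'] : IsFiniteMeasure (pairMeasure μ μ') := by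
  unfold pairMeasure; infer_instance

lemma measurable_shear : Measurable (fun p : ℝ × ℝ => (p.1, p.1 + p.2)) := by fun_prop

lemma pairMeasure_real_apply [IsFiniteMeasure μ] [IsFiniteMeasure μ'] {Q : Set (ℝ × ℝ)}
    (hQ : MeasurableSet Q) : (pairMeasure μ μ').real Q =
      (μ.prod μ).real ((fun p => (p.1, p.1 + p.2)) ⁻¹' Q) + (μ.prod μ').real Q := by
  rw [pairMeasure, measureReal_add_apply, map_measureReal_apply measurable_shear hQ]

lemma RegularPair.pairMeasure_closedBall_le [IsFiniteMeasure μ] [IsFiniteMeasure μ'] (hC : 0 ≤ C)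
    (hX : RegularPair δ α C X μ) (hY : RegularPair δ α C Y μ') (p : ℝ × ℝ) {R : ℝ}
    (hα : α ≤ R) (hR0 : 0 ≤ R) (hR : R ≤ 1) :
    (pairMeasure μ μ').real (closedBall p R) ≤ 2 * (C * R ^ δ) ^ 2 := by
  have hb : 0 ≤ C * R ^ δ := by positivity
  rw [pairMeasure_real_apply measurableSet_closedBall, ← closedBall_prod_same]
  have h₁ := measureReal_prod_le μ μ (Q := (fun p : ℝ × ℝ => (p.1, p.1 + p.2)) ⁻¹'
    (closedBall p.1 R ×ˢ closedBall p.2 R)) (measurable_shear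
      (measurableSet_closedBall.prod measurableSet_closedBall)) (S := closedBall p.1 R)
      measurableSet_closedBall (fun q hq => hq.1) hb (fun a _ => by
        refine le_trans (measureReal_mono ?_) (hX.upper (p.2 - a) R hα hR)
        intro x hx
        have := hx.2
        simp only [mem_closedBall, Real.dist_eq] at this ⊢
        rwa [show x - (p.2 - a) = a + x - p.2 by ring])
  have h₂ := measureReal_prod_le μ μ' (Q := closedBall p.1 R ×ˢ closedBall p.2 R)
      (measurableSet_closedBall.prod measurableSet_closedBall) (S := closedBall p.1 R)
      measurableSet_closedBall (fun q hq => hq.1) hb (fun a _ => by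
        refine le_trans (measureReal_mono ?_) (hY.upper p.2 R hα hR)
        intro x hx
        exact hx.2)
  have h₃ := mul_le_mul_of_nonneg_left (hX.upper p.1 R hα hR) hb
  nlinarith

lemma RegularPair.le_pairMeasure_box [IsFiniteMeasure μ] [IsFiniteMeasure μ'] (hC : 0 ≤ C)
    (hX : RegularPair δ α C X μ) (hY : RegularPair δ α C Y μ') {t y h : ℝ} (ht : t ∈ X)
    (hy : y ∈ Y) (hα : α ≤ h) (hh0 : 0 ≤ h) (hh : h ≤ 1) :
    (C⁻¹ * h ^ δ) ^ 2 ≤ (pairMeasure μ μ').real {q | |q.1 - t| ≤ h ∧ |q.2 - y| ≤ h} := by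
  have : {q : ℝ × ℝ | |q.1 - t| ≤ h ∧ |q.2 - y| ≤ h} = closedBall t h ×ˢ closedBall y h := by
    ext q; simp [Real.dist_eq]
  rw [this, pairMeasure_real_apply (measurableSet_closedBall.prod measurableSet_closedBall),
    measureReal_prod_prod (μ := μ) (ν := μ'), sq]
  have hb : 0 ≤ C⁻¹ * h ^ δ := by positivity
  have := mul_le_mul (hX.lower t ht h hα hh) (hY.lower y hy h hα hh) hb measureReal_nonneg
  linarith [measureReal_nonneg (μ := μ.prod μ)
    (s := (fun p : ℝ × ℝ => (p.1, p.1 + p.2)) ⁻¹' closedBall t h ×ˢ closedBall y h)]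

lemma RegularPair.le_pairMeasure_sheared_box [IsFiniteMeasure μ] [IsFiniteMeasure μ']
    (hC : 0 ≤ C) (hX : RegularPair δ α C X μ) {t x h : ℝ} (ht : t ∈ X)
    (hx : x ∈ X) (hα : α ≤ h) (hh0 : 0 ≤ h) (hh : h ≤ 1) :
    (C⁻¹ * h ^ δ) ^ 2 ≤
      (pairMeasure μ μ').real {q | |q.1 - t| ≤ h ∧ |q.2 - q.1 - x| ≤ h} := by
  have hm : MeasurableSet {q : ℝ × ℝ | |q.1 - t| ≤ h ∧ |q.2 - q.1 - x| ≤ h} := by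
    refine MeasurableSet.inter ?_ ?_
    · exact measurableSet_le (f := fun q : ℝ × ℝ => |q.1 - t|) (by fun_prop) measurable_const
    · exact measurableSet_le (f := fun q : ℝ × ℝ => |q.2 - q.1 - x|) (by fun_prop) measurable_const
  have : (fun p : ℝ × ℝ => (p.1, p.1 + p.2)) ⁻¹'
      {q : ℝ × ℝ | |q.1 - t| ≤ h ∧ |q.2 - q.1 - x| ≤ h} = closedBall t h ×ˢ closedBall x h := by
    ext q; simp [Real.dist_eq]
  rw [pairMeasure_real_apply hm, this, measureReal_prod_prod (μ := μ) (ν := μ), sq]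
  have hb : 0 ≤ C⁻¹ * h ^ δ := by positivity
  have := mul_le_mul (hX.lower t ht h hα hh) (hX.lower x hx h hα hh) hb measureReal_nonneg
  linarith [measureReal_nonneg (μ := μ.prod μ')
    (s := {q : ℝ × ℝ | |q.1 - t| ≤ h ∧ |q.2 - q.1 - x| ≤ h})]

lemma RegularPair.exists_far_near [IsFiniteMeasure μ] (hX : RegularPair δ α C X μ)
    {t r R : ℝ} (ht : t ∈ X) (hr : α ≤ r) (hr1 : r ≤ 1) (hR : α ≤ R) (hR1 : R ≤ 1)
    (hrR : C * r ^ δ < C⁻¹ * R ^ δ) : ∃ x ∈ X, r < |x - t| ∧ |x - t| ≤ R := by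
  by_contra! hcon
  have hsub : closedBall t R ⊆ closedBall t r ∪ Xᶜ := by
    intro x hx
    by_cases hxX : x ∈ X
    · left
      simp only [mem_closedBall, Real.dist_eq] at hx ⊢
      by_contra! hlt
      exact (hcon x hxX hlt).not_ge hx
    · exact .inr hxX
  have h₁ := measureReal_mono (μ := μ) hsub
  have h₂ := measureReal_union_le (μ := μ) (closedBall t r) Xᶜ
  have h₃ : μ.real Xᶜ = 0 := by simp [Measure.real, hX.null]
  linarith [hX.upper t r hr hr1, hX.lower t ht R hR hR1]

lemma RegularPair.le_pairMeasure_loss [IsFiniteMeasure μ] [IsFiniteMeasure μ'] (hC : 0 ≤ C)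
    (hX : RegularPair δ α C X μ) (hY : RegularPair δ α C Y μ') {t₀ z h h₀ : ℝ} (ht₀ : t₀ ∈ X)
    (hα : α ≤ h) (hh : 0 < h) (hhz : 100 * h ≤ infDist z Y) (hz : infDist z Y ≤ 1)
    (hδ : C * (13 * h) ^ δ < C⁻¹ * (infDist z Y / 4) ^ δ) (hh₀ : h₀ ≤ h) :
    (C⁻¹ * h ^ δ) ^ 2 ≤ (pairMeasure μ μ').real
      {q | q ∉ nearSet X Y h₀ ∧ |q.1 - t₀| ≤ infDist z Y ∧ |q.2 - z| ≤ 4 * infDist z Y} := by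
  set s := infDist z Y with hs
  obtain ⟨y₀, hy₀, hzy⟩ := hY.closed.exists_infDist_eq_dist hY.nonempty z
  rw [Real.dist_eq, ← hs] at hzy
  obtain ⟨t, ht, hlt, hle⟩ := hX.exists_far_near ht₀ (r := 13 * h) (R := s / 4) (by linarith)
    (by linarith) (by linarith) (by linarith) hδ
  obtain ⟨t', ht', htt, H⟩ := exists_miss (X := X) (Y := Y) hzy.symm
    (fun y hy => by simpa [Real.dist_eq] using infDist_le_dist_of_mem (x := z) hy)
    hh hhz ht₀ ht hlt hle
  rw [abs_le] at htt
  have hzy' := abs_le.1 hzy.symm.le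
  rcases H with H | ⟨x, hx, hxy, H⟩
  · refine (hX.le_pairMeasure_box hC hY ht' hy₀ hα hh.le (by linarith)).trans
      (measureReal_mono ?_)
    rintro q ⟨h₁, h₂⟩
    rw [abs_le] at h₁ h₂
    refine ⟨fun hq => ?_, abs_le.2 ⟨by linarith, by linarith⟩, abs_le.2 ⟨by linarith, by linarith⟩⟩
    obtain ⟨x, hx, hxq⟩ := hX.closed.exists_infDist_eq_dist hX.nonempty (q.2 - q.1)
    have h₃ := hq.2
    rw [hxq, Real.dist_eq, abs_le] at h₃
    exact (H x hx).not_ge (abs_le.2 ⟨by linarith, by linarith⟩)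
  · refine (hX.le_pairMeasure_sheared_box hC ht' hx hα hh.le (by linarith)).trans
      (measureReal_mono ?_)
    rintro q ⟨h₁, h₂⟩
    rw [abs_le] at h₁ h₂ hxy
    refine ⟨fun hq => ?_, abs_le.2 ⟨by linarith, by linarith⟩, abs_le.2 ⟨by linarith, by linarith⟩⟩
    obtain ⟨y, hy, hyq⟩ := hY.closed.exists_infDist_eq_dist hY.nonempty q.2
    have h₃ := hq.1
    rw [hyq, Real.dist_eq, abs_le] at h₃
    exact (H y hy).not_ge (abs_le.2 ⟨by linarith, by linarith⟩)

lemma RegularPair.le_volume_gaps [IsFiniteMeasure μ'] (hC : 0 < C) (hY : RegularPair δ α C Y μ')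
    {y ρ κ : ℝ} (hδ : δ ≤ 1) (hρ : 0 < ρ) (hρ1 : 2 * ρ ≤ 1) (hκ : 0 < κ) (hκ1 : 2 * κ ≤ 1)
    (hα : α ≤ κ * ρ) (hκC : 8 * C ^ 2 * κ ^ (1 - δ) ≤ 1) :
    ENNReal.ofReal ρ ≤ volume {z | z ∈ closedBall y ρ ∧ κ * ρ < infDist z Y} := by
  set σ := κ * ρ with hσ
  have hσ0 : 0 < σ := by positivity
  have hσρ : 2 * σ ≤ ρ := by nlinarith
  set E : Set ℝ := {z | infDist z Y ≤ σ} with hE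
  have hEm : MeasurableSet E :=
    (isClosed_le (continuous_infDist_pt Y) continuous_const).measurableSet
  have : IsFiniteMeasure (volume.restrict (closedBall y ρ)) :=
    ⟨by rw [Measure.restrict_apply_univ]; exact measure_closedBall_lt_top⟩
  have hdc := mul_measureReal_le_of_relation (volume.restrict (closedBall y ρ)) μ'
    (R := {p : ℝ × ℝ | |p.1 - p.2| ≤ 2 * σ})
    (isClosed_le (by fun_prop) continuous_const).measurableSet (m := C⁻¹ * σ ^ δ) (M := 4 * σ)
    (by positivity) hEm (L := closedBall y (2 * ρ)) measurableSet_closedBall ?_ ?_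
  · have hup := hY.upper y (2 * ρ) (by linarith) hρ1
    set v := (volume.restrict (closedBall y ρ)).real E with hv
    have hvρ : v ≤ ρ := by
      have h₁ : C⁻¹ * σ ^ δ * v ≤ 4 * σ * (C * (2 * ρ) ^ δ) := hdc.trans (by gcongr)
      have h2 : (2 : ℝ) ^ δ ≤ 2 := by
        simpa using Real.rpow_le_rpow_of_exponent_le (x := 2) (by norm_num) hδ
      have hκκ : κ = κ ^ δ * κ ^ (1 - δ) := by
        rw [← Real.rpow_add hκ]; simp
      rw [hσ, Real.mul_rpow hκ.le hρ.le, Real.mul_rpow (by norm_num) hρ.le] at h₁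
      have hP : 0 < κ ^ δ * ρ ^ δ := by positivity
      have h₃ : (κ ^ δ * ρ ^ δ) * v ≤ (κ ^ δ * ρ ^ δ) * ρ := by
        calc (κ ^ δ * ρ ^ δ) * v = C * (C⁻¹ * (κ ^ δ * ρ ^ δ) * v) := by field_simp
          _ ≤ C * (4 * (κ * ρ) * (C * (2 ^ δ * ρ ^ δ))) := by gcongr
          _ ≤ C * (4 * (κ * ρ) * (C * (2 * ρ ^ δ))) := by gcongr
          _ = (8 * C ^ 2 * κ ^ (1 - δ)) * ((κ ^ δ * ρ ^ δ) * ρ) := by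
            nth_rewrite 1 [hκκ]; ring
          _ ≤ 1 * ((κ ^ δ * ρ ^ δ) * ρ) := by gcongr
          _ = _ := one_mul _
      exact le_of_mul_le_mul_left h₃ hP
    have hset : {z | z ∈ closedBall y ρ ∧ σ < infDist z Y} = closedBall y ρ \ E := by
      ext z; simp [hE]
    have hvE : v = volume.real (closedBall y ρ ∩ E) := by
      rw [hv, measureReal_restrict_apply hEm, inter_comm]
    have hfin : volume (closedBall y ρ) ≠ ⊤ := measure_closedBall_lt_top.ne
    have hdiff := measureReal_inter_add_sdiff (μ := volume) (s := closedBall y ρ) hEm hfin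
    have hball : volume.real (closedBall y ρ) = 2 * ρ := by
      rw [Measure.real, Real.volume_closedBall, ENNReal.toReal_ofReal (by positivity)]
    rw [hset]
    exact ENNReal.ofReal_le_of_le_toReal (by
      change ρ ≤ volume.real _; linarith)
  · filter_upwards [ae_restrict_mem measurableSet_closedBall] with z hz hzE
    obtain ⟨w, hw, hzw⟩ := hY.closed.exists_infDist_eq_dist hY.nonempty z
    refine (hY.lower w hw σ hα (by linarith)).trans (measureReal_mono ?_)
    intro b hb
    have hzE' : infDist z Y ≤ σ := hzE
    rw [hzw, Real.dist_eq, abs_le] at hzE'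
    rw [mem_closedBall, Real.dist_eq, abs_le] at hb hz
    refine ⟨?_, ?_⟩
    · rw [mem_closedBall, Real.dist_eq, abs_le]
      constructor <;> linarith
    · exact abs_le.2 ⟨by linarith, by linarith⟩
  · intro b _
    calc (volume.restrict (closedBall y ρ)).real
          {a | a ∈ E ∧ (a, b) ∈ {p : ℝ × ℝ | |p.1 - p.2| ≤ 2 * σ}}
        ≤ (volume.restrict (closedBall y ρ)).real (closedBall b (2 * σ)) :=
          measureReal_mono fun a ha => by simpa [Real.dist_eq] using ha.2
      _ ≤ volume.real (closedBall b (2 * σ)) :=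
          ENNReal.toReal_mono measure_closedBall_lt_top.ne (Measure.restrict_apply_le _ _)
      _ ≤ 4 * σ := by
          rw [Measure.real, Real.volume_closedBall, ENNReal.toReal_ofReal (by positivity)]
          linarith

lemma RegularPair.le_pairMeasure_loss_strip [IsFiniteMeasure μ] [IsFiniteMeasure μ'] (hC : 0 < C)
    (hX : RegularPair δ α C X μ) (hY : RegularPair δ α C Y μ') {t z ρ η h₀ : ℝ} (ht : t ∈ X)
    (hδ1 : δ ≤ 1) (hα0 : 0 < α) (hη : 0 < η) (hη1 : 100 * η ≤ 1)
    (hα : α ≤ η * infDist z Y) (hzρ : infDist z Y ≤ ρ) (hρ : ρ ≤ 1)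
    (hηC : C ^ 2 * (52 * η) ^ δ < 1) (hηC' : 1 ≤ 200 * C ^ 2 * η ^ δ)
    (hh₀ : h₀ ≤ η * infDist z Y) :
    C⁻¹ ^ 8 / 40000 * ρ ^ (2 * δ - 1) * infDist z Y ≤ (pairMeasure μ μ').real
      {q | q ∉ nearSet X Y h₀ ∧ |q.1 - t| ≤ 2 * ρ ∧ |q.2 - z| ≤ 4 * infDist z Y} := by
  set s := infDist z Y with hs
  have hs0 : 0 < s := by
    by_contra! hle
    nlinarith
  have hρ0 : 0 < ρ := by linarith
  have hηs : η * s ≤ s := by nlinarith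
  set L : Set (ℝ × ℝ) := {q | q ∉ nearSet X Y h₀ ∧ |q.1 - t| ≤ 2 * ρ ∧ |q.2 - z| ≤ 4 * s} with hL
  have hLm : MeasurableSet L := by
    refine (measurableSet_nearSet X Y h₀).compl.inter (MeasurableSet.inter ?_ ?_)
    · exact measurableSet_le (f := fun q : ℝ × ℝ => |q.1 - t|) (by fun_prop) measurable_const
    · exact measurableSet_le (f := fun q : ℝ × ℝ => |q.2 - z|) (by fun_prop) measurable_const
  have hsep : C * (13 * (η * s)) ^ δ < C⁻¹ * (s / 4) ^ δ := by
    have h1 : (13 * (η * s)) ^ δ = (52 * η) ^ δ * (s / 4) ^ δ := by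
      rw [← Real.mul_rpow (by positivity) (by positivity)]; congr 1; ring
    have h2 : 0 < (s / 4) ^ δ := by positivity
    have h3 : C * (52 * η) ^ δ < C⁻¹ := by
      rw [lt_inv_comm₀ (by positivity) hC, ← one_div, lt_div_iff₀ (by positivity)]
      nlinarith
    rw [h1, ← mul_assoc]
    exact mul_lt_mul_of_pos_right h3 h2
  have hR : MeasurableSet {p : ℝ × (ℝ × ℝ) | |p.2.1 - p.1| ≤ s} :=
    measurableSet_le (f := fun p : ℝ × (ℝ × ℝ) => |p.2.1 - p.1|) (by fun_prop) measurable_const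
  have hdc := mul_measureReal_le_of_relation μ (pairMeasure μ μ') hR
    (m := (C⁻¹ * (η * s) ^ δ) ^ 2) (M := C * s ^ δ) (by positivity)
    (S := closedBall t ρ) measurableSet_closedBall hLm ?_ ?_
  · have hlow := hX.lower t ht ρ (by linarith) hρ
    have h1 : (C⁻¹ * (η * s) ^ δ) ^ 2 * (C⁻¹ * ρ ^ δ) ≤ C * s ^ δ * (pairMeasure μ μ').real L :=
      (by gcongr : _ ≤ _).trans hdc
    have h2 : (C⁻¹ * (1 / (200 * C ^ 2) * s ^ δ)) ^ 2 * (C⁻¹ * ρ ^ δ) ≤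
        C * s ^ δ * (pairMeasure μ μ').real L := by
      refine le_trans ?_ h1
      rw [Real.mul_rpow hη.le hs0.le]
      gcongr
      rw [div_le_iff₀ (by positivity)]
      linarith
    have hsδ : 0 < s ^ δ := by positivity
    have h3 : C⁻¹ ^ 8 / 40000 * (s ^ δ * ρ ^ δ) ≤ (pairMeasure μ μ').real L := by
      refine le_of_mul_le_mul_left (le_trans (le_of_eq ?_) h2) (mul_pos hC hsδ)
      field_simp
      norm_num
    refine le_trans ?_ h3
    have h4 : ρ ^ (δ - 1) * s ≤ s ^ δ := by
      have h5 : ρ ^ (δ - 1) ≤ s ^ (δ - 1) :=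
        Real.rpow_le_rpow_of_nonpos hs0 hzρ (by linarith)
      calc ρ ^ (δ - 1) * s ≤ s ^ (δ - 1) * s := by gcongr
        _ = s ^ δ := by
          nth_rewrite 2 [← Real.rpow_one s]
          rw [← Real.rpow_add hs0]; simp
    have h6 : ρ ^ (2 * δ - 1) = ρ ^ (δ - 1) * ρ ^ δ := by
      rw [← Real.rpow_add hρ0]; congr 1; ring
    calc C⁻¹ ^ 8 / 40000 * ρ ^ (2 * δ - 1) * s
        = C⁻¹ ^ 8 / 40000 * ((ρ ^ (δ - 1) * s) * ρ ^ δ) := by rw [h6]; ring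
      _ ≤ _ := by gcongr
  · have hae : ∀ᵐ a ∂μ, a ∈ X := by
      rw [ae_iff]; exact hX.null
    filter_upwards [hae] with a haX hat
    refine (hX.le_pairMeasure_loss hC.le hY haX hα (by positivity)
      (by nlinarith) (hzρ.trans hρ) hsep hh₀).trans (measureReal_mono ?_)
    rintro q ⟨hq, hq1, hq2⟩
    rw [mem_closedBall, Real.dist_eq] at hat
    refine ⟨⟨hq, ?_, hq2⟩, hq1⟩
    calc |q.1 - t| ≤ |q.1 - a| + |a - t| := abs_sub_le _ _ _
      _ ≤ 2 * ρ := by linarith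
  · intro q _
    refine (measureReal_mono ?_).trans (hX.upper q.1 s (by linarith) (by linarith))
    intro a ha
    rw [mem_closedBall, Real.dist_eq, abs_sub_comm]
    exact ha.2

lemma RegularPair.le_pairMeasure_loss_local [IsFiniteMeasure μ] [IsFiniteMeasure μ'] (hC : 0 < C)
    (hX : RegularPair δ α C X μ) (hY : RegularPair δ α C Y μ') {ρ η κ h₀ : ℝ} {p : ℝ × ℝ}
    (hp : p ∈ nearSet X Y h₀) (hpX : p.1 ∈ X)
    (hδ1 : δ ≤ 1) (hα0 : 0 < α) (hη : 0 < η) (hη1 : 100 * η ≤ 1)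
    (hκ : 0 < κ) (hκ1 : 2 * κ ≤ 1) (hρ0 : 0 < ρ)
    (hα : α ≤ h₀) (hρ : 100 * ρ ≤ 1)
    (hηC : C ^ 2 * (52 * η) ^ δ < 1) (hηC' : 1 ≤ 200 * C ^ 2 * η ^ δ)
    (hκC : 8 * C ^ 2 * κ ^ (1 - δ) ≤ 1) (hh₀ : h₀ = η * κ * ρ) :
    C⁻¹ ^ 8 / (16 * 10 ^ 9) * (100 * ρ) ^ (2 * δ) ≤ (pairMeasure μ μ').real
      {q | q ∈ nearSet X Y (100 * ρ) \ nearSet X Y h₀ ∧ |q.1 - p.1| ≤ 100 * ρ ∧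
        |q.2 - p.2| ≤ 100 * ρ} := by
  have hκρ : κ * ρ ≤ ρ := by nlinarith
  have hh₀κ : h₀ ≤ κ * ρ := by
    have : 0 < κ * ρ := by positivity
    rw [hh₀]; nlinarith
  set G : Set (ℝ × ℝ) := {q | q ∈ nearSet X Y (100 * ρ) \ nearSet X Y h₀ ∧
    |q.1 - p.1| ≤ 100 * ρ ∧ |q.2 - p.2| ≤ 100 * ρ} with hG
  have hGm : MeasurableSet G := by
    refine ((measurableSet_nearSet X Y _).diff (measurableSet_nearSet X Y h₀)).inter
      (MeasurableSet.inter ?_ ?_)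
    · exact measurableSet_le (f := fun q : ℝ × ℝ => |q.1 - p.1|) (by fun_prop) measurable_const
    · exact measurableSet_le (f := fun q : ℝ × ℝ => |q.2 - p.2|) (by fun_prop) measurable_const
  obtain ⟨y, hy, hpy⟩ := hY.closed.exists_infDist_eq_dist hY.nonempty p.2
  have hpy' := hp.1
  rw [hpy, Real.dist_eq, abs_le] at hpy'
  have hvol := hY.le_volume_gaps hC (y := y) hδ1 hρ0 (by linarith) hκ hκ1 (by linarith) hκC
  set E : Set ℝ := {z | z ∈ closedBall y ρ ∧ κ * ρ < infDist z Y} with hE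
  have hEρ : ∀ z ∈ E, infDist z Y ≤ ρ := fun z hz => (infDist_le_dist_of_mem hy).trans hz.1
  have hEpos : ∀ z ∈ E, 0 < infDist z Y := fun z hz => lt_trans (by positivity) hz.2
  set lam : Measure ℝ := ((pairMeasure μ μ').restrict G).map Prod.snd with hlam
  have hlamr : ∀ V : Set ℝ, MeasurableSet V →
      lam.real V = (pairMeasure μ μ').real (Prod.snd ⁻¹' V ∩ G) := fun V hV => by
    rw [hlam, map_measureReal_apply measurable_snd hV,
      measureReal_restrict_apply (measurable_snd hV)]
  have hvit := le_measureReal_of_vitali lam (E := E) (fun z => 4 * infDist z Y)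
    (m := C⁻¹ ^ 8 / 160000 * ρ ^ (2 * δ - 1)) (ρ := 4 * ρ) (V := univ) (by positivity)
    (fun z hz => by linarith [hEpos z hz]) (fun z hz => by linarith [hEρ z hz]) ?_
    (fun _ _ => subset_univ _) hvol
  · rw [hlamr univ MeasurableSet.univ, preimage_univ, univ_inter] at hvit
    have h1 : ρ ^ (2 * δ - 1) * ρ = ρ ^ (2 * δ) := by
      nth_rewrite 2 [← Real.rpow_one ρ]
      rw [← Real.rpow_add hρ0]; congr 1; ring
    have h2 : (100 * ρ) ^ (2 * δ) ≤ 10000 * ρ ^ (2 * δ) := by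
      rw [Real.mul_rpow (by norm_num) hρ0.le]
      gcongr
      calc (100 : ℝ) ^ (2 * δ) ≤ 100 ^ (2 : ℝ) :=
            Real.rpow_le_rpow_of_exponent_le (by norm_num) (by linarith)
        _ = 10000 := by norm_num
    have h3 : 0 < C⁻¹ ^ 8 := by positivity
    calc C⁻¹ ^ 8 / (16 * 10 ^ 9) * (100 * ρ) ^ (2 * δ)
        ≤ C⁻¹ ^ 8 / (16 * 10 ^ 9) * (10000 * ρ ^ (2 * δ)) := by gcongr
      _ = (C⁻¹ ^ 8 / 160000 * ρ ^ (2 * δ - 1) * ρ) / 10 := by rw [← h1]; ring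
      _ ≤ _ := by linarith
  · intro z hz
    have hzκ : η * κ * ρ ≤ η * infDist z Y := by
      rw [mul_assoc]; exact mul_le_mul_of_nonneg_left hz.2.le hη.le
    have := hX.le_pairMeasure_loss_strip hC hY (z := z) (h₀ := h₀) hpX hδ1 hα0 hη hη1
      (by linarith) (hEρ z hz) (by linarith) hηC hηC' (by linarith)
    rw [hlamr _ measurableSet_closedBall]
    refine le_trans (le_of_eq (by ring)) (this.trans (measureReal_mono ?_))
    rintro q ⟨hq, hq1, hq2⟩
    have hz1 := hz.1
    have hz2 := hEρ z hz
    rw [mem_closedBall, Real.dist_eq, abs_le] at hz1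
    have hq2' := abs_le.1 hq2
    have hqp : |q.2 - p.2| ≤ 6 * ρ := abs_le.2 ⟨by linarith, by linarith⟩
    refine ⟨?_, ⟨mem_nearSet_of_near hp hq1 hqp (by linarith), hq⟩, by linarith, by linarith⟩
    rwa [mem_preimage, mem_closedBall, Real.dist_eq]

/-- Passing from scale `R` to a much finer scale loses a fixed proportion of `nearSet`. -/
lemma RegularPair.pairMeasure_nearSet_step [IsFiniteMeasure μ] [IsFiniteMeasure μ'] (hC : 0 < C)
    (hX : RegularPair δ α C X μ) (hY : RegularPair δ α C Y μ') {R η κ : ℝ}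
    (hδ1 : δ ≤ 1) (hα0 : 0 < α) (hη : 0 < η) (hη1 : 100 * η ≤ 1)
    (hκ : 0 < κ) (hκ1 : 2 * κ ≤ 1) (hα : α ≤ η * κ / 100 * R) (hR0 : 0 < R) (hR : R ≤ 1)
    (hηC : C ^ 2 * (52 * η) ^ δ < 1) (hηC' : 1 ≤ 200 * C ^ 2 * η ^ δ)
    (hκC : 8 * C ^ 2 * κ ^ (1 - δ) ≤ 1) :
    (1 + C⁻¹ ^ 10 / 10 ^ 11) * (pairMeasure μ μ').real (nearSet X Y (η * κ / 100 * R)) ≤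
      (pairMeasure μ μ').real (nearSet X Y R) := by
  set ν := pairMeasure μ μ'
  set h₀ := η * κ / 100 * R with hh₀
  have hηκ : η * κ ≤ 1 := by nlinarith
  have hh₀R : h₀ ≤ R := by rw [hh₀]; nlinarith
  set S := nearSet X Y h₀ with hS
  have hSm : MeasurableSet S := measurableSet_nearSet _ _ _
  have hRm : MeasurableSet (nearSet X Y R) := measurableSet_nearSet _ _ _
  have hrel : MeasurableSet {z : (ℝ × ℝ) × (ℝ × ℝ) | |z.2.1 - z.1.1| ≤ R ∧
      |z.2.2 - z.1.2| ≤ R} := by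
    refine MeasurableSet.inter ?_ ?_
    · exact measurableSet_le (f := fun z : (ℝ × ℝ) × (ℝ × ℝ) => |z.2.1 - z.1.1|)
        (by fun_prop) measurable_const
    · exact measurableSet_le (f := fun z : (ℝ × ℝ) × (ℝ × ℝ) => |z.2.2 - z.1.2|)
        (by fun_prop) measurable_const
  have hdc := mul_measureReal_le_of_relation ν ν hrel (m := C⁻¹ ^ 8 / (16 * 10 ^ 9) * R ^ (2 * δ))
    (M := 2 * (C * R ^ δ) ^ 2) (by positivity) hSm (hRm.diff hSm) ?_ ?_
  · have hsub : S ⊆ nearSet X Y R := nearSet_mono _ _ hh₀R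
    have hdiff := measureReal_sdiff_add_inter (μ := ν) (s := nearSet X Y R) hSm
    rw [inter_eq_self_of_subset_right hsub] at hdiff
    have hRδ : R ^ (2 * δ) = (R ^ δ) ^ 2 := by
      rw [mul_comm, Real.rpow_mul hR0.le]; norm_num
    have hP : 0 < 2 * (C * R ^ δ) ^ 2 := by positivity
    have h1 : C⁻¹ ^ 10 / 10 ^ 11 * ν.real S ≤ ν.real (nearSet X Y R \ S) := by
      refine le_of_mul_le_mul_left (le_trans ?_ hdc) hP
      rw [hRδ]
      have h2 : 0 ≤ C⁻¹ ^ 8 * (R ^ δ) ^ 2 * ν.real S := by positivity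
      calc 2 * (C * R ^ δ) ^ 2 * (C⁻¹ ^ 10 / 10 ^ 11 * ν.real S)
          = (2 / 10 ^ 11) * (C⁻¹ ^ 8 * (R ^ δ) ^ 2 * ν.real S) := by field_simp
        _ ≤ (1 / (16 * 10 ^ 9)) * (C⁻¹ ^ 8 * (R ^ δ) ^ 2 * ν.real S) :=
          mul_le_mul_of_nonneg_right (by norm_num) h2
        _ = _ := by ring
    linarith
  · have hae : ∀ᵐ p ∂ν, p.1 ∈ X := by
      have hXm : MeasurableSet {p : ℝ × ℝ | p.1 ∈ X} := measurable_fst hX.closed.measurableSet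
      have h0 : ∀ᵐ x ∂μ, x ∈ X := by rw [ae_iff]; exact hX.null
      have hfst : ∀ (ν' : Measure ℝ) [IsFiniteMeasure ν'], ∀ᵐ p ∂(μ.prod ν'), p.1 ∈ X :=
        fun ν' _ => Measure.quasiMeasurePreserving_fst.ae h0
      change ∀ᵐ p ∂((μ.prod μ).map _ + μ.prod μ'), p.1 ∈ X
      rw [ae_add_measure_iff]
      exact ⟨(ae_map_iff measurable_shear.aemeasurable hXm).2 (hfst μ), hfst μ'⟩
    filter_upwards [hae] with p hpX hpS
    have := hX.le_pairMeasure_loss_local hC hY (ρ := R / 100) hpS hpX hδ1 hα0 hη hη1 hκ hκ1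
      (by positivity) hα (by linarith) hηC hηC' hκC (by rw [hh₀]; ring)
    rw [show 100 * (R / 100) = R by ring] at this
    exact this
  · intro q _
    refine (measureReal_mono ?_).trans (hX.pairMeasure_closedBall_le hC.le hY q
      (by linarith) hR0.le hR)
    intro a ha
    rw [← closedBall_prod_same]
    refine ⟨?_, ?_⟩
    · rw [mem_closedBall, Real.dist_eq, abs_sub_comm]; exact ha.2.1
    · rw [mem_closedBall, Real.dist_eq, abs_sub_comm]; exact ha.2.2

lemma pairMeasure_univ_le [IsFiniteMeasure μ] [IsFiniteMeasure μ'] (hC : 0 ≤ C)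
    (hμ : μ.real univ ≤ C) (hμ' : μ'.real univ ≤ C) :
    (pairMeasure μ μ').real univ ≤ 2 * C ^ 2 := by
  rw [pairMeasure_real_apply MeasurableSet.univ, preimage_univ, ← univ_prod_univ,
    measureReal_prod_prod, measureReal_prod_prod]
  have h₁ := mul_le_mul hμ hμ measureReal_nonneg hC
  have h₂ := mul_le_mul hμ hμ' measureReal_nonneg hC
  linarith

lemma RegularPair.pairMeasure_nearSet_le [IsFiniteMeasure μ] [IsFiniteMeasure μ'] (hC : 1 ≤ C)
    (hX : RegularPair δ α C X μ) (hY : RegularPair δ α C Y μ') (hμ : μ.real univ ≤ C)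
    (hμ' : μ'.real univ ≤ C) {r η κ β : ℝ}
    (hδ1 : δ ≤ 1) (hα0 : 0 < α) (hη : 0 < η) (hη1 : 100 * η ≤ 1)
    (hκ : 0 < κ) (hκ1 : 2 * κ ≤ 1) (hα : α ≤ r) (hr : r < 1)
    (hηC : C ^ 2 * (52 * η) ^ δ < 1) (hηC' : 1 ≤ 200 * C ^ 2 * η ^ δ)
    (hκC : 8 * C ^ 2 * κ ^ (1 - δ) ≤ 1) (hβ0 : 0 ≤ β)
    (hβ : 1 ≤ (1 + C⁻¹ ^ 10 / 10 ^ 11) * (η * κ / 100) ^ β) :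
    (pairMeasure μ μ').real (nearSet X Y r) ≤ 4 * C ^ 2 * r ^ β := by
  have hC0 : 0 < C := by linarith
  have hr0 : 0 < r := by linarith
  set ε := C⁻¹ ^ 10 / 10 ^ 11 with hε
  have hε0 : 0 < ε := by positivity
  have hε1 : ε ≤ 1 := by
    have : C⁻¹ ^ 10 ≤ 1 := pow_le_one₀ (by positivity) (inv_le_one_of_one_le₀ hC)
    rw [hε]; linarith
  set q := η * κ / 100 with hq
  have hq0 : 0 < q := by positivity
  have hq1 : q < 1 := by rw [hq]; nlinarith
  have hiter : ∀ n : ℕ, α ≤ q ^ n →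
      (1 + ε) ^ n * (pairMeasure μ μ').real (nearSet X Y (q ^ n)) ≤ 2 * C ^ 2 := by
    intro n
    induction n with
    | zero =>
      intro _
      rw [pow_zero, one_mul]
      exact (measureReal_mono (subset_univ _)).trans (pairMeasure_univ_le hC0.le hμ hμ')
    | succ n ih =>
      intro hn
      rw [pow_succ' q] at hn ⊢
      have hqn : q * q ^ n ≤ q ^ n := mul_le_of_le_one_left (by positivity) hq1.le
      have hstep := hX.pairMeasure_nearSet_step hC0 hY hδ1 hα0 hη hη1 hκ hκ1
        (R := q ^ n) hn (by positivity) (pow_le_one₀ hq0.le hq1.le) hηC hηC' hκC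
      refine le_trans ?_ (ih (hn.trans hqn))
      rw [pow_succ, mul_assoc]
      gcongr
  obtain ⟨n, hn, hn'⟩ := exists_nat_pow_near_of_lt_one hr0 hr.le hq0 hq1
  have h₁ := hiter n (hα.trans hn')
  have h₂ : (pairMeasure μ μ').real (nearSet X Y r) ≤
      (pairMeasure μ μ').real (nearSet X Y (q ^ n)) := measureReal_mono (nearSet_mono _ _ hn')
  have h₃ : 1 ≤ (1 + ε) ^ (n + 1) * r ^ β := by
    calc (1 : ℝ) ≤ ((1 + ε) * q ^ β) ^ (n + 1) := one_le_pow₀ hβ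
      _ = (1 + ε) ^ (n + 1) * (q ^ (n + 1)) ^ β := by
        rw [mul_pow, ← Real.rpow_natCast (q ^ β), ← Real.rpow_mul hq0.le, mul_comm β,
          Real.rpow_mul hq0.le, Real.rpow_natCast]
      _ ≤ _ := by gcongr
  have hP : 0 < (1 + ε) ^ n := by positivity
  refine h₂.trans (le_of_mul_le_mul_left (h₁.trans ?_) hP)
  have hrβ : 0 < r ^ β := by positivity
  calc 2 * C ^ 2 ≤ 2 * C ^ 2 * ((1 + ε) ^ (n + 1) * r ^ β) := le_mul_of_one_le_right (by positivity) h₃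
    _ = (1 + ε) ^ n * ((1 + ε) * (2 * C ^ 2) * r ^ β) := by ring
    _ ≤ (1 + ε) ^ n * ((1 + 1) * (2 * C ^ 2) * r ^ β) := by gcongr
    _ = _ := by ring

lemma exists_scale_parameters (hC : 1 ≤ C) (hδ0 : 0 < δ) (hδ1 : δ < 1) :
    ∃ η κ : ℝ, 0 < η ∧ 100 * η ≤ 1 ∧ 0 < κ ∧ 2 * κ ≤ 1 ∧ C ^ 2 * (52 * η) ^ δ < 1 ∧
      1 ≤ 200 * C ^ 2 * η ^ δ ∧ 8 * C ^ 2 * κ ^ (1 - δ) ≤ 1 ∧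
      1 ≤ (1 + C⁻¹ ^ 10 / 10 ^ 11) *
        (η * κ / 100) ^ (1 / 10 ^ 14 * min δ (1 - δ) * C ^ (-25 : ℝ)) := by
  have hC0 : 0 < C := by linarith
  have hC2 : 1 ≤ C ^ 2 := one_le_pow₀ hC
  have h1δ : 0 < 1 - δ := by linarith
  set a := (2 * C ^ 2) ^ (-(1 / δ)) with ha
  set κ := (8 * C ^ 2) ^ (-(1 / (1 - δ))) with hκ
  have ha0 : 0 < a := by positivity
  have hκ0 : 0 < κ := by positivity
  have haδ : a ^ δ = (2 * C ^ 2)⁻¹ := by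
    rw [ha, ← Real.rpow_mul (by positivity), ← Real.rpow_neg_one]
    congr 1; field_simp
  have hκδ : κ ^ (1 - δ) = (8 * C ^ 2)⁻¹ := by
    rw [hκ, ← Real.rpow_mul (by positivity), ← Real.rpow_neg_one]
    congr 1; field_simp
  have ha1 : a ≤ 1 := Real.rpow_le_one_of_one_le_of_nonpos (by linarith)
    (by rw [neg_nonpos]; positivity)
  have hκ1 : 2 * κ ≤ 1 := by
    have : κ ≤ (8 * C ^ 2) ^ (-1 : ℝ) := by
      refine Real.rpow_le_rpow_of_exponent_le (by linarith) (neg_le_neg ?_)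
      rw [le_div_iff₀ h1δ]; linarith
    rw [Real.rpow_neg_one] at this
    have h2 : (8 * C ^ 2)⁻¹ ≤ 8⁻¹ := by gcongr; linarith
    linarith
  refine ⟨a / 100, κ, by positivity, by linarith, hκ0, hκ1, ?_, ?_, ?_, ?_⟩
  · have h1 : (52 * (a / 100)) ^ δ ≤ a ^ δ := by gcongr; linarith
    rw [haδ] at h1
    calc C ^ 2 * (52 * (a / 100)) ^ δ ≤ C ^ 2 * (2 * C ^ 2)⁻¹ := by gcongr
      _ = 1 / 2 := by field_simp
      _ < 1 := by norm_num
  · rw [Real.div_rpow ha0.le (by norm_num), haδ]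
    have h1 : (100 : ℝ) ^ δ ≤ 100 := by
      simpa using Real.rpow_le_rpow_of_exponent_le (x := 100) (by norm_num) hδ1.le
    have h2 : 200 * C ^ 2 * ((2 * C ^ 2)⁻¹ / 100 ^ δ) = 100 / 100 ^ δ := by field_simp; norm_num
    rw [h2, le_div_iff₀ (by positivity)]
    linarith
  · rw [hκδ, mul_inv_cancel₀ (by positivity)]
  · set m := min δ (1 - δ) with hm
    have hm0 : 0 < m := lt_min hδ0 h1δ
    have hm1 : m ≤ 1 := (min_le_left _ _).trans hδ1.le
    set q := a / 100 * κ / 100 with hq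
    have hq0 : 0 < q := by positivity
    have hlog : -(210 * C ^ 2 / m) ≤ Real.log q := by
      have e1 : Real.log q = Real.log a + Real.log κ - Real.log 100 - Real.log 100 := by
        rw [hq, Real.log_div (by positivity) (by norm_num), Real.log_mul (by positivity) hκ0.ne',
          Real.log_div ha0.ne' (by norm_num)]
        ring
      have e2 : -(2 * C ^ 2 / m) ≤ Real.log a := by
        rw [ha, Real.log_rpow (by positivity)]
        have h1 : Real.log (2 * C ^ 2) ≤ 2 * C ^ 2 := Real.log_le_self (by positivity)
        have h2 : 1 / δ ≤ 1 / m := one_div_le_one_div_of_le hm0 (min_le_left _ _)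
        have h3 : 1 / δ * Real.log (2 * C ^ 2) ≤ 1 / m * (2 * C ^ 2) :=
          mul_le_mul h2 h1 (Real.log_nonneg (by linarith)) (by positivity)
        have h4 : 1 / m * (2 * C ^ 2) = 2 * C ^ 2 / m := by ring
        linarith
      have e3 : -(8 * C ^ 2 / m) ≤ Real.log κ := by
        rw [hκ, Real.log_rpow (by positivity)]
        have h1 : Real.log (8 * C ^ 2) ≤ 8 * C ^ 2 := Real.log_le_self (by positivity)
        have h2 : 1 / (1 - δ) ≤ 1 / m := one_div_le_one_div_of_le hm0 (min_le_right _ _)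
        have h3 : 1 / (1 - δ) * Real.log (8 * C ^ 2) ≤ 1 / m * (8 * C ^ 2) :=
          mul_le_mul h2 h1 (Real.log_nonneg (by linarith)) (by positivity)
        have h4 : 1 / m * (8 * C ^ 2) = 8 * C ^ 2 / m := by ring
        linarith
      have e4 : Real.log 100 ≤ 100 * C ^ 2 / m := by
        have h1 : Real.log 100 ≤ 100 := Real.log_le_self (by norm_num)
        have h2 : (100 : ℝ) ≤ 100 * C ^ 2 / m := by
          rw [le_div_iff₀ hm0]; nlinarith
        linarith
      have e5 : 210 * C ^ 2 / m = 2 * C ^ 2 / m + 8 * C ^ 2 / m + 100 * C ^ 2 / m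
          + 100 * C ^ 2 / m := by ring
      linarith
    have hC25 : C ^ (-25 : ℝ) = C⁻¹ ^ 25 := by
      rw [Real.rpow_neg hC0.le, inv_pow]
      norm_cast
    set D := C⁻¹ ^ 10 with hD
    have hD0 : 0 < D := by positivity
    have hD1 : D ≤ 1 := pow_le_one₀ (by positivity) (inv_le_one_of_one_le₀ hC)
    set β := 1 / 10 ^ 14 * m * C ^ (-25 : ℝ) with hβ
    have hβ0 : 0 < β := by positivity
    have hexp : 1 - D / 10 ^ 11 / 2 ≤ q ^ β := by
      rw [Real.rpow_def_of_pos hq0]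
      have h1 : -(D / 10 ^ 11 / 2) ≤ Real.log q * β := by
        have h2 : -(210 * C ^ 2 / m) * β ≤ Real.log q * β := by gcongr
        have h3 : -(210 * C ^ 2 / m) * β = -(210 / 10 ^ 14 * C⁻¹ ^ 23) := by
          rw [hβ, hC25]; field_simp
        have h4 : C⁻¹ ^ 23 ≤ D :=
          pow_le_pow_of_le_one (by positivity) (inv_le_one_of_one_le₀ hC) (by norm_num)
        linarith
      have h5 := Real.add_one_le_exp (Real.log q * β)
      linarith
    have hDD : 0 ≤ 1 + D / 10 ^ 11 := by positivity
    have := mul_le_mul_of_nonneg_left hexp hDD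
    nlinarith

lemma RegularPair.translate (hX : RegularPair δ α C X μ) (u : ℝ) :
    RegularPair δ α C ((fun y => y - u) ⁻¹' X) (μ.map (fun x => x + u)) := by
  have hmeas : Measurable (fun x : ℝ => x + u) := by fun_prop
  have hcl : IsClosed ((fun y => y - u) ⁻¹' X) := hX.closed.preimage (by fun_prop)
  have hball : ∀ x r, (fun x : ℝ => x + u) ⁻¹' closedBall x r = closedBall (x - u) r := by
    intro x r
    ext z
    simp only [mem_preimage, mem_closedBall, Real.dist_eq]
    rw [show z - (x - u) = z + u - x by ring]
  refine ⟨hcl, ?_, ?_, fun x r h₁ h₂ => ?_, fun x hx r h₁ h₂ => ?_⟩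
  · obtain ⟨x, hx⟩ := hX.nonempty
    exact ⟨x + u, by simpa using hx⟩
  · rw [Measure.map_apply hmeas hcl.measurableSet.compl]
    convert hX.null using 2
    ext z; simp
  · rw [map_measureReal_apply hmeas measurableSet_closedBall, hball]
    exact hX.upper _ r h₁ h₂
  · rw [map_measureReal_apply hmeas measurableSet_closedBall, hball]
    exact hX.lower _ hx r h₁ h₂

lemma RegularPair.measure_quadruples_le [IsFiniteMeasure μ] (hX : RegularPair δ α C X μ)
    {r : ℝ} (hr : α ≤ r) (hr0 : 0 ≤ r) (hr1 : r ≤ 1) (u : ℝ) :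
    (μ.prod (μ.prod μ)) {p | |u + p.1 - p.2.1 - p.2.2| ≤ r} ≤
      ENNReal.ofReal (C * r ^ δ) * ENNReal.ofReal ((pairMeasure μ (μ.map (fun x => x + u))).real
        (nearSet X ((fun y => y - u) ⁻¹' X) r)) := by
  set Y := (fun y => y - u) ⁻¹' X with hY
  have hm : MeasurableSet {p : ℝ × ℝ × ℝ | |u + p.1 - p.2.1 - p.2.2| ≤ r} :=
    measurableSet_le (f := fun p : ℝ × ℝ × ℝ => |u + p.1 - p.2.1 - p.2.2|) (by fun_prop)
      measurable_const
  set S := (fun p : ℝ × ℝ => (p.1, p.1 + p.2)) ⁻¹' nearSet X Y r with hS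
  have hSm : MeasurableSet S := measurable_shear (measurableSet_nearSet X Y r)
  have hae : ∀ᵐ p ∂(μ.prod μ), p.2 ∈ X := by
    have h0 : ∀ᵐ x ∂μ, x ∈ X := by rw [ae_iff]; exact hX.null
    exact Measure.quasiMeasurePreserving_snd.ae h0
  have hb : ∀ x, μ (closedBall x r) ≤ ENNReal.ofReal (C * r ^ δ) := fun x => by
    rw [← ofReal_measureReal]
    exact ENNReal.ofReal_le_ofReal (hX.upper x r hr hr1)
  rw [Measure.prod_apply_symm hm]
  calc ∫⁻ p, μ ((fun x => (x, p)) ⁻¹' {p : ℝ × ℝ × ℝ | |u + p.1 - p.2.1 - p.2.2| ≤ r}) ∂μ.prod μ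
      ≤ ∫⁻ p, S.indicator (fun _ => ENNReal.ofReal (C * r ^ δ)) p ∂μ.prod μ := by
        refine lintegral_mono_ae ?_
        filter_upwards [hae] with p hp
        have hset : (fun x => (x, p)) ⁻¹' {p : ℝ × ℝ × ℝ | |u + p.1 - p.2.1 - p.2.2| ≤ r} =
            closedBall (p.1 + p.2 - u) r := by
          ext x
          simp only [mem_preimage, mem_ofPred_eq, mem_closedBall, Real.dist_eq]
          rw [show x - (p.1 + p.2 - u) = u + x - p.1 - p.2 by ring]
        rw [hset]
        by_cases hpS : p ∈ S
        · rw [indicator_of_mem hpS]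
          exact hb _
        · rw [indicator_of_notMem hpS]
          have hsub : closedBall (p.1 + p.2 - u) r ⊆ Xᶜ := by
            intro x hx hxX
            apply hpS
            constructor
            · have hxY : x + u ∈ Y := by simpa [hY] using hxX
              refine (infDist_le_dist_of_mem hxY).trans ?_
              rw [mem_closedBall, Real.dist_eq, abs_sub_comm] at hx
              rw [Real.dist_eq]
              rwa [show p.1 + p.2 - (x + u) = p.1 + p.2 - u - x by ring]
            · simpa [infDist_zero_of_mem hp] using hr0
          exact (measure_mono_null hsub hX.null).le
    _ = ENNReal.ofReal (C * r ^ δ) * (μ.prod μ) S := by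
        rw [lintegral_indicator hSm]; simp
    _ ≤ _ := by
        gcongr
        rw [← ofReal_measureReal]
        refine ENNReal.ofReal_le_ofReal ?_
        rw [pairMeasure_real_apply (measurableSet_nearSet X Y r)]
        exact le_add_of_nonneg_right measureReal_nonneg

end

lemma IsRegularMeasure.measure_univ_le {δ α C : ℝ} {X : Set ℝ} {μ : Measure ℝ}
    (hμ : IsRegularMeasure δ α 1 C X μ) (hα : α ≤ 1) (hX : X ⊆ Icc 0 1) :
    μ univ ≤ ENNReal.ofReal C := by
  have hsub : (univ : Set ℝ) ⊆ closedBall 0 1 ∪ Xᶜ := by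
    intro x _
    by_cases hx : x ∈ X
    · left
      rw [mem_closedBall, Real.dist_eq, abs_le]
      constructor <;> linarith [(hX hx).1, (hX hx).2]
    · exact .inr hx
  calc μ univ ≤ μ (closedBall 0 1) + μ Xᶜ := (measure_mono hsub).trans (measure_union_le _ _)
    _ = μ (closedBall 0 1) := by rw [hμ.2.1, add_zero]
    _ ≤ ENNReal.ofReal (C * 1 ^ δ) := hμ.2.2.1 0 1 hα le_rfl
    _ = ENNReal.ofReal C := by simp

lemma IsRegularMeasure.regularPair {δ α C : ℝ} {X : Set ℝ} {μ : Measure ℝ} [IsFiniteMeasure μ]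
    (hμ : IsRegularMeasure δ α 1 C X μ) (hα : 0 ≤ α) (hC : 0 ≤ C) (hX : IsClosed X)
    (hne : X.Nonempty) : RegularPair δ α C X μ where
  closed := hX
  nonempty := hne
  null := hμ.2.1
  upper x r h₁ h₂ := by
    have : 0 ≤ r := hα.trans h₁
    exact ENNReal.toReal_le_of_le_ofReal (by positivity) (hμ.2.2.1 x r h₁ h₂)
  lower x hx r h₁ h₂ :=
    (ENNReal.ofReal_le_iff_le_toReal (measure_ne_top _ _)).1 (hμ.2.2.2 x hx r h₁ h₂)

/-- **Improved additive energy bound for regular measures on `ℝ`.**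
If `X ⊆ [0,1]` is `δ`-regular on scales `[α,1]` with constant `C` and associated regular
measure `μ`, then `E(μ, r) ≤ A · r^(δ+β)` for all `α ≤ r < 1`, where
`β = c · min(δ, 1-δ) · C⁻²⁵` with `c > 0` an absolute constant and `A` depending only on
`C` and `δ`. -/
theorem additive_energy_regular_one_dim :
    ∃ c : ℝ, 0 < c ∧
      ∀ (δ C : ℝ), 0 < δ → δ < 1 → 1 < C →
        ∃ A : ℝ, 0 < A ∧
          ∀ (α : ℝ) (X : Set ℝ) (μ : Measure ℝ),
            0 < α → α < 1 →
            X ⊆ Set.Icc 0 1 → IsClosed X → X.Nonempty →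
            IsRegularMeasure δ α 1 C X μ →
            ∀ r : ℝ, α ≤ r → r < 1 →
              addEnergy μ r ≤
                ENNReal.ofReal (A * r ^ (δ + c * min δ (1 - δ) * C ^ (-25 : ℝ))) := by
  refine ⟨1 / 10 ^ 14, by norm_num, fun δ C hδ0 hδ1 hC => ⟨4 * C ^ 4, by positivity, ?_⟩⟩
  intro α X μ hα0 hα1 hX01 hXc hXne hμ r hαr hr1
  have hr0 : 0 < r := by linarith
  have hC0 : 0 < C := by linarith
  have huniv := hμ.measure_univ_le hα1.le hX01
  have : IsFiniteMeasure μ := ⟨huniv.trans_lt ENNReal.ofReal_lt_top⟩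
  have hreg := hμ.regularPair hα0.le hC0.le hXc hXne
  have hmass : μ.real univ ≤ C := ENNReal.toReal_le_of_le_ofReal hC0.le huniv
  obtain ⟨η, κ, hη, hη1, hκ, hκ1, hηC, hηC', hκC, hβ⟩ := exists_scale_parameters hC.le hδ0 hδ1
  set β := 1 / 10 ^ 14 * min δ (1 - δ) * C ^ (-25 : ℝ)
  have hβ0 : 0 ≤ β := by
    have : 0 ≤ min δ (1 - δ) := le_min hδ0.le (by linarith)
    positivity
  have hslice : ∀ u : ℝ, (μ.prod (μ.prod μ)) {p | |u + p.1 - p.2.1 - p.2.2| ≤ r} ≤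
      ENNReal.ofReal (C * r ^ δ * (4 * C ^ 2 * r ^ β)) := fun u => by
    refine (hreg.measure_quadruples_le hαr hr0.le hr1.le u).trans ?_
    rw [ENNReal.ofReal_mul (p := C * r ^ δ) (by positivity)]
    refine mul_le_mul' le_rfl (ENNReal.ofReal_le_ofReal ?_)
    refine hreg.pairMeasure_nearSet_le hC.le (hreg.translate u) hmass ?_ hδ1.le hα0 hη hη1
      hκ hκ1 hαr hr1 hηC hηC' hκC hβ0 hβ
    rw [map_measureReal_apply (by fun_prop) MeasurableSet.univ, preimage_univ]
    exact hmass
  have hm : MeasurableSet {p : ℝ × ℝ × ℝ × ℝ | ‖p.1 + p.2.1 - p.2.2.1 - p.2.2.2‖ ≤ r} :=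
    measurableSet_le (f := fun p : ℝ × ℝ × ℝ × ℝ => ‖p.1 + p.2.1 - p.2.2.1 - p.2.2.2‖)
      (by fun_prop) measurable_const
  calc addEnergy μ r
      = ∫⁻ u, (μ.prod (μ.prod μ)) {p | |u + p.1 - p.2.1 - p.2.2| ≤ r} ∂μ := by
        rw [addEnergy, Measure.prod_apply hm]; rfl
    _ ≤ ∫⁻ _, ENNReal.ofReal (C * r ^ δ * (4 * C ^ 2 * r ^ β)) ∂μ := lintegral_mono hslice
    _ = ENNReal.ofReal (C * r ^ δ * (4 * C ^ 2 * r ^ β)) * μ univ := lintegral_const _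
    _ ≤ ENNReal.ofReal (C * r ^ δ * (4 * C ^ 2 * r ^ β)) * ENNReal.ofReal C :=
        mul_le_mul' le_rfl huniv
    _ = ENNReal.ofReal (4 * C ^ 4 * r ^ (δ + β)) := by
        rw [← ENNReal.ofReal_mul (by positivity), Real.rpow_add hr0]
        congr 1; ring
end

section
/- Let d ≥ 1 be an integer, let 0 < δ < d be a non-integer, and let C > 1 and 0 < α < 1. Let X ⊆ B(0,1) ⊆ ℝ^d be a δ-regular set on scales [α,1] with constant C, and let μ = μ_X be an associated regular measure. Then there exist constants K₁, K₂ > 0 depending only on δ and d, and a constant A depending only on C, δ and d, such that for every α ≤ r < 1 one has E(μ, r) ≤ A · r^{δ+β}, where β = exp(−K₁·(1 + (log C)^{K₂})). -/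
open MeasureTheory Metric Set
open scoped ENNReal Pointwise

section BalogSzemerediGowers

open Finset
open scoped Classical in
/-- Dependent random choice: a dense bipartite graph on `A × A` contains a large set of vertices any
two of which are joined by many paths of length four. -/
theorem exists_subset_many_paths {V : Type*} (A : Finset V) (G : V → V → Prop) {γ : ℝ}
    (hγ : 0 < γ) (hA : A.Nonempty)
    (hG : γ * (#A : ℝ) ^ 2 ≤ #{p ∈ A ×ˢ A | G p.1 p.2}) :
    ∃ B ⊆ A, γ / 4 * #A ≤ (#B : ℝ) ∧ ∀ a ∈ B, ∀ a' ∈ B,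
      γ / 4 * #A * (γ ^ 2 / 16 * #A) ^ 2 ≤
        (#{q ∈ A ×ˢ A ×ˢ A | G a q.2.1 ∧ G q.1 q.2.1 ∧ G q.1 q.2.2 ∧ G a' q.2.2} : ℝ) := by
  set n : ℝ := (#A : ℝ) with hn
  have hn0 : 0 < n := by simpa [hn] using hA
  let nb : V → Finset V := fun b => {a ∈ A | G a b}
  let codeg : V → V → ℕ := fun a a' => #{b ∈ A | G a b ∧ G a' b}
  let bad : Finset (V × V) := {p ∈ A ×ˢ A | (codeg p.1 p.2 : ℝ) < γ ^ 2 / 16 * n}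
  let badAt : V → Finset (V × V) := fun b => {p ∈ bad | G p.1 b ∧ G p.2 b}
  have hsum : γ * n ^ 2 ≤ ∑ b ∈ A, (#(nb b) : ℝ) := by
    refine hG.trans (le_of_eq ?_)
    rw [card_filter, Finset.sum_product_right]
    push_cast
    simp [nb]
  have hsq : γ ^ 2 * n ^ 3 ≤ ∑ b ∈ A, (#(nb b) : ℝ) ^ 2 := by
    have h1 := sq_sum_le_card_mul_sum_sq (s := A) (f := fun b => (#(nb b) : ℝ))
    have h2 : (γ * n ^ 2) ^ 2 ≤ (∑ b ∈ A, (#(nb b) : ℝ)) ^ 2 := by gcongr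
    have h3 : n * (γ ^ 2 * n ^ 3) ≤ n * ∑ b ∈ A, (#(nb b) : ℝ) ^ 2 := by
      calc n * (γ ^ 2 * n ^ 3) = (γ * n ^ 2) ^ 2 := by ring
        _ ≤ _ := h2.trans h1
    exact le_of_mul_le_mul_left h3 hn0
  have hbad : ∑ b ∈ A, (#(badAt b) : ℝ) ≤ γ ^ 2 / 16 * n * n ^ 2 := by
    have h1 : ∑ b ∈ A, (#(badAt b) : ℝ) = ∑ p ∈ bad, (codeg p.1 p.2 : ℝ) := by
      simp only [badAt, codeg, card_filter]
      push_cast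
      exact Finset.sum_comm
    rw [h1]
    calc ∑ p ∈ bad, (codeg p.1 p.2 : ℝ) ≤ ∑ p ∈ bad, γ ^ 2 / 16 * n :=
          Finset.sum_le_sum fun p hp => (mem_filter.1 hp).2.le
      _ = #bad * (γ ^ 2 / 16 * n) := by simp
      _ ≤ #(A ×ˢ A) * (γ ^ 2 / 16 * n) := by
          gcongr
          exact filter_subset _ _
      _ = _ := by
          rw [card_product]; push_cast; ring
  obtain ⟨b, -, hb⟩ : ∃ b ∈ A, γ ^ 2 / 2 * n ^ 2 ≤ (#(nb b) : ℝ) ^ 2 - 8 * #(badAt b) := by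
    apply exists_le_of_sum_le hA
    rw [sum_sub_distrib, ← Finset.mul_sum A (fun b => (#(badAt b) : ℝ)), sum_const, nsmul_eq_mul,
      ← hn]
    have h1 : n * (γ ^ 2 / 2 * n ^ 2) = γ ^ 2 * n ^ 3 - 8 * (γ ^ 2 / 16 * n * n ^ 2) := by ring
    rw [h1]
    gcongr
  have hN : γ / 2 * n ≤ #(nb b) := by
    apply le_of_sq_le_sq _ (by positivity)
    have : (0 : ℝ) ≤ #(badAt b) := by positivity
    have : 0 ≤ (γ * n) ^ 2 := by positivity
    nlinarith
  have hNpos : (0 : ℝ) < #(nb b) := lt_of_lt_of_le (by positivity) hN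
  have hbadb : 8 * (#(badAt b) : ℝ) ≤ (#(nb b) : ℝ) ^ 2 := by
    have : 0 ≤ γ ^ 2 / 2 * n ^ 2 := by positivity
    linarith
  let badNb : V → Finset V := fun a => {x ∈ nb b | (a, x) ∈ bad}
  let B : Finset V := {a ∈ nb b | (#(badNb a) : ℝ) < #(nb b) / 4}
  have hcompl : #(nb b) / 4 * (#{a ∈ nb b | ¬ (#(badNb a) : ℝ) < #(nb b) / 4} : ℝ)
      ≤ #(badAt b) := by
    have h1 : (#(badAt b) : ℝ) = ∑ a ∈ nb b, (#(badNb a) : ℝ) := by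
      have : badAt b = {p ∈ nb b ×ˢ nb b | p ∈ bad} := by
        ext p
        simp only [badAt, bad, nb, mem_filter, mem_product]
        tauto
      rw [this, card_filter, sum_product]
      push_cast
      simp [badNb]
    rw [h1, mul_comm, ← nsmul_eq_mul]
    refine (card_nsmul_le_sum _ _ _ ?_).trans (sum_le_sum_of_subset_of_nonneg
      (filter_subset _ _) fun _ _ _ => by positivity)
    intro a ha
    exact not_lt.1 (mem_filter.1 ha).2
  have hsplit : (#B : ℝ) + #{a ∈ nb b | ¬ (#(badNb a) : ℝ) < #(nb b) / 4} = #(nb b) := by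
    exact_mod_cast card_filter_add_card_filter_not (s := nb b)
      (fun a => (#(badNb a) : ℝ) < #(nb b) / 4)
  have hBcard : (#(nb b) : ℝ) / 2 ≤ #B := by
    nlinarith
  refine ⟨B, (filter_subset _ _).trans (filter_subset _ _), by linarith, ?_⟩
  intro a ha a' ha'
  have ha2 := (mem_filter.1 ha)
  have ha2' := (mem_filter.1 ha')
  have haA : a ∈ A := (mem_filter.1 ha2.1).1
  have haA' : a' ∈ A := (mem_filter.1 ha2'.1).1
  let good : Finset V := {x ∈ nb b | (a, x) ∉ bad ∧ (a', x) ∉ bad}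
  have hgood : (#(nb b) : ℝ) / 2 ≤ #good := by
    have hsub : nb b ⊆ good ∪ (badNb a ∪ badNb a') := by
      intro x hx
      simp only [good, badNb, Finset.mem_union, mem_filter]
      tauto
    have h1 : #(nb b) ≤ #good + (#(badNb a) + #(badNb a')) :=
      (Finset.card_le_card hsub).trans ((Finset.card_union_le _ _).trans
        (Nat.add_le_add_left (Finset.card_union_le _ _) _))
    have h2 : (#(nb b) : ℝ) ≤ #good + (#(badNb a) + #(badNb a')) := by exact_mod_cast h1
    linarith [ha2.2, ha2'.2]
  have hcod : ∀ c ∈ A, ∀ x ∈ nb b, (c, x) ∉ bad → γ ^ 2 / 16 * n ≤ codeg c x := by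
    intro c hc x hx h
    by_contra! h'
    exact h (mem_filter.2 ⟨mk_mem_product hc (mem_filter.1 hx).1, h'⟩)
  calc γ / 4 * n * (γ ^ 2 / 16 * n) ^ 2 ≤ #good * (γ ^ 2 / 16 * n) ^ 2 := by
        gcongr; linarith
    _ = ∑ x ∈ good, (γ ^ 2 / 16 * n) ^ 2 := by simp
    _ ≤ ∑ x ∈ good, (codeg a x * codeg a' x : ℝ) := by
        refine Finset.sum_le_sum fun x hx => ?_
        obtain ⟨hx1, hx2, hx3⟩ := mem_filter.1 hx
        rw [sq]
        exact mul_le_mul (hcod a haA x hx1 hx2) (hcod a' haA' x hx1 hx3) (by positivity)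
          (by positivity)
    _ ≤ ∑ x ∈ A, (codeg a x * codeg a' x : ℝ) :=
        sum_le_sum_of_subset_of_nonneg ((filter_subset _ _).trans (filter_subset _ _))
          fun _ _ _ => by positivity
    _ = _ := by
        rw [card_filter, sum_product]
        push_cast
        refine Finset.sum_congr rfl fun x _ => ?_
        rw [← Nat.cast_mul, ← card_product]
        have : ({y ∈ A | G a y ∧ G x y} : Finset V) ×ˢ ({y ∈ A | G a' y ∧ G x y} : Finset V) =
            {q ∈ A ×ˢ A | G a q.1 ∧ G x q.1 ∧ G x q.2 ∧ G a' q.2} := by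
          ext q
          simp only [mem_filter, mem_product]
          tauto
        rw [this, card_filter]
        push_cast
        rfl

open scoped Classical in
/-- The number of `(a, b, c, d) ∈ A × B × C × D` with `a + b - c - d = h`. -/
noncomputable def quadCount {G : Type*} [AddCommGroup G] (A B C D : Finset G) (h : G) : ℕ :=
  #{p ∈ (A ×ˢ C) ×ˢ (D ×ˢ B) | p.1.1 - p.1.2 = p.2.1 - p.2.2 + h}

open scoped Classical in
theorem quadCount_self_eq_sum {G : Type*} [AddCommGroup G] (A : Finset G) :
    quadCount A A A A 0 =
      ∑ p ∈ A ×ˢ A, #{q ∈ A ×ˢ A | q.1 - q.2 = p.1 - p.2} := by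
  rw [quadCount, card_filter, sum_product_right]
  simp only [add_zero, card_filter]

open scoped Classical in
theorem card_filter_eq_eq_sum {S T X : Type*} (s : Finset S) (t : Finset T) (f : S → X)
    (g : T → X) (U : Finset X) (hU : s.image f ⊆ U) :
    #{p ∈ s ×ˢ t | f p.1 = g p.2} = ∑ x ∈ U, #{a ∈ s | f a = x} * #{b ∈ t | g b = x} := by
  rw [card_eq_sum_card_fiberwise (f := fun p => f p.1) (t := U)]
  · refine Finset.sum_congr rfl fun x _ => ?_
    rw [← card_product]
    congr 1
    ext p
    simp only [mem_filter, mem_product]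
    constructor
    · rintro ⟨⟨⟨h1, h2⟩, h3⟩, h4⟩
      exact ⟨⟨h1, h4⟩, h2, h3 ▸ h4⟩
    · rintro ⟨⟨h1, h2⟩, h3, h4⟩
      exact ⟨⟨⟨h1, h3⟩, h2.trans h4.symm⟩, h2⟩
  · intro p hp
    exact hU (mem_image_of_mem _ (mem_product.1 (mem_filter.1 hp).1).1)

open scoped Classical in
theorem two_mul_card_filter_eq_le {S T X : Type*} (s : Finset S) (t : Finset T) (f : S → X)
    (g : T → X) :
    2 * #{p ∈ s ×ˢ t | f p.1 = g p.2} ≤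
      #{p ∈ s ×ˢ s | f p.1 = f p.2} + #{p ∈ t ×ˢ t | g p.1 = g p.2} := by
  let U := s.image f ∪ t.image g
  rw [card_filter_eq_eq_sum s t f g U subset_union_left,
    card_filter_eq_eq_sum s s f f U subset_union_left,
    card_filter_eq_eq_sum t t g g U subset_union_right, ← sum_add_distrib, mul_sum]
  refine Finset.sum_le_sum fun x _ => ?_
  nlinarith [two_mul_le_add_sq (#{a ∈ s | f a = x}) (#{b ∈ t | g b = x})]

open scoped Classical in
theorem four_mul_quadCount_le {G : Type*} [AddCommGroup G] (A B C D : Finset G) (h : G) :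
    4 * quadCount A B C D h ≤ quadCount A A A A 0 + quadCount B B B B 0 + quadCount C C C C 0 +
      quadCount D D D D 0 := by
  have swap : ∀ (A B : Finset G) (h : G),
      #{p ∈ (A ×ˢ B) ×ˢ (A ×ˢ B) | p.1.1 - p.1.2 + h = p.2.1 - p.2.2 + h} =
        quadCount A B A B 0 := by
    intro A B h
    refine card_bij (fun p _ => ((p.1.1, p.2.1), (p.1.2, p.2.2))) ?_ ?_ ?_
    · rintro ⟨⟨a, b⟩, c, d⟩ hp
      simp only [mem_filter, mem_product] at hp ⊢
      refine ⟨⟨⟨hp.1.1.1, hp.1.2.1⟩, hp.1.1.2, hp.1.2.2⟩, ?_⟩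
      have := add_right_cancel hp.2
      rw [add_zero, sub_eq_sub_iff_add_eq_add] at *
      rw [this]; abel
    · rintro ⟨⟨a, b⟩, c, d⟩ - ⟨⟨a', b'⟩, c', d'⟩ -
      simp only [Prod.mk.injEq]
      tauto
    · rintro ⟨⟨a, c⟩, b, d⟩ hp
      simp only [mem_filter, mem_product, add_zero] at hp
      refine ⟨((a, b), c, d), ?_, rfl⟩
      simp only [mem_filter, mem_product]
      refine ⟨⟨⟨hp.1.1.1, hp.1.2.1⟩, hp.1.1.2, hp.1.2.2⟩, ?_⟩
      have := hp.2
      rw [add_left_inj]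
      rw [sub_eq_sub_iff_add_eq_add] at *
      rw [this]; abel
  have h1 := two_mul_card_filter_eq_le (A ×ˢ C) (D ×ˢ B) (fun p => p.1 - p.2)
    (fun p => p.1 - p.2 + h)
  have h2 := two_mul_card_filter_eq_le (A ×ˢ A) (C ×ˢ C) (fun p => p.1 - p.2)
    (fun p => p.1 - p.2)
  have h3 := two_mul_card_filter_eq_le (D ×ˢ D) (B ×ˢ B) (fun p => p.1 - p.2)
    (fun p => p.1 - p.2)
  have h4 := swap A C 0
  have h5 := swap D B h
  simp only [quadCount, add_zero] at *
  omega

open scoped Classical in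
/-- **Balog–Szemerédi–Gowers**. -/
theorem exists_subset_card_sub_le {G : Type*} [AddCommGroup G] (A : Finset G) {γ : ℝ}
    (hγ : 0 < γ) (hA : A.Nonempty) (hE : 2 * γ * (#A : ℝ) ^ 3 ≤ quadCount A A A A 0) :
    ∃ B ⊆ A, γ / 4 * #A ≤ (#B : ℝ) ∧ (#(B - B) : ℝ) ≤ 1024 / γ ^ 9 * #A := by
  set n : ℝ := (#A : ℝ) with hn
  have hn0 : 0 < n := by simpa [hn] using hA
  let r : G → ℕ := fun x => #{q ∈ A ×ˢ A | q.1 - q.2 = x}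
  have hr : ∀ x, (r x : ℝ) ≤ n := by
    intro x
    simp only [r, hn, Nat.cast_le]
    refine card_le_card_of_injOn Prod.fst (fun p hp => ?_) ?_
    · exact (mem_product.1 (mem_filter.1 hp).1).1
    · rintro ⟨a, b⟩ hp ⟨c, d⟩ hq h
      have h1 := (mem_filter.1 hp).2
      have h2 := (mem_filter.1 hq).2
      simp only at h h1 h2
      subst h
      rw [← h2] at h1
      simpa using h1
  have hrE : (quadCount A A A A 0 : ℝ) = ∑ p ∈ A ×ˢ A, (r (p.1 - p.2) : ℝ) := by
    rw [quadCount_self_eq_sum]; push_cast; rfl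
  let P : G → G → Prop := fun a b => γ * n ≤ r (a - b)
  let S : Finset (G × G) := {p ∈ A ×ˢ A | P p.1 p.2}
  have hS : γ * n ^ 2 ≤ #S := by
    have h1 : (quadCount A A A A 0 : ℝ) ≤ n * #S + γ * n * n ^ 2 := by
      rw [hrE, ← sum_filter_add_sum_filter_not (A ×ˢ A) (fun p => P p.1 p.2)]
      gcongr
      · calc _ ≤ ∑ p ∈ S, n := Finset.sum_le_sum fun p _ => hr _
          _ = _ := by simp [mul_comm]
      · calc _ ≤ ∑ p ∈ A ×ˢ A with ¬ P p.1 p.2, γ * n :=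
              Finset.sum_le_sum fun p hp => (not_le.1 (mem_filter.1 hp).2).le
          _ ≤ ∑ p ∈ A ×ˢ A, γ * n :=
              sum_le_sum_of_subset_of_nonneg (filter_subset _ _) fun _ _ _ => by positivity
          _ = _ := by rw [sum_const, card_product, nsmul_eq_mul]; push_cast; rw [← hn]; ring
    have h2 : n * (γ * n ^ 2) ≤ n * #S := by nlinarith
    exact le_of_mul_le_mul_left h2 hn0
  obtain ⟨B, hBA, hB, hpath⟩ := exists_subset_many_paths A P hγ hA hS
  refine ⟨B, hBA, hB, ?_⟩
  let D : Finset G := S.image fun p => p.1 - p.2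
  have hD : (#D : ℝ) * (γ * n) ≤ n ^ 2 := by
    have h1 : (∑ x ∈ D, r x : ℕ) ≤ #(A ×ˢ A) := by
      have h2 := card_eq_sum_card_image (fun p : G × G => p.1 - p.2) (A ×ˢ A)
      rw [h2]
      exact sum_le_sum_of_subset (image_subset_image (filter_subset _ _))
    calc (#D : ℝ) * (γ * n) = ∑ x ∈ D, γ * n := by simp
      _ ≤ ∑ x ∈ D, (r x : ℝ) := by
          refine Finset.sum_le_sum fun x hx => ?_
          obtain ⟨p, hp, rfl⟩ := Finset.mem_image.1 hx
          exact (mem_filter.1 hp).2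
      _ ≤ (#(A ×ˢ A) : ℝ) := by exact_mod_cast h1
      _ = n ^ 2 := by rw [card_product]; push_cast; ring
  have hmem : ∀ a ∈ A, ∀ b ∈ A, P a b → a - b ∈ D := fun a ha b hb h =>
    Finset.mem_image.2 ⟨(a, b), mem_filter.2 ⟨mk_mem_product ha hb, h⟩, rfl⟩
  let Q : Finset (G × G × G × G) := D ×ˢ D ×ˢ D ×ˢ D
  let φ : G × G × G × G → G := fun t => t.1 - t.2.1 + t.2.2.1 - t.2.2.2
  have hfib : ∀ z ∈ B - B, γ / 4 * n * (γ ^ 2 / 16 * n) ^ 2 ≤ #{t ∈ Q | φ t = z} := by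
    intro z hz
    obtain ⟨a, ha, a', ha', rfl⟩ := Finset.mem_sub.1 hz
    refine (hpath a ha a' ha').trans ?_
    rw [Nat.cast_le]
    refine card_le_card_of_injOn
      (fun q => (a - q.2.1, q.1 - q.2.1, q.1 - q.2.2, a' - q.2.2)) ?_ ?_
    · rintro ⟨x, y, y'⟩ hq
      obtain ⟨h1, h2, h3, h4, h5⟩ := mem_filter.1 hq
      simp only [mem_product] at h1
      refine mem_filter.2 ⟨?_, ?_⟩
      · simp only [Q, mem_product]
        exact ⟨hmem _ (hBA ha) _ h1.2.1 h2, hmem _ h1.1 _ h1.2.1 h3, hmem _ h1.1 _ h1.2.2 h4,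
          hmem _ (hBA ha') _ h1.2.2 h5⟩
      · simp only [φ]; abel
    · rintro ⟨x, y, y'⟩ - ⟨w, z, z'⟩ - h
      simp only [Prod.mk.injEq, sub_right_inj] at h
      obtain ⟨rfl, h2, -, rfl⟩ := h
      simpa using h2
  have hcount : (#(B - B) : ℝ) * (γ / 4 * n * (γ ^ 2 / 16 * n) ^ 2) ≤ (#D : ℝ) ^ 4 := by
    calc (#(B - B) : ℝ) * (γ / 4 * n * (γ ^ 2 / 16 * n) ^ 2)
        = ∑ z ∈ B - B, γ / 4 * n * (γ ^ 2 / 16 * n) ^ 2 := by simp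
      _ ≤ ∑ z ∈ B - B, (#{t ∈ Q | φ t = z} : ℝ) := Finset.sum_le_sum hfib
      _ ≤ (#Q : ℝ) := by
          have h1 := sum_card_fiberwise_eq_card_filter Q (B - B) φ
          have h2 := Finset.card_le_card (filter_subset (fun t => φ t ∈ B - B) Q)
          exact_mod_cast h1.trans_le h2
      _ = (#D : ℝ) ^ 4 := by simp only [Q, card_product]; push_cast; ring
  have hD' : (#D : ℝ) ≤ n / γ := by
    rw [le_div_iff₀ hγ]
    nlinarith
  have hD4 : (#D : ℝ) ^ 4 ≤ (n / γ) ^ 4 := by gcongr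
  have hpos : 0 < γ / 4 * n * (γ ^ 2 / 16 * n) ^ 2 := by positivity
  refine le_of_mul_le_mul_right (hcount.trans (hD4.trans (le_of_eq ?_))) hpos
  field_simp
  norm_num

end BalogSzemerediGowers

section IteratedSumset

open Finset

theorem card_nsmul_le_pow {G : Type*} [AddCommGroup G] [DecidableEq G] (F : Finset G) (j : ℕ) :
    #(j • F) ≤ (j + 1) ^ #F := by
  have hsub : j • F ⊆ (Fintype.piFinset fun _ : F => Finset.range (j + 1)).image
      fun c => ∑ f : F, c f • (f : G) := by
    induction j with
    | zero =>
      intro x hx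
      rw [zero_nsmul, Finset.mem_zero] at hx
      refine Finset.mem_image.2 ⟨0, Fintype.mem_piFinset.2 fun _ => by simp, by simp [hx]⟩
    | succ j ih =>
      intro x hx
      rw [succ_nsmul] at hx
      obtain ⟨y, hy, f, hf, rfl⟩ := Finset.mem_add.1 hx
      obtain ⟨c, hc, rfl⟩ := Finset.mem_image.1 (ih hy)
      refine Finset.mem_image.2 ⟨c + Pi.single ⟨f, hf⟩ 1, ?_, ?_⟩
      · rw [Fintype.mem_piFinset] at hc ⊢
        intro g
        have h1 := Finset.mem_range.1 (hc g)
        have h2 : (Pi.single (⟨f, hf⟩ : F) 1 : F → ℕ) g ≤ 1 := by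
          rw [Pi.single_apply]; split_ifs <;> simp
        rw [Finset.mem_range, Pi.add_apply]
        omega
      · simp [add_smul, Finset.sum_add_distrib, Pi.single_apply, ite_smul]
  calc #(j • F) ≤ _ := Finset.card_le_card hsub
    _ ≤ _ := card_image_le
    _ = _ := by simp

theorem card_nsmul_sub_le {G : Type*} [AddCommGroup G] [DecidableEq G] (A : Finset G)
    (hA : A.Nonempty) {K : ℝ} (hK : (#(A - A) : ℝ) ≤ K * #A) {L : ℕ} (hL : K ^ 5 ≤ L) {κ : ℕ}
    (hκ : κ ≠ 0) : #(κ • (A - A)) ≤ κ ^ L * #(A - A) := by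
  have hA0 : (0 : ℝ) < #A := by simpa using hA
  have hcover : (#(2 • (A - A) + A) : ℝ) ≤ L * #A := by
    have h1 : 2 • (A - A) + A = 3 • A - 2 • A := by
      rw [succ_nsmul _ 2, two_nsmul, two_nsmul, sub_eq_add_neg, sub_eq_add_neg, neg_add]
      ac_rfl
    have h2 := pluennecke_ruzsa_inequality_nsmul_sub_nsmul_sub hA A 3 2
    have h3 : ((#(3 • A - 2 • A) : ℚ≥0) : ℝ) ≤
        (((#(A - A) / #A : ℚ≥0) ^ (3 + 2) * #A : ℚ≥0) : ℝ) := by exact_mod_cast h2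
    rw [h1]
    push_cast at h3
    refine h3.trans ?_
    gcongr
    refine le_trans ?_ hL
    gcongr
    rwa [div_le_iff₀ hA0]
  obtain ⟨F, -, hF, hsub⟩ := ruzsa_covering_add hA hcover
  have hF' : #F ≤ L := by exact_mod_cast hF
  have hiter : ∀ j : ℕ, (j + 1) • (A - A) ⊆ j • F + (A - A) := by
    intro j
    induction j with
    | zero => simp
    | succ j ih =>
      calc (j + 1 + 1) • (A - A) = (j + 1) • (A - A) + (A - A) := succ_nsmul _ _
        _ ⊆ (j • F + (A - A)) + (A - A) := add_subset_add_right ih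
        _ = j • F + 2 • (A - A) := by rw [add_assoc, two_nsmul]
        _ ⊆ j • F + (F + (A - A)) := add_subset_add_left hsub
        _ = (j + 1) • F + (A - A) := by rw [← add_assoc, succ_nsmul]
  rcases κ with _ | j
  · exact absurd rfl hκ
  · calc #((j + 1) • (A - A)) ≤ #(j • F + (A - A)) := Finset.card_le_card (hiter j)
      _ ≤ #(j • F) * #(A - A) := card_add_le
      _ ≤ (j + 1) ^ #F * #(A - A) := by gcongr; exact card_nsmul_le_pow F j
      _ ≤ _ := by gcongr; omega

end IteratedSumset

section Pivot

open Finset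

/-- Either a set of vectors of size at most `lam * ρ` is covered at scale `ρ` as efficiently as a
subset of a `(k-1)`-dimensional subspace would be, or it contains `k` vectors that are linearly
independent in a quantitative sense. -/
theorem exists_cover_or_independent (ι : Type*) [Fintype ι] (k : ℕ) :
    ∃ c : ℝ, 1 ≤ c ∧ ∀ (lam : ℕ), 1 ≤ lam → ∀ (ρ : ℝ), 0 < ρ → ∀ S : Finset (ι → ℝ),
      (∀ x ∈ S, ‖x‖ ≤ lam * ρ) →
      (∃ Z : Finset (ι → ℝ), (#Z : ℝ) * lam ≤ c * (lam : ℝ) ^ k ∧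
        ∀ x ∈ S, ∃ z ∈ Z, ‖x - z‖ ≤ c * ρ) ∨
      ∃ v : Fin k → ι → ℝ, (∀ l, v l ∈ S) ∧
        ∀ (a : Fin k → ℝ) (l : Fin k), |a l| * ρ ≤ c * ‖∑ i, a i • v i‖ := by
  classical
  induction k with
  | zero => exact ⟨1, le_rfl, fun lam _ ρ _ S _ => Or.inr ⟨Fin.elim0, fun l => l.elim0,
      fun _ l => l.elim0⟩⟩
  | succ k ih =>
    obtain ⟨c, hc, ih⟩ := ih
    refine ⟨3 * c + 1 + k * c, by nlinarith [(Nat.cast_nonneg k : (0 : ℝ) ≤ k)], ?_⟩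
    intro lam hlam ρ hρ S hS
    have hk0 : (0 : ℝ) ≤ k := Nat.cast_nonneg k
    have hkc : 0 ≤ k * c := by positivity
    have hlam' : (1 : ℝ) ≤ lam := by exact_mod_cast hlam
    by_cases hsmall : ∀ x ∈ S, ‖x‖ ≤ ρ
    · refine Or.inl ⟨{0}, ?_, fun x hx => ⟨0, by simp, ?_⟩⟩
      · have : (lam : ℝ) ≤ (lam : ℝ) ^ (k + 1) := le_self_pow₀ hlam' (by omega)
        simp only [Finset.card_singleton, Nat.cast_one, one_mul]
        nlinarith
      · rw [sub_zero]
        have := hsmall x hx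
        nlinarith
    push Not at hsmall
    obtain ⟨x₀, hx₀, hx₀ρ⟩ := hsmall
    obtain ⟨v, hv, hmax⟩ := S.exists_max_image (fun x => ‖x‖) ⟨x₀, hx₀⟩
    have hvρ : ρ < ‖v‖ := hx₀ρ.trans_le (hmax x₀ hx₀)
    have hv0 : 0 < ‖v‖ := hρ.trans hvρ
    obtain ⟨i, hi⟩ : ∃ i, ‖v i‖ = ‖v‖ := by
      by_contra! h
      exact lt_irrefl _ ((pi_norm_lt_iff hv0).2 fun i => lt_of_le_of_ne (norm_le_pi_norm v i) (h i))
    have hvi : v i ≠ 0 := by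
      rw [← norm_pos_iff, hi]; exact hv0
    let T : (ι → ℝ) →ₗ[ℝ] (ι → ℝ) :=
      LinearMap.id - ((v i)⁻¹ • (LinearMap.proj i : (ι → ℝ) →ₗ[ℝ] ℝ)).smulRight v
    have hT : ∀ x, T x = x - (x i / v i) • v := by
      intro x
      simp [T, div_eq_inv_mul]
    have hTv : T v = 0 := by rw [hT, div_self hvi, one_smul, sub_self]
    have hTn : ∀ x, ‖T x‖ ≤ 2 * ‖x‖ := by
      intro x
      rw [hT]
      refine (norm_sub_le _ _).trans ?_
      rw [norm_smul, norm_div, hi, div_mul_cancel₀ _ hv0.ne']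
      linarith [norm_le_pi_norm x i]
    rcases ih lam hlam (2 * ρ) (by positivity) (S.image T) (by
      intro y hy
      obtain ⟨x, hx, rfl⟩ := Finset.mem_image.1 hy
      linarith [hTn x, hS x hx]) with ⟨Z, hZ, hcov⟩ | ⟨w, hw, hind⟩
    · left
      let I : Finset ℤ := Finset.Icc (-(lam : ℤ)) lam
      refine ⟨(Z ×ˢ I).image fun p => p.1 + ((p.2 : ℝ) / lam) • v, ?_, ?_⟩
      · have h1 : (#((Z ×ˢ I).image fun p => p.1 + ((p.2 : ℝ) / lam) • v) : ℝ) ≤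
            #Z * (2 * lam + 1) := by
          have h2 : #((Z ×ˢ I).image fun p => p.1 + ((p.2 : ℝ) / lam) • v) ≤
              #Z * (2 * lam + 1) := by
            refine card_image_le.trans (le_of_eq ?_)
            rw [card_product, Int.card_Icc]
            congr 1
            omega
          exact_mod_cast h2
        calc _ ≤ #Z * (2 * lam + 1) * (lam : ℝ) := by gcongr
          _ = (#Z * lam) * (2 * lam + 1) := by ring
          _ ≤ (c * (lam : ℝ) ^ k) * (3 * lam) := by gcongr; linarith
          _ = 3 * c * (lam : ℝ) ^ (k + 1) := by ring
          _ ≤ _ := by gcongr; linarith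
      · intro x hx
        obtain ⟨z, hz, hxz⟩ := hcov (T x) (Finset.mem_image_of_mem _ hx)
        set t := x i / v i with ht
        have ht1 : |t| ≤ 1 := by
          rw [ht, abs_div, div_le_one (abs_pos.2 hvi)]
          rw [Real.norm_eq_abs] at hi
          rw [hi]
          exact (norm_le_pi_norm x i).trans (hmax x hx)
        obtain ⟨ht2, ht3⟩ := abs_le.1 ht1
        have hlam0 : (0 : ℝ) < lam := by linarith
        refine ⟨z + ((⌊t * lam⌋ : ℝ) / lam) • v, Finset.mem_image.2 ⟨(z, ⌊t * lam⌋), ?_, rfl⟩, ?_⟩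
        · refine mk_mem_product hz (Finset.mem_Icc.2 ⟨Int.le_floor.2 ?_, ?_⟩)
          · push_cast; nlinarith
          · have : (⌊t * lam⌋ : ℝ) ≤ lam := (Int.floor_le _).trans (by nlinarith)
            exact_mod_cast this
        · have h1 : x - (z + ((⌊t * lam⌋ : ℝ) / lam) • v) =
              (T x - z) + (t - (⌊t * lam⌋ : ℝ) / lam) • v := by
            rw [hT, sub_smul]; abel
          have h2 : |t - (⌊t * lam⌋ : ℝ) / lam| ≤ 1 / lam := by
            rw [abs_le]
            have h3 := Int.floor_le (t * lam)
            have h4 := Int.lt_floor_add_one (t * lam)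
            have h5 : t = t * lam / lam := by field_simp
            constructor
            · have : (⌊t * lam⌋ : ℝ) / lam ≤ t * lam / lam := by gcongr
              have : 0 < 1 / (lam : ℝ) := by positivity
              linarith
            · have : t * lam / lam ≤ (⌊t * lam⌋ + 1 : ℝ) / lam := by gcongr
              rw [add_div] at this
              linarith
          rw [h1]
          calc _ ≤ ‖T x - z‖ + ‖(t - (⌊t * lam⌋ : ℝ) / lam) • v‖ := norm_add_le _ _
            _ ≤ c * (2 * ρ) + 1 / lam * (lam * ρ) := by
                rw [norm_smul, Real.norm_eq_abs]
                gcongr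
                exact hS v hv
            _ = (2 * c + 1) * ρ := by field_simp
            _ ≤ _ := mul_le_mul_of_nonneg_right (by linarith) hρ.le
    · right
      choose u hu hTu using fun l => Finset.mem_image.1 (hw l)
      refine ⟨Fin.cons v u, Fin.cases hv hu, ?_⟩
      intro a
      rw [Fin.sum_univ_succ]
      simp only [Fin.cons_zero, Fin.cons_succ]
      set s := a 0 • v + ∑ j : Fin k, a j.succ • u j with hs
      have hTs : T s = ∑ j : Fin k, a j.succ • w j := by
        simp [hs, hTv, hTu]
      have hsucc : ∀ j : Fin k, |a j.succ| * ρ ≤ c * ‖s‖ := by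
        intro j
        have h1 := hind (fun j => a j.succ) j
        rw [← hTs] at h1
        have h2 := hTn s
        have h3 : c * ‖T s‖ ≤ c * (2 * ‖s‖) := by gcongr
        nlinarith
      intro l
      refine Fin.cases ?_ (fun j => ?_) l
      · have h1 : a 0 * v i = s i - ∑ j : Fin k, a j.succ * u j i := by
          simp [hs]
        have h2 : |a 0| * ‖v‖ ≤ ‖s‖ + ∑ j : Fin k, |a j.succ| * ‖v‖ := by
          rw [← hi, Real.norm_eq_abs, ← abs_mul, h1]
          refine (abs_sub _ _).trans (add_le_add (norm_le_pi_norm s i) ?_)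
          refine (Finset.abs_sum_le_sum_abs _ _).trans (Finset.sum_le_sum fun j _ => ?_)
          rw [abs_mul]
          refine mul_le_mul_of_nonneg_left ?_ (abs_nonneg _)
          rw [← Real.norm_eq_abs, ← Real.norm_eq_abs, hi]
          exact (norm_le_pi_norm (u j) i).trans (hmax _ (hu j))
        have h3 : (∑ j : Fin k, |a j.succ| * ‖v‖) * ρ ≤ k * (c * ‖s‖) * ‖v‖ := by
          calc _ = ∑ j : Fin k, (|a j.succ| * ρ) * ‖v‖ := by
                rw [Finset.sum_mul]; exact Finset.sum_congr rfl fun j _ => by ring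
            _ ≤ ∑ j : Fin k, (c * ‖s‖) * ‖v‖ := 
                Finset.sum_le_sum fun j _ => mul_le_mul_of_nonneg_right (hsucc j) hv0.le
            _ = _ := by simp; ring
        have h4 : |a 0| * ρ * ‖v‖ ≤ ((1 + k * c) * ‖s‖) * ‖v‖ := by
          have h5 : ‖s‖ * ρ ≤ ‖s‖ * ‖v‖ := by gcongr
          nlinarith
        refine (le_of_mul_le_mul_right h4 hv0).trans ?_
        gcongr
        linarith
      · refine (hsucc j).trans ?_
        gcongr
        linarith

end Pivot

section Discrete

open Finset

theorem eq_zero_of_multiscale_sum_eq_zero {V : Type*} [NormedAddCommGroup V] [NormedSpace ℝ V]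
    {k : ℕ} {c q lam Λ : ℝ} (hc : 0 ≤ c) (hq : 0 ≤ q) (hlam : 0 ≤ lam) (hΛ : 2 ≤ Λ)
    (hsep : 2 * c * k * q * lam < Λ) (v : ℕ → Fin k → V) (m : ℕ)
    (hv : ∀ j < m, ∀ l, ‖v j l‖ ≤ lam * Λ ^ j)
    (hind : ∀ j < m, ∀ (a : Fin k → ℝ) (l : Fin k), |a l| * Λ ^ j ≤ c * ‖∑ i, a i • v j i‖)
    (b : ℕ → Fin k → ℤ) (hb : ∀ j < m, ∀ l, |(b j l : ℝ)| ≤ q)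
    (hsum : ∑ j ∈ Finset.range m, ∑ l, (b j l : ℝ) • v j l = 0) :
    ∀ j < m, ∀ l, b j l = 0 := by
  induction m with
  | zero => simp
  | succ m ih =>
    have hΛ0 : 0 < Λ := by linarith
    rw [Finset.sum_range_succ] at hsum
    have hgeom : ∀ n : ℕ, (∑ j ∈ Finset.range n, Λ ^ j) * Λ ≤ 2 * Λ ^ n := by
      intro n
      induction n with
      | zero => simp
      | succ n ihn =>
        rw [Finset.sum_range_succ, add_mul, pow_succ]
        have : 0 < Λ ^ n := by positivity
        nlinarith
    have hlow : ‖∑ j ∈ Finset.range m, ∑ l, (b j l : ℝ) • v j l‖ ≤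
        (k * q * lam) * ∑ j ∈ Finset.range m, Λ ^ j := by
      rw [Finset.mul_sum]
      refine norm_sum_le_of_le _ fun j hj => ?_
      have hj' : j < m + 1 := (Finset.mem_range.1 hj).trans (Nat.lt_succ_self m)
      calc ‖∑ l, (b j l : ℝ) • v j l‖ ≤ ∑ l : Fin k, q * (lam * Λ ^ j) := by
            refine norm_sum_le_of_le _ fun l _ => ?_
            rw [norm_smul, Real.norm_eq_abs]
            exact mul_le_mul (hb j hj' l) (hv j hj' l) (norm_nonneg _) hq
        _ = k * q * lam * Λ ^ j := by simp; ring
    have htop : ∀ l, b m l = 0 := by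
      intro l
      have h1 := hind m (Nat.lt_succ_self m) (fun i => (b m i : ℝ)) l
      rw [← neg_eq_of_add_eq_zero_right hsum, norm_neg] at h1
      have h2 : |(b m l : ℝ)| * Λ ^ m * Λ ≤ (2 * c * k * q * lam) * Λ ^ m := by
        calc |(b m l : ℝ)| * Λ ^ m * Λ
            ≤ c * ((k * q * lam) * ∑ j ∈ Finset.range m, Λ ^ j) * Λ := by
              exact mul_le_mul_of_nonneg_right (h1.trans (mul_le_mul_of_nonneg_left hlow hc)) hΛ0.le
          _ = c * k * q * lam * ((∑ j ∈ Finset.range m, Λ ^ j) * Λ) := by ring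
          _ ≤ c * k * q * lam * (2 * Λ ^ m) :=
              mul_le_mul_of_nonneg_left (hgeom m) (by positivity)
          _ = _ := by ring
      have hpos : 0 < Λ ^ m := by positivity
      have h3 : |(b m l : ℝ)| * (Λ ^ m * Λ) < 1 * (Λ ^ m * Λ) := by nlinarith
      have h4 : |(b m l : ℝ)| < 1 := lt_of_mul_lt_mul_right h3 (by positivity)
      have h5 : |b m l| < 1 := by exact_mod_cast h4
      exact Int.abs_lt_one_iff.1 h5
    intro j hj l
    rcases Nat.lt_succ_iff_lt_or_eq.1 hj with h | rfl
    · refine ih (fun j hj => hv j (hj.trans (Nat.lt_succ_self m)))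
        (fun j hj => hind j (hj.trans (Nat.lt_succ_self m)))
        (fun j hj => hb j (hj.trans (Nat.lt_succ_self m))) ?_ j h l
      simpa [htop] using hsum
    · exact htop l

theorem sum_nsmul_mem_nsmul {G X : Type*} [AddCommGroup G] [DecidableEq G] {H : Finset G}
    (h0 : 0 ∈ H) (s : Finset X) (u : X → G) (hu : ∀ x ∈ s, u x ∈ H) {q : ℕ} (a : X → ℕ)
    (ha : ∀ x ∈ s, a x ≤ q) : ∑ x ∈ s, a x • u x ∈ (#s * q) • H := by
  classical
  induction s using Finset.induction_on with
  | empty => simp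
  | insert x s hx ih =>
    rw [Finset.sum_insert hx, Finset.card_insert_of_notMem hx, add_comm (#s), add_mul, one_mul,
      add_nsmul]
    refine Finset.add_mem_add ?_ (ih (fun y hy => hu y (mem_insert_of_mem hy))
      fun y hy => ha y (mem_insert_of_mem hy))
    exact Finset.nsmul_subset_nsmul_right h0 (ha x (mem_insert_self _ _))
      (Finset.nsmul_mem_nsmul (hu x (mem_insert_self _ _)))

/-- Iterated sumsets of a set of integer vectors which has `k` quantitatively independent directions
at each of `m` scales are at least `k`-dimensional. -/
theorem pow_le_card_nsmul {ι : Type*} [Fintype ι] {k : ℕ} {c lam Λ : ℝ} {q : ℕ}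
    (hc : 0 ≤ c) (hlam : 0 ≤ lam) (hΛ : 2 ≤ Λ) (hsep : 2 * c * k * q * lam < Λ)
    {H : Finset (ι → ℤ)} (h0 : 0 ∈ H) (m : ℕ) (u : ℕ → Fin k → ι → ℤ)
    (huH : ∀ j < m, ∀ l, u j l ∈ H)
    (hu : ∀ j < m, ∀ l, ‖(fun t => (u j l t : ℝ))‖ ≤ lam * Λ ^ j)
    (hind : ∀ j < m, ∀ (a : Fin k → ℝ) (l : Fin k),
      |a l| * Λ ^ j ≤ c * ‖∑ i, a i • (fun t => (u j i t : ℝ))‖) :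
    q ^ (m * k) ≤ #((m * k * q) • H) := by
  let s : Finset (Fin m × Fin k → ℕ) := Fintype.piFinset fun _ => Finset.range q
  have hs : #s = q ^ (m * k) := by simp [s, Fintype.card_piFinset]
  rw [← hs]
  refine Finset.card_le_card_of_injOn (fun a => ∑ x : Fin m × Fin k, a x • u x.1 x.2) ?_ ?_
  · intro a ha
    have ha' := Fintype.mem_piFinset.1 ha
    have h1 := sum_nsmul_mem_nsmul h0 Finset.univ (fun x : Fin m × Fin k => u x.1 x.2)
      (fun x _ => huH _ x.1.2 _) (q := q) a (fun x _ => (Finset.mem_range.1 (ha' x)).le)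
    rw [Finset.card_univ, Fintype.card_prod, Fintype.card_fin, Fintype.card_fin] at h1
    exact Finset.mem_coe.2 h1
  · intro a ha a' ha' haa
    have hra := Fintype.mem_piFinset.1 ha
    have hra' := Fintype.mem_piFinset.1 ha'
    let b : ℕ → Fin k → ℤ := fun j l =>
      if h : j < m then (a (⟨j, h⟩, l) : ℤ) - a' (⟨j, h⟩, l) else 0
    have hz := eq_zero_of_multiscale_sum_eq_zero hc (Nat.cast_nonneg q) hlam hΛ hsep
      (fun j l t => (u j l t : ℝ)) m hu hind b ?_ ?_
    · ext x
      have := hz x.1 x.1.2 x.2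
      simp only [b, x.1.2, dif_pos] at this
      have h2 : (a x : ℤ) - a' x = 0 := this
      omega
    · intro j hj l
      simp only [b, hj, dif_pos]
      have h1 := Finset.mem_range.1 (hra (⟨j, hj⟩, l))
      have h2 := Finset.mem_range.1 (hra' (⟨j, hj⟩, l))
      have h3 : |(a (⟨j, hj⟩, l) : ℤ) - a' (⟨j, hj⟩, l)| ≤ q := by
        rw [abs_le]; omega
      exact_mod_cast h3
    · rw [Finset.sum_range]
      ext t
      have h1 := congrFun haa t
      simp only [Fintype.sum_prod_type, Finset.sum_apply, nsmul_eq_mul] at h1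
      have h2 : ∑ j : Fin m, ∑ l : Fin k, ((a (j, l) : ℤ) - a' (j, l)) * u j l t = 0 := by
        simp only [sub_mul, Finset.sum_sub_distrib]
        rw [sub_eq_zero]
        exact h1
      simp only [Finset.sum_apply, Pi.smul_apply, smul_eq_mul, Pi.zero_apply]
      have h3 : ∀ (j : Fin m) (l : Fin k), b j l = (a (j, l) : ℤ) - a' (j, l) := by
        intro j l
        simp [b, j.2]
      simp only [h3]
      exact_mod_cast h2

end Discrete

section Coarsening

open Finset

variable {ι : Type*}

/-- The index of the cell of side length `n` that contains the integer point `x`. -/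
def coarsen (n : ℕ) (x : ι → ℤ) : ι → ℤ := fun i => x i / n

theorem coarsen_one (x : ι → ℤ) : coarsen 1 x = x := by
  ext i; simp [coarsen]

theorem coarsen_coarsen (m n : ℕ) (x : ι → ℤ) : coarsen n (coarsen m x) = coarsen (m * n) x := by
  ext i
  simp [coarsen, Int.ediv_ediv_of_nonneg]

variable [Fintype ι]

theorem norm_intCast_sub_le_of_coarsen_eq {n : ℕ} (hn : 0 < n) {x y : ι → ℤ}
    (h : coarsen n x = coarsen n y) : ‖(fun t => ((x - y) t : ℝ))‖ ≤ n := by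
  refine (pi_norm_le_iff_of_nonneg (Nat.cast_nonneg n)).2 fun i => ?_
  have hn' : (0 : ℤ) < n := by exact_mod_cast hn
  have h1 := congrFun h i
  simp only [coarsen] at h1
  have hx1 := Int.ediv_mul_le (x i) hn'.ne'
  have hx2 := Int.lt_ediv_add_one_mul_self (x i) hn'
  have hy1 := Int.ediv_mul_le (y i) hn'.ne'
  have hy2 := Int.lt_ediv_add_one_mul_self (y i) hn'
  rw [h1] at hx1 hx2
  have : |x i - y i| ≤ n := by rw [abs_le]; constructor <;> linarith
  rw [Real.norm_eq_abs, Pi.sub_apply]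
  exact_mod_cast this

theorem card_image_coarsen_le {n : ℕ} (hn : 0 < n) (S : Finset (ι → ℤ)) (z : ι → ℝ)
    (c : ℕ) (hS : ∀ x ∈ S, ‖(fun t => (x t : ℝ)) - z‖ ≤ c * n) :
    #(S.image (coarsen n)) ≤ (2 * c + 1) ^ Fintype.card ι := by
  classical
  have hn' : (0 : ℤ) < n := by exact_mod_cast hn
  have hnr : (0 : ℝ) < n := by exact_mod_cast hn
  let B : ι → Finset ℤ := fun i => Finset.Icc ⌊z i / n - c⌋ (⌊z i / n - c⌋ + 2 * c)
  have hB : #(Fintype.piFinset B) = (2 * c + 1) ^ Fintype.card ι := by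
    rw [Fintype.card_piFinset]
    have : ∀ i, #(B i) = 2 * c + 1 := by
      intro i
      simp only [B, Int.card_Icc]
      omega
    simp [this]
  rw [← hB]
  refine Finset.card_le_card fun y hy => ?_
  obtain ⟨x, hx, rfl⟩ := Finset.mem_image.1 hy
  rw [Fintype.mem_piFinset]
  intro i
  have h1 := (norm_le_pi_norm ((fun t => (x t : ℝ)) - z) i).trans (hS x hx)
  rw [Real.norm_eq_abs, Pi.sub_apply, abs_le] at h1
  have hz : z i / n * n = z i := div_mul_cancel₀ _ hnr.ne'
  rw [Finset.mem_Icc]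
  constructor
  · rw [coarsen, Int.le_ediv_iff_mul_le hn']
    have h2 := Int.floor_le (z i / n - c)
    have h3 : (⌊z i / n - c⌋ : ℝ) * n ≤ x i := by nlinarith
    exact_mod_cast h3
  · have h4 : ⌊z i / n - c⌋ + 2 * c = ⌊z i / n + c⌋ := by
      have : z i / n + c = z i / n - c + ((2 * c : ℤ) : ℝ) := by push_cast; ring
      rw [this, Int.floor_add_intCast]
    rw [h4, Int.le_floor]
    have h5 := Int.ediv_mul_le (x i) hn'.ne'
    have h6 : ((x i / (n : ℤ) : ℤ) : ℝ) * n ≤ x i := by exact_mod_cast h5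
    simp only [coarsen]
    refine le_of_mul_le_mul_right ?_ hnr
    nlinarith

/-- `F` branches like a `log D / log lam`-dimensional regular set through `m` scales. -/
structure IsTreeRegular (F : Finset (ι → ℤ)) (lam m : ℕ) (D M : ℝ) : Prop where
  card_fibre_le : ∀ i j, i + j ≤ m → ∀ c,
    (#{b ∈ F.image (coarsen (lam ^ i)) | coarsen (lam ^ j) b = c} : ℝ) ≤ M * D ^ j
  exists_coarsen_eq : ∃ c, ∀ x ∈ F, coarsen (lam ^ m) x = c

theorem IsTreeRegular.card_image_le {F : Finset (ι → ℤ)} {lam m : ℕ} {D M : ℝ}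
    (hF : IsTreeRegular F lam m D M) {i j : ℕ} (hij : i + j = m) :
    (#(F.image (coarsen (lam ^ i))) : ℝ) ≤ M * D ^ j := by
  obtain ⟨c, hc⟩ := hF.exists_coarsen_eq
  have h := hF.card_fibre_le i j hij.le c
  rwa [Finset.filter_true_of_mem] at h
  intro b hb
  obtain ⟨x, hx, rfl⟩ := Finset.mem_image.1 hb
  rw [coarsen_coarsen, ← pow_add, hij]
  exact hc x hx

theorem IsTreeRegular.card_le {F : Finset (ι → ℤ)} {lam m : ℕ} {D M : ℝ}
    (hF : IsTreeRegular F lam m D M) : (#F : ℝ) ≤ M * D ^ m := by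
  have h := hF.card_image_le (zero_add m)
  rwa [pow_zero, funext coarsen_one, Finset.image_id'] at h

theorem IsTreeRegular.card_le_card_image {F : Finset (ι → ℤ)} {lam m : ℕ} {D M : ℝ}
    (hF : IsTreeRegular F lam m D M) {A : Finset (ι → ℤ)} (hA : A ⊆ F) {i : ℕ} (hi : i ≤ m) :
    (#A : ℝ) ≤ M * D ^ i * #(A.image (coarsen (lam ^ i))) := by
  rw [Finset.card_eq_sum_card_image (coarsen (lam ^ i)) A, Nat.cast_sum, mul_comm, ← nsmul_eq_mul]
  refine Finset.sum_le_card_nsmul _ _ _ fun b _ => ?_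
  refine le_trans ?_ (hF.card_fibre_le 0 i (by omega) b)
  rw [pow_zero, funext coarsen_one, Finset.image_id']
  exact_mod_cast Finset.card_le_card (Finset.filter_subset_filter _ hA)

/-- A dense subset of a tree-regular set has quantitatively independent differences at every
scale. -/
theorem exists_independent_differences (ι : Type*) [Fintype ι] (k : ℕ) :
    ∃ c : ℕ, 1 ≤ c ∧ ∀ (F A : Finset (ι → ℤ)) (lam m i : ℕ) (D M M₁ : ℝ), 1 ≤ lam → 0 < D →
      0 ≤ M → 0 ≤ M₁ → i + 1 ≤ m → IsTreeRegular F lam m D M → A ⊆ F → D ^ m ≤ M₁ * #A →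
      c * M ^ 2 * M₁ * (lam : ℝ) ^ k < D * lam →
      ∃ u : Fin k → ι → ℤ, (∀ l, u l ∈ A - A) ∧
        (∀ l, ‖(fun t => (u l t : ℝ))‖ ≤ lam * (lam : ℝ) ^ i) ∧
        ∀ (a : Fin k → ℝ) (l : Fin k),
          |a l| * (lam : ℝ) ^ i ≤ c * ‖∑ i, a i • (fun t => (u i t : ℝ))‖ := by
  obtain ⟨c, hc, H⟩ := exists_cover_or_independent ι k
  set c' : ℕ := ⌈c⌉₊ with hc'
  have hcc : c ≤ c' := Nat.le_ceil c
  have hc1 : 1 ≤ c' := by exact_mod_cast hc.trans hcc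
  refine ⟨c' * (2 * c' + 1) ^ Fintype.card ι,
    Nat.mul_pos hc1 (pow_pos (by omega) _), ?_⟩
  intro F A lam m i D M M₁ hlam hD hM hM₁ him hF hAF hA hbig
  have hlam0 : (0 : ℝ) < lam := by exact_mod_cast hlam
  have hρ : (0 : ℝ) < (lam : ℝ) ^ i := by positivity
  have hA0 : A.Nonempty := by
    rw [Finset.nonempty_iff_ne_empty]
    rintro rfl
    have : 0 < D ^ m := by positivity
    simp at hA
    linarith
  obtain ⟨e, he, hemax⟩ := (A.image (coarsen (lam ^ (i + 1)))).exists_max_image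
    (fun e => #{x ∈ A | coarsen (lam ^ (i + 1)) x = e}) (hA0.image _)
  set Ae := {x ∈ A | coarsen (lam ^ (i + 1)) x = e} with hAe
  obtain ⟨x₀, hx₀, hx₀e⟩ := Finset.mem_image.1 he
  have hcardA : (#A : ℝ) ≤ #Ae * (M * D ^ (m - (i + 1))) := by
    have h1 := Finset.card_le_mul_card_image (s := A) (f := coarsen (lam ^ (i + 1))) _ hemax
    have h2 := hF.card_image_le (i := i + 1) (j := m - (i + 1)) (by omega)
    have h3 : (#(A.image (coarsen (lam ^ (i + 1)))) : ℝ) ≤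
        #(F.image (coarsen (lam ^ (i + 1)))) := by
      exact_mod_cast Finset.card_le_card (Finset.image_subset_image hAF)
    calc (#A : ℝ) ≤ #Ae * #(A.image (coarsen (lam ^ (i + 1)))) := by exact_mod_cast h1
      _ ≤ _ := by gcongr; exact h3.trans h2
  have hcardAe := hF.card_le_card_image (A := Ae) ((Finset.filter_subset _ _).trans hAF)
    (i := i) (by omega)
  set I := Ae.image (coarsen (lam ^ i)) with hI
  have hDI : D ≤ M ^ 2 * M₁ * #I := by
    have hpow : D ^ m = D * (D ^ (m - (i + 1)) * D ^ i) := by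
      rw [← pow_add, ← pow_succ']; congr 1; omega
    have h1 : D * (D ^ (m - (i + 1)) * D ^ i) ≤
        (M ^ 2 * M₁ * #I) * (D ^ (m - (i + 1)) * D ^ i) := by
      rw [← hpow]
      calc D ^ m ≤ M₁ * #A := hA
        _ ≤ M₁ * ((M * D ^ i * #I) * (M * D ^ (m - (i + 1)))) := by
            gcongr
            exact hcardA.trans (mul_le_mul_of_nonneg_right hcardAe (by positivity))
        _ = _ := by ring
    exact le_of_mul_le_mul_right h1 (by positivity)
  let φ : (ι → ℤ) → ι → ℝ := fun x t => ((x - x₀) t : ℝ)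
  have hφ : ∀ y ∈ Ae.image φ, ‖y‖ ≤ lam * (lam : ℝ) ^ i := by
    intro y hy
    obtain ⟨x, hx, rfl⟩ := Finset.mem_image.1 hy
    rw [← pow_succ']
    have := norm_intCast_sub_le_of_coarsen_eq (pow_pos hlam (i + 1))
        ((Finset.mem_filter.1 hx).2.trans hx₀e.symm)
    exact_mod_cast this
  rcases H lam hlam _ hρ (Ae.image φ) hφ with ⟨Z, hZ, hcov⟩ | ⟨v, hv, hind⟩
  · exfalso
    have hcardI : #I ≤ #Z * (2 * c' + 1) ^ Fintype.card ι := by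
      have hsub : I ⊆ Z.biUnion fun z =>
          ({x ∈ Ae | ‖φ x - z‖ ≤ c * (lam : ℝ) ^ i}).image (coarsen (lam ^ i)) := by
        intro b hb
        obtain ⟨x, hx, rfl⟩ := Finset.mem_image.1 hb
        obtain ⟨z, hz, hxz⟩ := hcov (φ x) (Finset.mem_image_of_mem _ hx)
        exact Finset.mem_biUnion.2 ⟨z, hz, Finset.mem_image_of_mem _
          (Finset.mem_filter.2 ⟨hx, hxz⟩)⟩
      refine (Finset.card_le_card hsub).trans (Finset.card_biUnion_le_card_mul _ _ _ fun z _ => ?_)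
      refine card_image_coarsen_le (pow_pos hlam i) _ (z + fun t => (x₀ t : ℝ)) c' ?_
      intro x hx
      have h1 := (Finset.mem_filter.1 hx).2
      have h2 : (fun t => (x t : ℝ)) - (z + fun t => (x₀ t : ℝ)) = φ x - z := by
        ext t
        simp [φ]
        ring
      rw [h2]
      push_cast
      exact h1.trans (by gcongr)
    have hcardI' : (#I : ℝ) ≤ #Z * (2 * c' + 1) ^ Fintype.card ι := by exact_mod_cast hcardI
    refine absurd hbig (not_lt.2 ?_)
    push_cast
    calc D * lam ≤ (M ^ 2 * M₁ * (#Z * (2 * c' + 1) ^ Fintype.card ι)) * lam := by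
          gcongr
          exact hDI.trans (by gcongr)
      _ = M ^ 2 * M₁ * (2 * c' + 1) ^ Fintype.card ι * (#Z * lam) := by ring
      _ ≤ M ^ 2 * M₁ * (2 * c' + 1) ^ Fintype.card ι * (c' * (lam : ℝ) ^ k) := by
          refine mul_le_mul_of_nonneg_left (hZ.trans ?_) (by positivity)
          gcongr
      _ = _ := by ring
  · have hv' : ∀ l, ∃ x ∈ Ae, φ x = v l := fun l => Finset.mem_image.1 (hv l)
    choose x hx hxv using hv'
    refine ⟨fun l => x l - x₀, fun l => Finset.sub_mem_sub (Finset.mem_filter.1 (hx l)).1 hx₀,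
      fun l => ?_, fun a l => ?_⟩
    · rw [← pow_succ']
      have := norm_intCast_sub_le_of_coarsen_eq (pow_pos hlam (i + 1))
        ((Finset.mem_filter.1 (hx l)).2.trans hx₀e.symm)
      exact_mod_cast this
    · have h1 : ∀ l, (fun t => ((x l - x₀) t : ℝ)) = v l := hxv
      simp only [h1]
      refine (hind a l).trans ?_
      gcongr
      push_cast
      refine hcc.trans (le_mul_of_one_le_right (by positivity) (one_le_pow₀ ?_))
      have : (0 : ℝ) ≤ c' := by positivity
      linarith

end Coarsening

section EnergyIncrement

open Finset

theorem quadCount_le_card_pow {G : Type*} [AddCommGroup G] (A : Finset G) :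
    quadCount A A A A 0 ≤ #A ^ 3 := by
  classical
  rw [quadCount_self_eq_sum]
  calc _ ≤ ∑ p ∈ A ×ˢ A, #A := by
        refine Finset.sum_le_sum fun p _ => ?_
        refine Finset.card_le_card_of_injOn Prod.fst
          (fun q hq => (Finset.mem_product.1 (Finset.mem_filter.1 hq).1).1) ?_
        intro q hq q' hq' h
        have h1 := (Finset.mem_filter.1 hq).2
        have h2 := (Finset.mem_filter.1 hq').2
        refine Prod.ext h ?_
        rw [← h2, show q.1 = q'.1 from h] at h1
        simpa using h1
    _ = _ := by rw [Finset.sum_const, Finset.card_product, smul_eq_mul]; ring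

theorem exists_subset_small_doubling {G : Type*} [AddCommGroup G] [DecidableEq G] (F : Finset G)
    {M T : ℝ} (hM : 2 ≤ M) (hT : 0 < T) (hF : (#F : ℝ) ≤ M * T)
    (hE : T ^ 3 < M * quadCount F F F F 0) :
    ∃ A ⊆ F, T ≤ M ^ 8 * #A ∧ (#(A - A) : ℝ) ≤ M ^ 56 * T ∧ (#(A - A) : ℝ) ≤ M ^ 62 * #A := by
  have hM0 : 0 < M := by linarith
  have hE3 : (quadCount F F F F 0 : ℝ) ≤ (#F : ℝ) ^ 3 := by exact_mod_cast quadCount_le_card_pow F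
  have hTF : T ≤ M * #F := by
    refine le_of_pow_le_pow_left₀ (n := 3) (by norm_num) (by positivity) ?_
    calc T ^ 3 ≤ M * (#F : ℝ) ^ 3 := hE.le.trans (by gcongr)
      _ ≤ M ^ 3 * (#F : ℝ) ^ 3 := by
          gcongr
          exact le_self_pow₀ (by linarith) (by norm_num)
      _ = _ := by ring
  have hF0 : F.Nonempty := by
    rw [Finset.nonempty_iff_ne_empty]
    rintro rfl
    simp at hTF
    linarith
  have hpow : ∀ n : ℕ, (2 : ℝ) ^ n ≤ M ^ n := fun n => by gcongr
  obtain ⟨A, hAF, h1, h2⟩ := exists_subset_card_sub_le F (γ := 1 / (2 * M ^ 4)) (by positivity) hF0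
    (by
      calc 2 * (1 / (2 * M ^ 4)) * (#F : ℝ) ^ 3 ≤ 2 * (1 / (2 * M ^ 4)) * (M * T) ^ 3 := by gcongr
        _ = T ^ 3 / M := by field_simp
        _ ≤ _ := by rw [div_le_iff₀ hM0]; linarith)
  have h1' : (#F : ℝ) ≤ M ^ 7 * #A := by
    have : (#F : ℝ) ≤ 2 ^ 3 * M ^ 4 * #A := by
      have h3 : 1 / (2 * M ^ 4) / 4 * (#F : ℝ) = #F / (8 * M ^ 4) := by field_simp; norm_num
      rw [h3, div_le_iff₀ (by positivity)] at h1
      linarith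
    refine this.trans ?_
    calc (2 : ℝ) ^ 3 * M ^ 4 * #A ≤ M ^ 3 * M ^ 4 * #A := by gcongr
      _ = _ := by ring
  have h2' : (#(A - A) : ℝ) ≤ M ^ 55 * #F := by
    calc (#(A - A) : ℝ) ≤ 1024 / (1 / (2 * M ^ 4)) ^ 9 * #F := by convert h2
      _ = 2 ^ 19 * M ^ 36 * #F := by field_simp; norm_num
      _ ≤ M ^ 19 * M ^ 36 * #F := by gcongr
      _ = _ := by ring
  refine ⟨A, hAF, ?_, ?_, ?_⟩
  · calc T ≤ M * (M ^ 7 * #A) := hTF.trans (by gcongr)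
      _ = _ := by ring
  · calc _ ≤ M ^ 55 * (M * T) := h2'.trans (by gcongr)
      _ = _ := by ring
  · calc _ ≤ M ^ 55 * (M ^ 7 * #A) := h2'.trans (by gcongr)
      _ = _ := by ring

/-- A tree-regular set with large additive energy satisfies a multi-scale growth bound. -/
theorem exists_pow_le_of_large_energy (ι : Type*) [Fintype ι] (k : ℕ) (hk : 1 ≤ k) :
    ∃ c : ℕ, 1 ≤ c ∧ ∀ (F : Finset (ι → ℤ)) (lam p m M : ℕ) (D : ℝ), 2 ≤ lam → 1 ≤ m → 2 ≤ M →
      0 < D → IsTreeRegular F lam ((p + 2) * m) D M → c * (M : ℝ) ^ 10 * (lam : ℝ) ^ k < D * lam →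
      2 * c * k < lam → (D ^ ((p + 2) * m)) ^ 3 < M * quadCount F F F F 0 →
      ((lam : ℝ) ^ p) ^ (m * k) ≤
        ((m * k * lam ^ p : ℕ) : ℝ) ^ (M ^ 310) * (M ^ 56 * D ^ ((p + 2) * m)) := by
  obtain ⟨c, hc, H⟩ := exists_independent_differences ι k
  refine ⟨c, hc, fun F lam p m M D hlam hm hM hD hF hbig hsep hE => ?_⟩
  have hM2 : (2 : ℝ) ≤ M := by exact_mod_cast hM
  have hlam2 : (2 : ℝ) ≤ lam := by exact_mod_cast hlam
  set T := D ^ ((p + 2) * m) with hT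
  have hT0 : 0 < T := by positivity
  obtain ⟨A, hAF, hA1, hA2, hA3⟩ := exists_subset_small_doubling F hM2 hT0 hF.card_le hE
  have hA0 : A.Nonempty := by
    rw [Finset.nonempty_iff_ne_empty]
    rintro rfl
    simp at hA1
    linarith
  have hu : ∀ j : ℕ, j < m → ∃ u : Fin k → ι → ℤ, (∀ l, u l ∈ A - A) ∧
        (∀ l, ‖(fun t => (u l t : ℝ))‖ ≤ lam * ((lam : ℝ) ^ (p + 2)) ^ j) ∧
        ∀ (a : Fin k → ℝ) (l : Fin k),
          |a l| * ((lam : ℝ) ^ (p + 2)) ^ j ≤ c * ‖∑ i, a i • (fun t => (u i t : ℝ))‖ := by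
    intro j hj
    simp only [← pow_mul]
    refine H F A lam ((p + 2) * m) ((p + 2) * j) D M (M ^ 8) (by omega) hD (by positivity)
      (by positivity) (by nlinarith) hF hAF hA1 ?_
    calc (c : ℝ) * M ^ 2 * M ^ 8 * lam ^ k = c * M ^ 10 * lam ^ k := by ring
      _ < _ := hbig
  have hu' : ∀ j : ℕ, ∃ u : Fin k → ι → ℤ, j < m → (∀ l, u l ∈ A - A) ∧
        (∀ l, ‖(fun t => (u l t : ℝ))‖ ≤ lam * ((lam : ℝ) ^ (p + 2)) ^ j) ∧
        ∀ (a : Fin k → ℝ) (l : Fin k),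
          |a l| * ((lam : ℝ) ^ (p + 2)) ^ j ≤ c * ‖∑ i, a i • (fun t => (u i t : ℝ))‖ := by
    intro j
    by_cases hj : j < m
    · obtain ⟨u, h⟩ := hu j hj
      exact ⟨u, fun _ => h⟩
    · exact ⟨0, fun h => absurd h hj⟩
  choose u hu using hu'
  have hsep' : (2 * c * k : ℝ) < lam := by exact_mod_cast hsep
  have hgrow := pow_le_card_nsmul (c := c) (lam := lam) (Λ := (lam : ℝ) ^ (p + 2)) (q := lam ^ p)
    (by positivity) (by positivity)
    (hlam2.trans (le_self_pow₀ (by linarith) (by omega)))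
    (by
      calc (2 * c * k * (lam ^ p : ℕ) * lam : ℝ) = (2 * c * k) * ((lam : ℝ) ^ p * lam) := by
            push_cast; ring
        _ < lam * ((lam : ℝ) ^ p * lam) := by gcongr
        _ = _ := by ring)
    (H := A - A) (by
      obtain ⟨x, hx⟩ := hA0
      exact Finset.mem_sub.2 ⟨x, hx, x, hx, sub_self x⟩) m u
    (fun j hj => (hu j hj).1) (fun j hj => (hu j hj).2.1) (fun j hj => (hu j hj).2.2)
  have hplun := card_nsmul_sub_le A hA0 hA3 (L := M ^ 310) (by push_cast; rw [← pow_mul])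
    (κ := m * k * lam ^ p) (by positivity)
  calc ((lam : ℝ) ^ p) ^ (m * k) = (((lam ^ p) ^ (m * k) : ℕ) : ℝ) := by push_cast; ring
    _ ≤ (((m * k * lam ^ p) ^ (M ^ 310) * #(A - A) : ℕ) : ℝ) := by
        exact_mod_cast hgrow.trans hplun
    _ = ((m * k * lam ^ p : ℕ) : ℝ) ^ (M ^ 310) * #(A - A) := by push_cast; ring
    _ ≤ _ := by gcongr

end EnergyIncrement

section DiscreteEnergyBound

set_option exponentiation.threshold 400 in
/-- Tree-regular sets of dimension strictly between `k - 1` and `k` have small additive energy,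
at a scale depending polynomially on the regularity constant. -/
theorem exists_quadCount_le (ι : Type*) [Fintype ι] (k : ℕ) (hk : 1 ≤ k) {δ : ℝ}
    (hδ : (k : ℝ) - 1 < δ) (hδk : δ < k) :
    ∃ K M₀ : ℕ, ∀ M : ℕ, M₀ ≤ M → ∃ lam m : ℕ, 2 ≤ lam ∧ 1 ≤ m ∧
      m * Real.log lam ≤ (M : ℝ) ^ K ∧
      ∀ F : Finset (ι → ℤ), IsTreeRegular F lam m ((lam : ℝ) ^ δ) M →
        M * (quadCount F F F F 0 : ℝ) ≤ (((lam : ℝ) ^ δ) ^ m) ^ 3 := by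
  obtain ⟨c, hc, H⟩ := exists_pow_le_of_large_energy ι k hk
  set θ : ℝ := δ + 1 - k with hθ
  have hθ0 : 0 < θ := by rw [hθ]; linarith
  obtain ⟨s, hs⟩ := exists_nat_ge (11 / θ)
  have hs' : 11 ≤ s * θ := (div_le_iff₀ hθ0).1 hs
  have hs1 : 1 ≤ s := by
    rcases Nat.eq_zero_or_pos s with rfl | h
    · norm_num at hs'
    · exact h
  obtain ⟨p, hp⟩ := exists_nat_ge ((2 * δ + 1) / (k - δ))
  have hp' : δ * (p + 2) + 1 ≤ p * k := by
    rw [div_le_iff₀ (by linarith)] at hp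
    linarith
  refine ⟨314, 370 + s * p + (p + 2) * s + 2 * c * k + c + k, fun M hM => ?_⟩
  have hM1 : 370 + s * p ≤ M := by nlinarith [Nat.zero_le ((p + 2) * s), Nat.zero_le (2 * c * k)]
  have hM2 : (p + 2) * s ≤ M := by nlinarith [Nat.zero_le (s * p), Nat.zero_le (2 * c * k)]
  have hM3 : 2 * c * k < M := by nlinarith [Nat.zero_le (s * p), Nat.zero_le ((p + 2) * s)]
  have hM4 : c < M := by nlinarith [Nat.zero_le (s * p), Nat.zero_le ((p + 2) * s)]
  have hM5 : k ≤ M := by nlinarith [Nat.zero_le (s * p), Nat.zero_le ((p + 2) * s)]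
  have hM6 : 2 ≤ M := by omega
  have hMlam : M ≤ M ^ s := Nat.le_self_pow (by omega) M
  have hMr : (2 : ℝ) ≤ M := by exact_mod_cast hM6
  set lam := M ^ s with hlam
  have hlamr : (lam : ℝ) = (M : ℝ) ^ s := by rw [hlam]; push_cast; rfl
  have hlam1 : (1 : ℝ) ≤ lam := by exact_mod_cast (by omega : 1 ≤ lam)
  have hlam0 : (0 : ℝ) < lam := by linarith
  set D := (lam : ℝ) ^ δ with hD
  have hD0 : 0 < D := by positivity
  refine ⟨lam, (p + 2) * M ^ 312, by omega, Nat.mul_pos (by omega) (pow_pos (by omega) _), ?_,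
    fun F hF => ?_⟩
  · rw [hlamr, Real.log_pow]
    have hlog : Real.log M ≤ M := (Real.log_le_sub_one_of_pos (by linarith)).trans (by linarith)
    have hM2' : ((p + 2) * s : ℝ) ≤ M := by exact_mod_cast hM2
    push_cast
    calc ((p + 2) * M ^ 312 * (s * Real.log M) : ℝ) = ((p + 2) * s) * M ^ 312 * Real.log M := by
          ring
      _ ≤ M * M ^ 312 * M := by gcongr
      _ = _ := by ring
  · by_contra hcon
    push Not at hcon
    have hbig : c * (M : ℝ) ^ 10 * (lam : ℝ) ^ k < D * lam := by
      have h1 : (M : ℝ) ^ 11 ≤ (lam : ℝ) ^ θ := by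
        rw [hlamr, ← Real.rpow_natCast _ s, ← Real.rpow_mul (by linarith),
          ← Real.rpow_natCast _ 11]
        exact Real.rpow_le_rpow_of_exponent_le (by linarith) (by exact_mod_cast hs')
      have h2 : D * lam = (lam : ℝ) ^ θ * (lam : ℝ) ^ k := by
        rw [hD, ← Real.rpow_natCast _ k, ← Real.rpow_add hlam0, hθ, ← Real.rpow_add_one hlam0.ne']
        congr 1; ring
      rw [h2]
      have h3 : (c : ℝ) < M := by exact_mod_cast hM4
      calc c * (M : ℝ) ^ 10 * (lam : ℝ) ^ k < M * (M : ℝ) ^ 10 * (lam : ℝ) ^ k := by gcongr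
        _ = (M : ℝ) ^ 11 * (lam : ℝ) ^ k := by ring
        _ ≤ _ := by gcongr
    have hgrow := H F lam p (M ^ 312) M D (by omega) (Nat.one_le_pow _ _ (by omega)) hM6 hD0 hF hbig
      (by omega) hcon
    have hlow : D ^ ((p + 2) * M ^ 312) * (lam : ℝ) ^ (M ^ 312) ≤
        ((lam : ℝ) ^ p) ^ (M ^ 312 * k) := by
      have h1 : D ^ (p + 2) * lam ≤ (lam : ℝ) ^ (p * k) := by
        rw [hD, ← Real.rpow_natCast _ (p + 2), ← Real.rpow_mul hlam0.le,
          ← Real.rpow_add_one hlam0.ne', ← Real.rpow_natCast _ (p * k)]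
        refine Real.rpow_le_rpow_of_exponent_le hlam1 ?_
        push_cast
        exact hp'
      calc _ = (D ^ (p + 2) * lam) ^ (M ^ 312) := by rw [mul_pow, pow_mul]
        _ ≤ ((lam : ℝ) ^ (p * k)) ^ (M ^ 312) := by gcongr
        _ = _ := by rw [← pow_mul, ← pow_mul]; congr 1; ring
    have hnat : (lam : ℝ) ^ (M ^ 312) ≤
        ((M ^ 312 * k * lam ^ p : ℕ) : ℝ) ^ (M ^ 310) * M ^ 56 := by
      refine le_of_mul_le_mul_left ?_ (pow_pos hD0 ((p + 2) * M ^ 312))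
      refine (hlow.trans hgrow).trans_eq (by ring)
    have hnat' : lam ^ (M ^ 312) ≤ (M ^ 312 * k * lam ^ p) ^ (M ^ 310) * M ^ 56 := by
      exact_mod_cast hnat
    have hexp : M ^ (s * M ^ 312) ≤ M ^ ((313 + s * p) * M ^ 310 + 56) := by
      calc M ^ (s * M ^ 312) = lam ^ (M ^ 312) := by rw [hlam, pow_mul]
        _ ≤ (M ^ 312 * M * lam ^ p) ^ (M ^ 310) * M ^ 56 := hnat'.trans (by gcongr)
        _ = _ := by
          rw [hlam, ← pow_mul, ← pow_succ, ← pow_add, ← pow_mul, ← pow_add]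
    have h1 := (Nat.pow_le_pow_iff_right (by omega)).1 hexp
    have h2 : 1 ≤ M ^ 310 := Nat.one_le_pow _ _ (by omega)
    have h3 : M ^ 312 = M ^ 2 * M ^ 310 := pow_add M 2 310
    rw [h3] at h1
    generalize M ^ 310 = P at h1 h2
    have h4 : (370 + s * p) * P ≤ s * (M ^ 2 * P) := by
      calc (370 + s * p) * P ≤ M * P := by gcongr
        _ ≤ 1 * (M ^ 2 * P) := by rw [one_mul]; gcongr; exact Nat.le_self_pow (by norm_num) M
        _ ≤ _ := by gcongr
    nlinarith

end DiscreteEnergyBound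

section Tensorization

open Finset

theorem quadCount_eq_card {G : Type*} [AddCommGroup G] [DecidableEq G] (A B C D : Finset G)
    (h : G) : quadCount A B C D h =
      #{p ∈ (A ×ˢ C) ×ˢ (D ×ˢ B) | p.1.1 - p.1.2 = p.2.1 - p.2.2 + h} := by
  rw [quadCount]
  congr

variable {ι : Type*} [Fintype ι]

/-- The number of quadruples that are additive up to an error of at most `3` in each coordinate is
controlled by the number of additive quadruples. -/
theorem card_near_quadruple_le (A : Finset (ι → ℤ)) :
    #{p ∈ (A ×ˢ A) ×ˢ (A ×ˢ A) | ∀ i, |(p.1.1 - p.1.2 - (p.2.1 - p.2.2)) i| ≤ 3} ≤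
      7 ^ Fintype.card ι * quadCount A A A A 0 := by
  classical
  let B : Finset (ι → ℤ) := Fintype.piFinset fun _ => Finset.Icc (-3) 3
  have hB : #B = 7 ^ Fintype.card ι := by simp [B, Fintype.card_piFinset]
  rw [← hB, mul_comm]
  refine Finset.card_le_mul_card_image_of_maps_to
    (f := fun p => p.1.1 - p.1.2 - (p.2.1 - p.2.2)) ?_ _ ?_
  · intro p hp
    refine Fintype.mem_piFinset.2 fun i => ?_
    have := (Finset.mem_filter.1 hp).2 i
    rw [abs_le] at this
    exact Finset.mem_Icc.2 this
  · intro h _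
    have h1 : quadCount A A A A h ≤ quadCount A A A A 0 := by
      have := four_mul_quadCount_le A A A A h
      omega
    rw [quadCount_eq_card A A A A h] at h1
    refine le_trans (Finset.card_le_card fun p hp => ?_) h1
    obtain ⟨hp1, hp2⟩ := Finset.mem_filter.1 hp
    refine Finset.mem_filter.2 ⟨(Finset.mem_filter.1 hp1).1, ?_⟩
    rw [← hp2]
    abel

/-- Additive energy is submultiplicative under passing to coarser cells. -/
theorem quadCount_le_mul_quadCount_image (A : Finset (ι → ℤ)) {N : ℕ} (hN : 0 < N) {B : ℕ}
    (hB : ∀ a, quadCount {b ∈ A | coarsen N b = a} {b ∈ A | coarsen N b = a}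
      {b ∈ A | coarsen N b = a} {b ∈ A | coarsen N b = a} 0 ≤ B) :
    quadCount A A A A 0 ≤ B * (7 ^ Fintype.card ι *
      quadCount (A.image (coarsen N)) (A.image (coarsen N)) (A.image (coarsen N))
        (A.image (coarsen N)) 0) := by
  classical
  rw [quadCount_eq_card A A A A]
  refine le_trans ?_ (Nat.mul_le_mul_left B (card_near_quadruple_le _))
  refine Finset.card_le_mul_card_image_of_maps_to
    (f := fun p => ((coarsen N p.1.1, coarsen N p.1.2), (coarsen N p.2.1, coarsen N p.2.2)))
    ?_ _ ?_
  · intro p hp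
    obtain ⟨hp1, hp2⟩ := Finset.mem_filter.1 hp
    simp only [Finset.mem_product] at hp1
    simp only [Finset.mem_filter, Finset.mem_product]
    refine ⟨⟨⟨Finset.mem_image_of_mem _ hp1.1.1, Finset.mem_image_of_mem _ hp1.1.2⟩,
      ⟨Finset.mem_image_of_mem _ hp1.2.1, Finset.mem_image_of_mem _ hp1.2.2⟩⟩, fun i => ?_⟩
    have hN' : (0 : ℤ) < N := by exact_mod_cast hN
    have h := congrFun hp2 i
    simp only [Pi.sub_apply, Pi.add_apply, Pi.zero_apply, add_zero] at h
    simp only [Pi.sub_apply, coarsen]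
    have l1 := Int.ediv_mul_le (p.1.1 i) hN'.ne'
    have u1 := Int.lt_ediv_add_one_mul_self (p.1.1 i) hN'
    have l2 := Int.ediv_mul_le (p.1.2 i) hN'.ne'
    have u2 := Int.lt_ediv_add_one_mul_self (p.1.2 i) hN'
    have l3 := Int.ediv_mul_le (p.2.1 i) hN'.ne'
    have u3 := Int.lt_ediv_add_one_mul_self (p.2.1 i) hN'
    have l4 := Int.ediv_mul_le (p.2.2 i) hN'.ne'
    have u4 := Int.lt_ediv_add_one_mul_self (p.2.2 i) hN'
    generalize p.1.1 i / (N : ℤ) = a at *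
    generalize p.1.2 i / (N : ℤ) = b at *
    generalize p.2.1 i / (N : ℤ) = c at *
    generalize p.2.2 i / (N : ℤ) = d at *
    rw [abs_le]
    constructor
    · refine le_of_mul_le_mul_right ?_ hN'
      linarith
    · refine le_of_mul_le_mul_right ?_ hN'
      linarith
  · rintro ⟨⟨a, c⟩, d, b⟩ _
    have h4 := four_mul_quadCount_le {x ∈ A | coarsen N x = a} {x ∈ A | coarsen N x = b}
      {x ∈ A | coarsen N x = c} {x ∈ A | coarsen N x = d} 0
    have ha := hB a
    have hb := hB b
    have hc := hB c
    have hd := hB d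
    have h5 : quadCount {x ∈ A | coarsen N x = a} {x ∈ A | coarsen N x = b}
      {x ∈ A | coarsen N x = c} {x ∈ A | coarsen N x = d} 0 ≤ B := by omega
    rw [quadCount_eq_card] at h5
    refine le_trans (Finset.card_le_card fun p hp => ?_) h5
    obtain ⟨hp1, hp2⟩ := Finset.mem_filter.1 hp
    obtain ⟨hp0, hp3⟩ := Finset.mem_filter.1 hp1
    simp only [Prod.mk.injEq] at hp2
    simp only [Finset.mem_product] at hp0
    simp only [Finset.mem_filter, Finset.mem_product]
    tauto

end Tensorization

section RegularMeasure

open Finset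

variable {d : ℕ}

/-- The index of the cell of side length `1 / n` that contains `x`. -/
noncomputable def cellIndex (n : ℕ) (x : EuclideanSpace ℝ (Fin d)) : Fin d → ℤ :=
  fun i => ⌊x i * n⌋

open scoped Classical in
/-- The indices of the cells of side length `1 / n` that meet a subset `X` of the unit ball. -/
noncomputable def cellFinset (X : Set (EuclideanSpace ℝ (Fin d))) (n : ℕ) : Finset (Fin d → ℤ) :=
  {a ∈ Fintype.piFinset fun _ => Finset.Icc (-(n : ℤ)) n | ∃ x ∈ X, cellIndex n x = a}

theorem coarsen_cellIndex {N : ℕ} (hN : 0 < N) (n : ℕ) (x : EuclideanSpace ℝ (Fin d)) :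
    coarsen N (cellIndex (N * n) x) = cellIndex n x := by
  ext i
  have h := Int.mul_natCast_floor_div_cancel (a := x i * n) hN.ne'
  rw [coarsen, cellIndex, cellIndex, ← h]
  congr 2
  push_cast
  ring

theorem mem_cellFinset {X : Set (EuclideanSpace ℝ (Fin d))} (hX : X ⊆ closedBall 0 1) {n : ℕ}
    {a : Fin d → ℤ} : a ∈ cellFinset X n ↔ ∃ x ∈ X, cellIndex n x = a := by
  classical
  rw [cellFinset, Finset.mem_filter, and_iff_right_iff_imp]
  rintro ⟨x, hx, rfl⟩
  refine Fintype.mem_piFinset.2 fun i => ?_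
  have h1 : |x i| ≤ 1 := by
    have h2 := (PiLp.norm_apply_le x i).trans (mem_closedBall_zero_iff.1 (hX hx))
    rwa [Real.norm_eq_abs] at h2
  have hn : (0 : ℝ) ≤ n := Nat.cast_nonneg n
  obtain ⟨h3, h4⟩ := abs_le.1 h1
  rw [Finset.mem_Icc, cellIndex]
  constructor
  · rw [Int.le_floor]
    push_cast
    nlinarith
  · have h5 : ((⌊x i * n⌋ : ℤ) : ℝ) ≤ n := (Int.floor_le _).trans (by nlinarith)
    exact_mod_cast h5

theorem image_coarsen_cellFinset {X : Set (EuclideanSpace ℝ (Fin d))} (hX : X ⊆ closedBall 0 1)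
    {N : ℕ} (hN : 0 < N) (n : ℕ) :
    (cellFinset X (N * n)).image (coarsen N) = cellFinset X n := by
  ext a
  rw [Finset.mem_image, mem_cellFinset hX]
  constructor
  · rintro ⟨b, hb, rfl⟩
    obtain ⟨x, hx, rfl⟩ := (mem_cellFinset hX).1 hb
    exact ⟨x, hx, (coarsen_cellIndex hN n x).symm⟩
  · rintro ⟨x, hx, rfl⟩
    exact ⟨_, (mem_cellFinset hX).2 ⟨x, hx, rfl⟩, coarsen_cellIndex hN n x⟩

theorem norm_sub_le_of_cellIndex_eq {n : ℕ} (hn : 0 < n) {x y : EuclideanSpace ℝ (Fin d)}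
    (h : cellIndex n x = cellIndex n y) : ‖x - y‖ ≤ d / n := by
  have hn' : (0 : ℝ) < n := by exact_mod_cast hn
  have hc : ∀ i, ‖(x - y) i‖ ≤ 1 / n := by
    intro i
    have h1 := congrFun h i
    simp only [cellIndex] at h1
    have h2 := Int.abs_sub_lt_one_of_floor_eq_floor h1
    rw [← sub_mul, abs_mul, abs_of_pos hn'] at h2
    rw [le_div_iff₀ hn']
    exact h2.le
  rw [EuclideanSpace.norm_eq]
  refine Real.sqrt_le_iff.2 ⟨by positivity, ?_⟩
  calc ∑ i, ‖(x - y) i‖ ^ 2 ≤ ∑ _i : Fin d, (1 / n : ℝ) ^ 2 := by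
        refine Finset.sum_le_sum fun i _ => ?_
        gcongr
        exact hc i
    _ = d * (1 / n : ℝ) ^ 2 := by simp
    _ ≤ (d : ℝ) ^ 2 * (1 / n : ℝ) ^ 2 := by
        gcongr
        exact_mod_cast Nat.le_self_pow (by norm_num) d
    _ = _ := by ring

variable {δ α C : ℝ} {X : Set (EuclideanSpace ℝ (Fin d))}
  {μ : Measure (EuclideanSpace ℝ (Fin d))}

theorem IsRegularMeasure.univ_le (hμ : IsRegularMeasure δ α 1 C X μ) (hα : α ≤ 1)
    (hX : X ⊆ closedBall 0 1) : μ Set.univ ≤ ENNReal.ofReal C := by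
  obtain ⟨-, hsupp, hup, -⟩ := hμ
  have h1 := hup 0 1 hα le_rfl
  rw [Real.one_rpow, mul_one] at h1
  calc μ Set.univ ≤ μ X + μ Xᶜ := by rw [← Set.union_compl_self X]; exact measure_union_le _ _
    _ = μ X := by rw [hsupp, add_zero]
    _ ≤ μ (closedBall 0 1) := measure_mono hX
    _ ≤ _ := h1

theorem IsRegularMeasure.closedBall_le (hμ : IsRegularMeasure δ α 1 C X μ) (hα : α ≤ 1)
    (hX : X ⊆ closedBall 0 1) (hδ : 0 ≤ δ) (hC : 0 ≤ C) (x : EuclideanSpace ℝ (Fin d)) {R : ℝ}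
    (hR : α ≤ R) : μ (closedBall x R) ≤ ENNReal.ofReal (C * R ^ δ) := by
  rcases le_total R 1 with h | h
  · exact hμ.2.2.1 x R hR h
  · refine (measure_mono (Set.subset_univ _)).trans ((hμ.univ_le hα hX).trans ?_)
    exact ENNReal.ofReal_le_ofReal (le_mul_of_one_le_right hC (Real.one_le_rpow h hδ))

theorem IsRegularMeasure.measure_cellIndex_le (hμ : IsRegularMeasure δ α 1 C X μ) (hd : 1 ≤ d)
    (hX : X ⊆ closedBall 0 1) (hδ : 0 ≤ δ) (hC : 0 ≤ C) {n : ℕ} (hn : 0 < n) (hα : α ≤ 1 / n)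
    (a : Fin d → ℤ) (ha : a ∈ cellFinset X n) :
    μ {x | cellIndex n x = a} ≤ ENNReal.ofReal (C * (d / n) ^ δ) := by
  obtain ⟨x, hx, rfl⟩ := (mem_cellFinset hX).1 ha
  have hn' : (1 : ℝ) ≤ n := by exact_mod_cast hn
  have hd' : (1 : ℝ) ≤ d := by exact_mod_cast hd
  have h1 : (1 : ℝ) / n ≤ 1 := by rw [div_le_one (by linarith)]; exact hn'
  refine (measure_mono fun y hy => ?_).trans (hμ.closedBall_le (hα.trans h1) hX hδ hC x
    (R := d / n) (hα.trans (by gcongr)))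
  rw [mem_closedBall, dist_eq_norm]
  exact norm_sub_le_of_cellIndex_eq hn hy

/-- A regular set meets at most the expected number of subcells of a cell. -/
theorem IsRegularMeasure.card_cellFinset_le (hμ : IsRegularMeasure δ α 1 C X μ)
    (hX : X ⊆ closedBall 0 1) (hδ : 0 ≤ δ) (hC : 0 < C) {N n : ℕ} (hN : 0 < N) (hn : 0 < n)
    (hα : α ≤ 1 / (N * n : ℕ)) (c : Fin d → ℤ) :
    (#{b ∈ cellFinset X (N * n) | coarsen N b = c} : ℝ) ≤
      3 ^ d * (d + 1) ^ δ * C ^ 2 * (N : ℝ) ^ δ := by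
  classical
  set S := {b ∈ cellFinset X (N * n) | coarsen N b = c} with hS
  rcases S.eq_empty_or_nonempty with hS0 | ⟨b₀, hb₀⟩
  · rw [hS0]
    simp only [Finset.card_empty, Nat.cast_zero]
    positivity
  have hn' : (1 : ℝ) ≤ n := by exact_mod_cast hn
  have hN' : (1 : ℝ) ≤ N := by exact_mod_cast hN
  have hNn : 0 < N * n := Nat.mul_pos hN hn
  set s : ℝ := 1 / (N * n : ℕ) with hs
  have hNn' : (1 : ℝ) ≤ (N * n : ℕ) := by exact_mod_cast hNn
  have hs0 : 0 < s := by positivity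
  have hs1 : s ≤ 1 := by rw [hs, div_le_one (by linarith)]; exact hNn'
  have hsn : s ≤ 1 / n := by
    rw [hs]
    push_cast
    gcongr
    nlinarith
  have hpt : ∀ b, ∃ x, b ∈ S → x ∈ X ∧ cellIndex (N * n) x = b ∧ cellIndex n x = c := by
    intro b
    by_cases hb : b ∈ S
    · obtain ⟨hb1, hb2⟩ := Finset.mem_filter.1 hb
      obtain ⟨x, hx, rfl⟩ := (mem_cellFinset hX).1 hb1
      exact ⟨x, fun _ => ⟨hx, rfl, by rw [← hb2, coarsen_cellIndex hN]⟩⟩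
    · exact ⟨0, fun h => absurd h hb⟩
  choose x hx using hpt
  have hoverlap : ∀ y, #{b ∈ S | y ∈ closedBall (x b) s} ≤ 3 ^ d := by
    intro y
    let B : Finset (Fin d → ℤ) := Fintype.piFinset fun i =>
      Finset.Icc (cellIndex (N * n) y i - 1) (cellIndex (N * n) y i + 1)
    have hB : #B = 3 ^ d := by
      have : ∀ z : ℤ, #(Finset.Icc (z - 1) (z + 1)) = 3 := by
        intro z
        rw [Int.card_Icc]
        omega
      simp [B, Fintype.card_piFinset, this]
    rw [← hB]
    refine Finset.card_le_card fun b hb => Fintype.mem_piFinset.2 fun i => ?_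
    obtain ⟨hbS, hyb⟩ := Finset.mem_filter.1 hb
    rw [mem_closedBall, dist_eq_norm] at hyb
    have h1 := (PiLp.norm_apply_le (y - x b) i).trans hyb
    rw [Real.norm_eq_abs, hs, le_div_iff₀ (by linarith), PiLp.sub_apply,
      ← abs_of_nonneg (zero_le_one.trans hNn'), ← abs_mul, sub_mul,
      abs_le] at h1
    have h2 : b i = ⌊x b i * (N * n : ℕ)⌋ := (congrFun (hx b hbS).2.1 i).symm
    rw [h2, cellIndex, Finset.mem_Icc, sub_le_iff_le_add, ← Int.floor_add_one, ← Int.floor_add_one]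
    exact ⟨Int.floor_le_floor (by linarith), Int.floor_le_floor (by linarith)⟩
  have hR : ∀ b ∈ S, closedBall (x b) s ⊆ closedBall (x b₀) ((d + 1) / n) := by
    intro b hb
    refine closedBall_subset_closedBall' ?_
    rw [dist_eq_norm]
    have h1 := norm_sub_le_of_cellIndex_eq hn ((hx b hb).2.2.trans (hx b₀ hb₀).2.2.symm)
    rw [add_div]
    linarith
  have hsum : ∑ b ∈ S, μ (closedBall (x b) s) ≤
      (3 ^ d : ℕ) * μ (closedBall (x b₀) ((d + 1) / n)) := by
    calc ∑ b ∈ S, μ (closedBall (x b) s)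
        = ∑ b ∈ S, ∫⁻ y, (closedBall (x b) s).indicator 1 y ∂μ := by
          refine Finset.sum_congr rfl fun b _ => ?_
          rw [lintegral_indicator_one measurableSet_closedBall]
      _ = ∫⁻ y, ∑ b ∈ S, (closedBall (x b) s).indicator 1 y ∂μ := by
          rw [lintegral_finsetSum]
          exact fun b _ => measurable_one.indicator measurableSet_closedBall
      _ ≤ ∫⁻ y, (closedBall (x b₀) ((d + 1) / n)).indicator
          (fun _ => ((3 ^ d : ℕ) : ℝ≥0∞)) y ∂μ := by
          refine lintegral_mono fun y => ?_
          by_cases hy : y ∈ closedBall (x b₀) ((d + 1) / n)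
          · rw [Set.indicator_of_mem hy]
            calc ∑ b ∈ S, (closedBall (x b) s).indicator (1 : EuclideanSpace ℝ (Fin d) → ℝ≥0∞) y
                = (#{b ∈ S | y ∈ closedBall (x b) s} : ℝ≥0∞) := by
                  rw [Finset.card_filter]
                  push_cast
                  refine Finset.sum_congr rfl fun b _ => ?_
                  simp only [Set.indicator, Pi.one_apply]
              _ ≤ _ := by exact_mod_cast hoverlap y
          · rw [Set.indicator_of_notMem hy, nonpos_iff_eq_zero]
            exact Finset.sum_eq_zero fun b hb => Set.indicator_of_notMem (fun h => hy (hR b hb h)) _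
      _ = _ := by rw [lintegral_indicator_const measurableSet_closedBall]
  have hlow : (#S : ℝ≥0∞) * ENNReal.ofReal (C⁻¹ * s ^ δ) ≤ ∑ b ∈ S, μ (closedBall (x b) s) := by
    rw [← nsmul_eq_mul]
    exact Finset.card_nsmul_le_sum _ _ _ fun b hb => hμ.2.2.2 _ (hx b hb).1 s hα hs1
  have hup : μ (closedBall (x b₀) ((d + 1) / n)) ≤ ENNReal.ofReal (C * ((d + 1) / n) ^ δ) := by
    refine hμ.closedBall_le (hα.trans hs1) hX hδ hC.le _ (hα.trans (hsn.trans ?_))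
    gcongr
    linarith [(Nat.cast_nonneg d : (0 : ℝ) ≤ d)]
  have hfin : (#S : ℝ) * (C⁻¹ * s ^ δ) ≤ (3 ^ d : ℕ) * (C * ((d + 1) / n) ^ δ) := by
    have h := hlow.trans (hsum.trans (mul_le_mul_right hup _))
    rw [← ENNReal.ofReal_natCast, ← ENNReal.ofReal_natCast,
      ← ENNReal.ofReal_mul (Nat.cast_nonneg _), ← ENNReal.ofReal_mul (Nat.cast_nonneg _)] at h
    exact (ENNReal.ofReal_le_ofReal_iff (by positivity)).1 h
  have hsδ : ((d + 1 : ℝ) / n) ^ δ = (d + 1) ^ δ * (N : ℝ) ^ δ * s ^ δ := by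
    rw [← Real.mul_rpow (by positivity) (by positivity),
      ← Real.mul_rpow (by positivity) (by positivity), hs]
    congr 1
    push_cast
    field_simp
  have hsδ0 : 0 < s ^ δ := Real.rpow_pos_of_pos hs0 δ
  rw [hsδ] at hfin
  push_cast at hfin
  have h1 : (#S : ℝ) * (C⁻¹ * s ^ δ) ≤
      (3 ^ d * (d + 1) ^ δ * C ^ 2 * (N : ℝ) ^ δ) * (C⁻¹ * s ^ δ) := by
    refine hfin.trans_eq ?_
    field_simp
  exact le_of_mul_le_mul_right h1 (by positivity)

theorem IsRegularMeasure.isTreeRegular (hμ : IsRegularMeasure δ α 1 C X μ)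
    (hX : X ⊆ closedBall 0 1) (hδ : 0 ≤ δ) (hC : 0 < C) {lam m n : ℕ} (hlam : 0 < lam)
    (hn : 0 < n) (hα : α ≤ 1 / (lam ^ m * n : ℕ)) {M : ℝ}
    (hM : 3 ^ d * (d + 1) ^ δ * C ^ 2 ≤ M) (a : Fin d → ℤ) :
    IsTreeRegular {b ∈ cellFinset X (lam ^ m * n) | coarsen (lam ^ m) b = a} lam m
      ((lam : ℝ) ^ δ) M where
  card_fibre_le i j hij c := by
    obtain ⟨l, rfl⟩ := Nat.exists_eq_add_of_le hij
    have hl : 0 < lam ^ l * n := Nat.mul_pos (pow_pos hlam l) hn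
    have hj : 0 < lam ^ j * (lam ^ l * n) := Nat.mul_pos (pow_pos hlam j) hl
    have hmn : lam ^ (i + j + l) * n = lam ^ i * (lam ^ j * (lam ^ l * n)) := by ring
    have hsub : {b ∈ ({b ∈ cellFinset X (lam ^ (i + j + l) * n) |
          coarsen (lam ^ (i + j + l)) b = a}).image (coarsen (lam ^ i)) |
          coarsen (lam ^ j) b = c} ⊆
        {b ∈ cellFinset X (lam ^ j * (lam ^ l * n)) | coarsen (lam ^ j) b = c} := by
      rw [← image_coarsen_cellFinset hX (pow_pos hlam i) (lam ^ j * (lam ^ l * n)), ← hmn]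
      exact Finset.filter_subset_filter _ (Finset.image_subset_image (Finset.filter_subset _ _))
    have hα' : α ≤ 1 / (lam ^ j * (lam ^ l * n) : ℕ) := by
      refine hα.trans ?_
      rw [hmn]
      have h1 : (1 : ℝ) ≤ (lam ^ i : ℕ) := by exact_mod_cast Nat.one_le_pow i lam hlam
      have h2 : (0 : ℝ) < (lam ^ j * (lam ^ l * n) : ℕ) := by exact_mod_cast hj
      rw [Nat.cast_mul (lam ^ i)]
      exact one_div_le_one_div_of_le h2 (le_mul_of_one_le_left h2.le h1)
    calc _ ≤ (#{b ∈ cellFinset X (lam ^ j * (lam ^ l * n)) | coarsen (lam ^ j) b = c} : ℝ) := by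
          exact_mod_cast Finset.card_le_card hsub
      _ ≤ 3 ^ d * (d + 1) ^ δ * C ^ 2 * ((lam ^ j : ℕ) : ℝ) ^ δ :=
          hμ.card_cellFinset_le hX hδ hC (pow_pos hlam j) hl hα' c
      _ ≤ M * ((lam ^ j : ℕ) : ℝ) ^ δ := by gcongr
      _ = _ := by
          rw [Nat.cast_pow, Real.rpow_pow_comm (Nat.cast_nonneg _)]
  exists_coarsen_eq := ⟨a, fun _ hx => (Finset.mem_filter.1 hx).2⟩

theorem card_cellFinset_one_le : #(cellFinset X 1) ≤ 3 ^ d := by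
  classical
  refine (Finset.card_filter_le _ _).trans ?_
  simp [Fintype.card_piFinset]

theorem IsRegularMeasure.quadCount_cellFinset_le (hμ : IsRegularMeasure δ α 1 C X μ)
    (hX : X ⊆ closedBall 0 1) (hδ : 0 ≤ δ) (hC : 0 < C) {lam m B : ℕ} (hlam : 0 < lam) {M : ℝ}
    (hM : 3 ^ d * (d + 1) ^ δ * C ^ 2 ≤ M)
    (hB : ∀ F : Finset (Fin d → ℤ), IsTreeRegular F lam m ((lam : ℝ) ^ δ) M →
      quadCount F F F F 0 ≤ B) (j : ℕ) (hα : α ≤ 1 / ((lam ^ m) ^ j : ℕ)) :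
    quadCount (cellFinset X ((lam ^ m) ^ j)) (cellFinset X ((lam ^ m) ^ j))
      (cellFinset X ((lam ^ m) ^ j)) (cellFinset X ((lam ^ m) ^ j)) 0 ≤
        (7 ^ d * B) ^ j * (3 ^ d) ^ 3 := by
  induction j with
  | zero =>
    rw [pow_zero, pow_zero, one_mul]
    exact (quadCount_le_card_pow _).trans (Nat.pow_le_pow_left card_cellFinset_one_le 3)
  | succ j ih =>
    have hN : 0 < lam ^ m := pow_pos hlam m
    have hn : 0 < (lam ^ m) ^ j := pow_pos hN j
    have hα' : α ≤ 1 / ((lam ^ m) ^ j : ℕ) := by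
      refine hα.trans (one_div_le_one_div_of_le (by exact_mod_cast hn) ?_)
      exact_mod_cast Nat.pow_le_pow_right hN (Nat.le_succ j)
    rw [pow_succ'] at hα ⊢
    have h := quadCount_le_mul_quadCount_image (cellFinset X (lam ^ m * (lam ^ m) ^ j)) hN (B := B)
      fun a => hB _ (hμ.isTreeRegular hX hδ hC hlam hn hα hM a)
    rw [image_coarsen_cellFinset hX hN, Fintype.card_fin] at h
    refine h.trans ?_
    calc _ ≤ B * (7 ^ d * ((7 ^ d * B) ^ j * (3 ^ d) ^ 3)) := by
          gcongr
          exact ih hα'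
      _ = _ := by ring

/-- Additive energy of a regular measure at scale `1 / n` is bounded by the discrete additive energy
of the cells of side length `1 / n` meeting its support. -/
theorem IsRegularMeasure.addEnergy_le (hμ : IsRegularMeasure δ α 1 C X μ) (hd : 1 ≤ d)
    (hX : X ⊆ closedBall 0 1) (hδ : 0 ≤ δ) (hC : 0 ≤ C) {n : ℕ} (hn : 0 < n) (hα : α ≤ 1 / n) :
    _root_.addEnergy μ (1 / n) ≤ ENNReal.ofReal ((C * (d / n) ^ δ) ^ 4 * (7 ^ d *
      quadCount (cellFinset X n) (cellFinset X n) (cellFinset X n) (cellFinset X n) 0)) := by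
  classical
  have hn' : (1 : ℝ) ≤ n := by exact_mod_cast hn
  have hn0 : (0 : ℝ) < n := by linarith
  have h1n : (1 : ℝ) / n ≤ 1 := by rw [div_le_one hn0]; exact hn'
  have : IsFiniteMeasure μ :=
    ⟨(hμ.univ_le (hα.trans h1n) hX).trans_lt ENNReal.ofReal_lt_top⟩
  set A := cellFinset X n with hA
  set q := C * (d / n) ^ δ with hq
  set S := {p ∈ (A ×ˢ A) ×ˢ (A ×ˢ A) | ∀ i, |(p.1.1 - p.1.2 - (p.2.1 - p.2.2)) i| ≤ 3} with hS
  let Q : (Fin d → ℤ) → Set (EuclideanSpace ℝ (Fin d)) := fun a => {x | cellIndex n x = a}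
  have hQ : ∀ a ∈ A, μ (Q a) ≤ ENNReal.ofReal q := fun a ha =>
    hμ.measure_cellIndex_le hd hX hδ hC hn hα a ha
  have haeX : ∀ᵐ x ∂μ, x ∈ X := hμ.2.1
  have hae : ∀ᵐ p ∂(μ.prod (μ.prod (μ.prod μ))),
      p.1 ∈ X ∧ p.2.1 ∈ X ∧ p.2.2.1 ∈ X ∧ p.2.2.2 ∈ X := by
    have q1 := Measure.quasiMeasurePreserving_fst (μ := μ) (ν := μ.prod (μ.prod μ))
    have q2 := Measure.quasiMeasurePreserving_snd (μ := μ) (ν := μ.prod (μ.prod μ))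
    have q21 := (Measure.quasiMeasurePreserving_fst (μ := μ) (ν := μ.prod μ)).comp q2
    have q22 := (Measure.quasiMeasurePreserving_snd (μ := μ) (ν := μ.prod μ)).comp q2
    have q221 := (Measure.quasiMeasurePreserving_fst (μ := μ) (ν := μ)).comp q22
    have q222 := (Measure.quasiMeasurePreserving_snd (μ := μ) (ν := μ)).comp q22
    filter_upwards [q1.ae haeX, q21.ae haeX, q221.ae haeX, q222.ae haeX] with p h1 h2 h3 h4
    exact ⟨h1, h2, h3, h4⟩
  have hcover : (μ.prod (μ.prod (μ.prod μ)))
      {p | ‖p.1 + p.2.1 - p.2.2.1 - p.2.2.2‖ ≤ 1 / n} ≤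
      (μ.prod (μ.prod (μ.prod μ)))
        (⋃ t ∈ S, Q t.1.1 ×ˢ (Q t.2.2 ×ˢ (Q t.1.2 ×ˢ Q t.2.1))) := by
    refine measure_mono_ae ?_
    filter_upwards [hae] with p hp hnorm
    obtain ⟨h1, h2, h3, h4⟩ := hp
    refine Set.mem_iUnion₂.2 ⟨((cellIndex n p.1, cellIndex n p.2.2.1),
      (cellIndex n p.2.2.2, cellIndex n p.2.1)), ?_, rfl, rfl, rfl, rfl⟩
    have hmem : ∀ x ∈ X, cellIndex n x ∈ A := fun x hx => (mem_cellFinset hX).2 ⟨x, hx, rfl⟩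
    refine Finset.mem_filter.2 ⟨Finset.mem_product.2 ⟨Finset.mem_product.2 ⟨hmem _ h1, hmem _ h3⟩,
      Finset.mem_product.2 ⟨hmem _ h4, hmem _ h2⟩⟩, fun i => ?_⟩
    have hi := (PiLp.norm_apply_le _ i).trans
      (show ‖p.1 + p.2.1 - p.2.2.1 - p.2.2.2‖ ≤ 1 / n from hnorm)
    rw [Real.norm_eq_abs, le_div_iff₀ hn0, ← abs_of_pos hn0, ← abs_mul] at hi
    simp only [PiLp.sub_apply, PiLp.add_apply, sub_mul, add_mul] at hi
    simp only [Pi.sub_apply, cellIndex]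
    obtain ⟨hi1, hi2⟩ := abs_le.1 hi
    have l1 := Int.floor_le (p.1 i * n)
    have u1 := Int.lt_floor_add_one (p.1 i * n)
    have l2 := Int.floor_le (p.2.1 i * n)
    have u2 := Int.lt_floor_add_one (p.2.1 i * n)
    have l3 := Int.floor_le (p.2.2.1 i * n)
    have u3 := Int.lt_floor_add_one (p.2.2.1 i * n)
    have l4 := Int.floor_le (p.2.2.2 i * n)
    have u4 := Int.lt_floor_add_one (p.2.2.2 i * n)
    generalize ⌊p.1 i * n⌋ = a at *
    generalize ⌊p.2.1 i * n⌋ = b at *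
    generalize ⌊p.2.2.1 i * n⌋ = c at *
    generalize ⌊p.2.2.2 i * n⌋ = e at *
    have h5 : |((a - c - (e - b) : ℤ) : ℝ)| ≤ (3 : ℤ) := by
      push_cast
      rw [abs_le]
      constructor <;> linarith
    exact_mod_cast h5
  rw [_root_.addEnergy]
  refine hcover.trans ((measure_biUnion_finset_le _ _).trans ?_)
  have hbox : ∀ t ∈ S, (μ.prod (μ.prod (μ.prod μ)))
      (Q t.1.1 ×ˢ (Q t.2.2 ×ˢ (Q t.1.2 ×ˢ Q t.2.1))) ≤ ENNReal.ofReal (q ^ 4) := by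
    intro t ht
    have ht1 := (Finset.mem_filter.1 ht).1
    simp only [Finset.mem_product] at ht1
    rw [Measure.prod_prod, Measure.prod_prod, Measure.prod_prod, ENNReal.ofReal_pow (by positivity)]
    calc _ ≤ ENNReal.ofReal q * (ENNReal.ofReal q * (ENNReal.ofReal q * ENNReal.ofReal q)) := by
          gcongr
          · exact hQ _ ht1.1.1
          · exact hQ _ ht1.2.2
          · exact hQ _ ht1.1.2
          · exact hQ _ ht1.2.1
      _ = _ := by ring
  refine (Finset.sum_le_card_nsmul _ _ _ hbox).trans ?_
  have hcard : #S ≤ 7 ^ d * quadCount A A A A 0 := by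
    have := card_near_quadruple_le A
    rw [Fintype.card_fin] at this
    convert this
  rw [nsmul_eq_mul, ← ENNReal.ofReal_natCast, ← ENNReal.ofReal_mul (Nat.cast_nonneg _), mul_comm]
  refine ENNReal.ofReal_le_ofReal (mul_le_mul_of_nonneg_left ?_ (by positivity))
  exact_mod_cast hcard

theorem IsRegularMeasure.addEnergy_le_rpow (hμ : IsRegularMeasure δ α 1 C X μ) (hd : 1 ≤ d)
    (hX : X ⊆ closedBall 0 1) (hδ : 0 < δ) (hC : 0 < C) {lam m N M : ℕ} {β r : ℝ}
    (hlam : 0 < lam) (hN : lam ^ m = N) (hN1 : 1 < N) (hβ : β ≤ 1 / Real.log N)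
    (hM : 3 ^ d * (d + 1) ^ δ * C ^ 2 ≤ M) (hM7 : 3 * 7 ^ d ≤ (M : ℝ))
    (hE : ∀ F : Finset (Fin d → ℤ), IsTreeRegular F lam m ((lam : ℝ) ^ δ) M →
      M * (quadCount F F F F 0 : ℝ) ≤ (((lam : ℝ) ^ δ) ^ m) ^ 3)
    (hr0 : 0 < r) (hr : α ≤ r) (hr1 : r < 1) :
    addEnergy μ r ≤ ENNReal.ofReal ((C * d ^ δ) ^ 4 * (7 ^ d * (3 ^ d) ^ 3) *
      ((N : ℝ) ^ δ * Real.exp 1) * r ^ (δ + β)) := by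
  have hN1' : (1 : ℝ) < N := by exact_mod_cast hN1
  have hN0 : (0 : ℝ) < N := by linarith
  have hM0 : (0 : ℝ) < M := by
    have : (0 : ℝ) < 7 ^ d := by positivity
    linarith
  have hlogN : 0 < Real.log N := Real.log_pos hN1'
  have hDN : ((lam : ℝ) ^ δ) ^ m = (N : ℝ) ^ δ := by
    rw [← hN, Nat.cast_pow, Real.rpow_pow_comm (Nat.cast_nonneg _)]
  have hNδ : 0 < (N : ℝ) ^ δ := by positivity
  obtain ⟨j, hj1, hj2⟩ := exists_nat_pow_near (one_le_one_div hr0 hr1.le) hN1'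
  obtain ⟨n, hn⟩ : ∃ n : ℕ, N ^ j = n := ⟨_, rfl⟩
  have hn0 : 0 < n := hn ▸ pow_pos (by omega) j
  have hn0' : (0 : ℝ) < n := by exact_mod_cast hn0
  have hnN : (n : ℝ) = (N : ℝ) ^ j := by rw [← hn, Nat.cast_pow]
  have hnr : r ≤ 1 / n := by
    rw [le_div_iff₀ hn0', hnN, mul_comm, ← le_div_iff₀ hr0]
    exact hj1
  have hnr' : 1 ≤ r * n * N := by
    rw [div_lt_iff₀ hr0] at hj2
    rw [hnN]
    calc 1 ≤ (N : ℝ) ^ (j + 1) * r := hj2.le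
      _ = _ := by ring
  obtain ⟨B, hB⟩ : ∃ B : ℕ, ⌊((N : ℝ) ^ δ) ^ 3 / M⌋₊ = B := ⟨_, rfl⟩
  have hB7 : (7 ^ d * B : ℝ) ≤ ((N : ℝ) ^ δ) ^ 3 * Real.exp (-1) := by
    have h1 : (B : ℝ) ≤ ((N : ℝ) ^ δ) ^ 3 / M := hB ▸ Nat.floor_le (by positivity)
    have h2 : (7 ^ d : ℝ) / M ≤ Real.exp (-1) := by
      rw [Real.exp_neg, ← one_div, div_le_div_iff₀ hM0 (Real.exp_pos 1)]
      have h3 : Real.exp 1 ≤ 3 := by linarith [Real.exp_one_lt_d9]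
      calc (7 ^ d : ℝ) * Real.exp 1 ≤ 7 ^ d * 3 := by gcongr
        _ ≤ _ := by linarith
    calc (7 ^ d * B : ℝ) ≤ 7 ^ d * (((N : ℝ) ^ δ) ^ 3 / M) := by gcongr
      _ = ((N : ℝ) ^ δ) ^ 3 * (7 ^ d / M) := by ring
      _ ≤ _ := by gcongr
  have hquad := hμ.quadCount_cellFinset_le hX hδ.le hC (lam := lam) (m := m) (B := B) (M := M)
    hlam hM (fun F hF => by
      have h := hE F hF
      rw [hDN] at h
      rw [← hB]
      refine Nat.le_floor ?_
      rw [le_div_iff₀ hM0]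
      linarith) j (by rw [hN, hn]; exact hr.trans hnr)
  rw [hN, hn] at hquad
  have hquad' : ((quadCount (cellFinset X n) (cellFinset X n) (cellFinset X n) (cellFinset X n) 0 :
      ℕ) : ℝ) ≤ ((n : ℝ) ^ δ) ^ 3 * Real.exp (-j) * (3 ^ d) ^ 3 := by
    calc _ ≤ (7 ^ d * B : ℝ) ^ j * (3 ^ d) ^ 3 := by exact_mod_cast hquad
      _ ≤ (((N : ℝ) ^ δ) ^ 3 * Real.exp (-1)) ^ j * (3 ^ d) ^ 3 := by gcongr
      _ = _ := by
        rw [hnN, ← Real.rpow_pow_comm hN0.le, mul_pow, ← Real.exp_nat_mul, mul_neg_one,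
          pow_right_comm]
  refine (measure_mono fun p hp => le_trans (show ‖_‖ ≤ r from hp) hnr).trans
    ((hμ.addEnergy_le hd hX hδ.le hC.le hn0 (hr.trans hnr)).trans (ENNReal.ofReal_le_ofReal ?_))
  have hnδ : 0 < (n : ℝ) ^ δ := by positivity
  have hscale : ((n : ℝ) ^ δ)⁻¹ ≤ (N : ℝ) ^ δ * r ^ δ := by
    have h1 := Real.one_le_rpow hnr' hδ.le
    rw [Real.mul_rpow (by positivity) hN0.le, Real.mul_rpow hr0.le hn0'.le] at h1
    rw [inv_le_iff_one_le_mul₀ hnδ]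
    linarith
  have hgain : Real.exp (-j) ≤ Real.exp 1 * r ^ β := by
    have h1 : -((j : ℝ) + 1) ≤ Real.log r * (1 / Real.log N) := by
      have h2 := Real.log_lt_log (by positivity) hj2
      rw [one_div, Real.log_inv, Real.log_pow] at h2
      push_cast at h2
      rw [mul_one_div, le_div_iff₀ hlogN]
      linarith
    calc Real.exp (-j) = Real.exp 1 * Real.exp (-((j : ℝ) + 1)) := by
          rw [← Real.exp_add]; congr 1; ring
      _ ≤ Real.exp 1 * r ^ (1 / Real.log N) := by
          rw [Real.rpow_def_of_pos hr0]
          gcongr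
      _ ≤ _ := mul_le_mul_of_nonneg_left
          (Real.rpow_le_rpow_of_exponent_ge hr0 hr1.le hβ) (Real.exp_pos 1).le
  calc _ ≤ (C * (d / n) ^ δ) ^ 4 * (7 ^ d * (((n : ℝ) ^ δ) ^ 3 * Real.exp (-j) * (3 ^ d) ^ 3)) := by
        gcongr
    _ = (C * d ^ δ) ^ 4 * (7 ^ d * (3 ^ d) ^ 3) * (((n : ℝ) ^ δ)⁻¹ * Real.exp (-j)) := by
        rw [Real.div_rpow (Nat.cast_nonneg _) hn0'.le]
        field_simp
    _ ≤ (C * d ^ δ) ^ 4 * (7 ^ d * (3 ^ d) ^ 3) *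
          (((N : ℝ) ^ δ * r ^ δ) * (Real.exp 1 * r ^ β)) := by
        gcongr
    _ = _ := by
        rw [Real.rpow_add hr0]
        ring

end RegularMeasure

/-- **Improved additive energy bound for higher dimensional regular measures.**
For non-integer `0 < δ < d`, if `X ⊆ B(0,1) ⊆ ℝᵈ` is `δ`-regular on scales `[α,1]` with
constant `C` and associated regular measure `μ`, then `E(μ, r) ≤ A · r^(δ+β)` for all
`α ≤ r < 1`, where `β = exp(-K₁(1 + (log C)^K₂))` with `K₁, K₂ > 0` depending only on
`δ, d` and `A` depending only on `C, δ, d`. -/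
theorem additive_energy_regular_higher_dim :
    ∀ (d : ℕ), 1 ≤ d → ∀ δ : ℝ, 0 < δ → δ < d → (∀ n : ℤ, δ ≠ n) →
      ∃ K₁ K₂ : ℝ, 0 < K₁ ∧ 0 < K₂ ∧
        ∀ C : ℝ, 1 < C →
          ∃ A : ℝ, 0 < A ∧
            ∀ (α : ℝ) (X : Set (EuclideanSpace ℝ (Fin d)))
              (μ : Measure (EuclideanSpace ℝ (Fin d))),
              0 < α → α < 1 →
              X ⊆ closedBall 0 1 → IsClosed X → X.Nonempty →
              IsRegularMeasure δ α 1 C X μ →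
              ∀ r : ℝ, α ≤ r → r < 1 →
                addEnergy μ r ≤
                  ENNReal.ofReal
                    (A * r ^ (δ + Real.exp (-K₁ * (1 + Real.log C ^ K₂)))) := by
  intro d hd δ hδ _ hne
  have hk1 : 1 ≤ ⌈δ⌉₊ := Nat.one_le_iff_ne_zero.2 (Nat.ceil_pos.2 hδ).ne'
  have hk2 : (⌈δ⌉₊ : ℝ) - 1 < δ := by linarith [Nat.ceil_lt_add_one hδ.le]
  have hk3 : δ < ⌈δ⌉₊ := lt_of_le_of_ne (Nat.le_ceil δ) (by exact_mod_cast hne ⌈δ⌉₊)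
  obtain ⟨K, M₀, H⟩ := exists_quadCount_le (Fin d) ⌈δ⌉₊ hk1 hk2 hk3
  obtain ⟨c, hc⟩ : ∃ c : ℝ, c = 3 ^ d * (d + 1) ^ δ + 3 * 7 ^ d + M₀ := ⟨_, rfl⟩
  have hc1 : (0 : ℝ) ≤ 3 ^ d * (d + 1) ^ δ := by positivity
  have hc2 : (1 : ℝ) ≤ 7 ^ d := one_le_pow₀ (by norm_num)
  have hc3 : (0 : ℝ) ≤ M₀ := Nat.cast_nonneg _
  have hc4 : 1 ≤ c := by linarith
  have hK0 : (0 : ℝ) ≤ K := Nat.cast_nonneg _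
  have hlogc : 0 ≤ Real.log (2 * c) := Real.log_nonneg (by linarith)
  refine ⟨K * Real.log (2 * c) + 2 * K + 1, 1, by positivity, one_pos, fun C hC => ?_⟩
  have hC0 : 0 < C := by linarith
  have hlogC : 0 ≤ Real.log C := Real.log_nonneg hC.le
  have hCC : 1 ≤ C ^ 2 := one_le_pow₀ hC.le
  obtain ⟨M, hM⟩ : ∃ M : ℕ, M = ⌈c * C ^ 2⌉₊ := ⟨_, rfl⟩
  have hM1 : c * C ^ 2 ≤ M := hM ▸ Nat.le_ceil _
  have hM2 : (M : ℝ) ≤ 2 * c * C ^ 2 := by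
    have := Nat.ceil_lt_add_one (a := c * C ^ 2) (by positivity)
    rw [← hM] at this
    nlinarith
  have hcM : c ≤ M := by nlinarith
  have hM0 : (0 : ℝ) < M := by linarith
  obtain ⟨lam, m, hlam, hm, hlog, hE⟩ := H M (by
    have : (M₀ : ℝ) ≤ M := by linarith
    exact_mod_cast this)
  obtain ⟨N, hN⟩ : ∃ N : ℕ, lam ^ m = N := ⟨_, rfl⟩
  have hN1 : 1 < N := hN ▸ Nat.one_lt_pow (by omega) (by omega)
  have hN1' : (1 : ℝ) < N := by exact_mod_cast hN1
  have hN0 : (0 : ℝ) < N := by linarith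
  have hlogN : 0 < Real.log N := Real.log_pos hN1'
  have hlogN' : Real.log N = m * Real.log lam := by rw [← hN, Nat.cast_pow, Real.log_pow]
  have hβ : Real.exp (-(K * Real.log (2 * c) + 2 * K + 1) * (1 + Real.log C ^ (1 : ℝ))) ≤
      1 / Real.log N := by
    have h1 : Real.log N ≤ Real.exp ((K * Real.log (2 * c) + 2 * K + 1) * (1 + Real.log C)) := by
      calc Real.log N ≤ (M : ℝ) ^ K := by rw [hlogN']; exact hlog
        _ ≤ (2 * c * C ^ 2) ^ K := by gcongr
        _ = Real.exp (K * (Real.log (2 * c) + 2 * Real.log C)) := by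
            rw [Real.exp_nat_mul, Real.exp_add, Real.exp_log (by positivity),
              ← Real.log_rpow hC0, Real.exp_log (by positivity), Real.rpow_two]
        _ ≤ _ := by
            refine Real.exp_le_exp.2 ?_
            have h2 : 0 ≤ K * Real.log (2 * c) * Real.log C := by positivity
            nlinarith
    rw [Real.rpow_one, neg_mul, Real.exp_neg, one_div]
    exact inv_anti₀ hlogN h1
  refine ⟨(C * d ^ δ) ^ 4 * (7 ^ d * (3 ^ d) ^ 3) * ((N : ℝ) ^ δ * Real.exp 1), by positivity, ?_⟩
  intro α X μ hα0 _ hX _ _ hμ r hr hr1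
  exact hμ.addEnergy_le_rpow hd hX hδ hC0 (by omega) hN hN1 hβ (by nlinarith) (by nlinarith) hE
    (hα0.trans_le hr) hr hr1
end
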